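/- Let Ω ⊂ ℝⁿ be a bounded, open, connected set with smooth boundary such that for every function h continuous on cl Ω and harmonic in Ω one has (1/|Ω|) ∫_Ω h dx = (1/|∂Ω|) ∫_{∂Ω} h dσ, where dσ is the (n−1)-dimensional Hausdorff measure on ∂Ω. Then Ω is a ball. -/

import Mathlib

open MeasureTheory Set
open scoped Topology

noncomputable section

/-- The `i`-th standard basis vector of `EuclideanSpace ℝ (Fin n)`. -/
def stdVec (n : ℕ) (i : Fin n) : EuclideanSpace ℝ (Fin n) := EuclideanSpace.single i 1

/-- The second partial derivative `∂²u/∂xᵢ∂xⱼ`. -/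
noncomputable def secondDeriv (n : ℕ) (u : EuclideanSpace ℝ (Fin n) → ℝ) (i j : Fin n)
    (x : EuclideanSpace ℝ (Fin n)) : ℝ :=
  fderiv ℝ (fun y => fderiv ℝ u y (stdVec n j)) x (stdVec n i)

/-- The Euclidean Laplacian `Δu = ∑ i, ∂²u/∂xᵢ²`. -/
noncomputable def lap (n : ℕ) (u : EuclideanSpace ℝ (Fin n) → ℝ)
    (x : EuclideanSpace ℝ (Fin n)) : ℝ :=
  ∑ i, secondDeriv n u i i x

/-- `Ω` has `C^k` boundary: near every boundary point, `Ω` is the sublevel set of a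
`C^k` local defining function with nonvanishing gradient. -/
def HasCkBoundary {n : ℕ} (k : ℕ∞) (Ω : Set (EuclideanSpace ℝ (Fin n))) : Prop :=
  ∀ x ∈ frontier Ω, ∃ (U : Set (EuclideanSpace ℝ (Fin n))) (f : EuclideanSpace ℝ (Fin n) → ℝ),
    IsOpen U ∧ x ∈ U ∧ ContDiffOn ℝ k f U ∧ (∀ y ∈ U, gradient f y ≠ 0) ∧
    Ω ∩ U = {y ∈ U | f y < 0} ∧ frontier Ω ∩ U = {y ∈ U | f y = 0}

/-- `ν` is the outward unit normal vector field on the boundary of `Ω`. -/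
def IsOutwardUnitNormal {n : ℕ} (Ω : Set (EuclideanSpace ℝ (Fin n)))
    (ν : EuclideanSpace ℝ (Fin n) → EuclideanSpace ℝ (Fin n)) : Prop :=
  ∀ x ∈ frontier Ω, ‖ν x‖ = 1 ∧ ∃ ε > 0, ∀ t : ℝ, 0 < t → t < ε →
    x + t • ν x ∉ closure Ω ∧ x - t • ν x ∈ Ω

open scoped ContDiff

/-- Euclidean `n`-space. -/
abbrev Eu (n : ℕ) := EuclideanSpace ℝ (Fin n)

/-- The partial derivative `∂v/∂xᵢ`. -/
def pd {n : ℕ} (i : Fin n) (v : Eu n → ℝ) (x : Eu n) : ℝ := fderiv ℝ v x (stdVec n i)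

section PartialDerivatives

variable {n : ℕ} {i j : Fin n} {v w : Eu n → ℝ} {x : Eu n} {Ω : Set (Eu n)}

theorem lap_eq_sum_pd (v : Eu n → ℝ) (x : Eu n) : lap n v x = ∑ i, pd i (pd i v) x := rfl

theorem Filter.EventuallyEq.pd (h : v =ᶠ[𝓝 x] w) (i : Fin n) : pd i v =ᶠ[𝓝 x] pd i w := by
  filter_upwards [h.fderiv (𝕜 := ℝ)] with y hy
  simp only [_root_.pd, hy]

theorem lap_congr (h : v =ᶠ[𝓝 x] w) : lap n v x = lap n w x := by
  simp only [lap_eq_sum_pd, ((h.pd _).pd _).eq_of_nhds]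

theorem HasFDerivAt.pd_eq {v' : Eu n →L[ℝ] ℝ} (h : HasFDerivAt v v' x) (i : Fin n) :
    pd i v x = v' (stdVec n i) := by
  rw [pd, h.fderiv]

theorem pd_add (hv : DifferentiableAt ℝ v x) (hw : DifferentiableAt ℝ w x) :
    pd i (fun y => v y + w y) x = pd i v x + pd i w x :=
  (hv.hasFDerivAt.add hw.hasFDerivAt).pd_eq i

theorem pd_sub (hv : DifferentiableAt ℝ v x) (hw : DifferentiableAt ℝ w x) :
    pd i (fun y => v y - w y) x = pd i v x - pd i w x :=
  (hv.hasFDerivAt.sub hw.hasFDerivAt).pd_eq i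

theorem pd_mul (hv : DifferentiableAt ℝ v x) (hw : DifferentiableAt ℝ w x) :
    pd i (fun y => v y * w y) x = pd i v x * w x + v x * pd i w x := by
  have h : HasFDerivAt (fun y => v y * w y) _ x := hv.hasFDerivAt.mul hw.hasFDerivAt
  rw [h.pd_eq i]
  simp [pd, mul_comm, add_comm]

theorem pd_const (c : ℝ) : pd i (fun _ : Eu n => c) x = 0 := by
  simp [pd]

theorem pd_const_mul (c : ℝ) (hv : DifferentiableAt ℝ v x) :
    pd i (fun y => c * v y) x = c * pd i v x := by
  rw [pd_mul (by fun_prop) hv, pd_const]; ring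

theorem pd_sum {ι : Type*} (s : Finset ι) {v : ι → Eu n → ℝ}
    (hv : ∀ k ∈ s, DifferentiableAt ℝ (v k) x) :
    pd i (fun y => ∑ k ∈ s, v k y) x = ∑ k ∈ s, pd i (v k) x := by
  rw [(HasFDerivAt.fun_sum fun k hk => (hv k hk).hasFDerivAt).pd_eq i]
  simp [pd]

theorem pd_comp {φ : ℝ → ℝ} {φ' : ℝ} (hφ : HasDerivAt φ φ' (v x)) (hv : DifferentiableAt ℝ v x) :
    pd i (fun y => φ (v y)) x = φ' * pd i v x := by
  have h : HasFDerivAt (fun y => φ (v y)) _ x := hφ.comp_hasFDerivAt x hv.hasFDerivAt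
  rw [h.pd_eq i]
  simp [pd]

theorem pd_coord : pd i (fun y : Eu n => y j) x = if i = j then 1 else 0 := by
  have : HasFDerivAt (fun y : Eu n => y j) (EuclideanSpace.proj j : Eu n →L[ℝ] ℝ) x :=
    (EuclideanSpace.proj j : Eu n →L[ℝ] ℝ).hasFDerivAt
  rw [this.pd_eq i]
  simp [stdVec, eq_comm]

theorem pd_comp_sub_right (z : Eu n) : pd i (fun y => v (y - z)) x = pd i v (x - z) := by
  simp only [pd]
  rw [fderiv_comp_sub]

theorem pd_norm_sq : pd i (fun y : Eu n => ‖y‖ ^ 2) x = 2 * x i := by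
  have : (fun y : Eu n => ‖y‖ ^ 2) = fun y => ∑ j, y j * y j := by
    ext y; rw [EuclideanSpace.norm_sq_eq]; simp [← sq]
  rw [this, pd_sum _ (fun k _ => by fun_prop)]
  have h : ∀ k, pd i (fun y : Eu n => y k * y k) x = if i = k then 2 * x k else 0 := fun k => by
    rw [pd_mul (by fun_prop) (by fun_prop), pd_coord]
    split_ifs <;> ring
  simp [h]

theorem norm_fderiv_le_sum_pd (v : Eu n → ℝ) (x : Eu n) : ‖fderiv ℝ v x‖ ≤ ∑ i, |pd i v x| := by
  refine ContinuousLinearMap.opNorm_le_bound _ (by positivity) fun y => ?_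
  have hy : y = ∑ i, y i • stdVec n i := by
    ext k; simp [stdVec, Pi.single_apply, Finset.sum_apply]
  conv_lhs => rw [hy]
  rw [map_sum, Finset.sum_mul]
  refine (norm_sum_le _ _).trans (Finset.sum_le_sum fun k _ => ?_)
  rw [map_smul, norm_smul, mul_comm]
  exact mul_le_mul_of_nonneg_left (PiLp.norm_apply_le y k) (abs_nonneg _)

theorem fderiv_eq_zero_of_pd (h : ∀ i, pd i v x = 0) : fderiv ℝ v x = 0 := by
  have := norm_fderiv_le_sum_pd v x
  simp only [h, abs_zero, Finset.sum_const_zero] at this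
  exact norm_le_zero_iff.1 this

theorem ContDiffOn.pd (hΩ : IsOpen Ω) (hv : ContDiffOn ℝ ∞ v Ω) (i : Fin n) :
    ContDiffOn ℝ ∞ (pd i v) Ω :=
  (hv.fderiv_of_isOpen hΩ (m := ∞) (by simp)).clm_apply contDiffOn_const

theorem ContDiff.pd (hv : ContDiff ℝ ∞ v) (i : Fin n) : ContDiff ℝ ∞ (pd i v) :=
  contDiffOn_univ.1 (ContDiffOn.pd isOpen_univ hv.contDiffOn i)

theorem HasCompactSupport.pd (hv : HasCompactSupport v) (i : Fin n) :
    HasCompactSupport (pd i v) :=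
  hv.fderiv_apply ℝ _

theorem ContDiffOn.differentiableAt_of_isOpen (hΩ : IsOpen Ω) (hv : ContDiffOn ℝ ∞ v Ω)
    (hx : x ∈ Ω) : DifferentiableAt ℝ v x :=
  (hv.contDiffAt (hΩ.mem_nhds hx)).differentiableAt (by simp)

theorem ContDiffAt.eventually_differentiableAt (hv : ContDiffAt ℝ ∞ v x) :
    ∀ᶠ y in 𝓝 x, DifferentiableAt ℝ v y :=
  ((hv.of_le (m := 1) (by norm_cast)).eventually (by simp)).mono
    fun _ hy => hy.differentiableAt (by simp)

theorem ContDiffAt.pd (hv : ContDiffAt ℝ ∞ v x) (i : Fin n) : ContDiffAt ℝ ∞ (pd i v) x :=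
  (hv.fderiv_right (m := ∞) (by simp)).clm_apply contDiffAt_const

theorem pd_comm (hv : ContDiffAt ℝ ∞ v x) : pd i (pd j v) x = pd j (pd i v) x := by
  have hd : DifferentiableAt ℝ (fderiv ℝ v) x :=
    (hv.fderiv_right (m := 1) (by norm_cast)).differentiableAt (by simp)
  have h : ∀ k l : Fin n, pd k (pd l v) x = fderiv ℝ (fderiv ℝ v) x (stdVec n k) (stdVec n l) := by
    intro k l
    have : HasFDerivAt (pd l v)
        ((ContinuousLinearMap.apply ℝ ℝ (stdVec n l)).comp (fderiv ℝ (fderiv ℝ v) x)) x :=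
      ((ContinuousLinearMap.apply ℝ ℝ (stdVec n l)).hasFDerivAt).comp x hd.hasFDerivAt
    rw [this.pd_eq k]; simp
  rw [h, h]
  exact (hv.isSymmSndFDerivAt (by simp; exact WithTop.coe_le_coe.2 le_top)).eq _ _

theorem lap_add (hv : ContDiffAt ℝ ∞ v x) (hw : ContDiffAt ℝ ∞ w x) :
    lap n (fun y => v y + w y) x = lap n v x + lap n w x := by
  simp only [lap_eq_sum_pd, ← Finset.sum_add_distrib]
  refine Finset.sum_congr rfl fun i _ => ?_
  have h : pd i (fun y => v y + w y) =ᶠ[𝓝 x] fun y => pd i v y + pd i w y := by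
    filter_upwards [hv.eventually_differentiableAt, hw.eventually_differentiableAt] with y hy hy'
    exact pd_add hy hy'
  rw [(h.pd i).eq_of_nhds, pd_add]
  · exact (hv.pd i).differentiableAt (by simp)
  · exact (hw.pd i).differentiableAt (by simp)

theorem lap_const_mul (c : ℝ) (hv : ContDiffAt ℝ ∞ v x) :
    lap n (fun y => c * v y) x = c * lap n v x := by
  simp only [lap_eq_sum_pd, Finset.mul_sum]
  refine Finset.sum_congr rfl fun i _ => ?_
  have h : pd i (fun y => c * v y) =ᶠ[𝓝 x] fun y => c * pd i v y := by
    filter_upwards [hv.eventually_differentiableAt] with y hy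
    exact pd_const_mul c hy
  rw [(h.pd i).eq_of_nhds, pd_const_mul]
  exact (hv.pd i).differentiableAt (by simp)

theorem lap_sub (hv : ContDiffAt ℝ ∞ v x) (hw : ContDiffAt ℝ ∞ w x) :
    lap n (fun y => v y - w y) x = lap n v x - lap n w x := by
  have : (fun y => v y - w y) = fun y => v y + (-1) * w y := by ext; ring
  rw [this, lap_add hv (contDiffAt_const.mul hw), lap_const_mul _ hw]; ring

theorem integral_mul_pd_eq_neg {v w : Eu n → ℝ} (hv : ContDiff ℝ 1 v) (hw : ContDiff ℝ 1 w)
    (hc : HasCompactSupport w) (i : Fin n) :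
    ∫ x, v x * pd i w x = -∫ x, pd i v x * w x := by
  have h1 : Continuous (fun x => fderiv ℝ v x (stdVec n i)) :=
    (hv.continuous_fderiv (by simp)).clm_apply continuous_const
  have h2 : Continuous (fun x => fderiv ℝ w x (stdVec n i)) :=
    (hw.continuous_fderiv (by simp)).clm_apply continuous_const
  refine integral_mul_fderiv_eq_neg_fderiv_mul_of_integrable ?_ ?_ ?_ ?_ ?_
  · exact (h1.mul hw.continuous).integrable_of_hasCompactSupport hc.mul_left
  · exact (hv.continuous.mul h2).integrable_of_hasCompactSupport (hc.fderiv_apply ℝ _).mul_left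
  · exact (hv.continuous.mul hw.continuous).integrable_of_hasCompactSupport hc.mul_left
  · exact fun x _ => hv.differentiable (by simp) x
  · exact fun x _ => hw.differentiable (by simp) x

theorem integral_pd_eq_zero (hw : ContDiff ℝ 1 w) (hc : HasCompactSupport w) (i : Fin n) :
    ∫ x, pd i w x = 0 := by
  have := integral_mul_pd_eq_neg (v := fun _ : Eu n => (1 : ℝ)) contDiff_const hw hc i
  simpa [pd_const] using this

end PartialDerivatives

section MaximumPrinciple

variable {n : ℕ} {Ω : Set (Eu n)}

theorem exists_compact_abs_sub_lt_of_tendsto_frontier (hΩb : Bornology.IsBounded Ω)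
    {F : Eu n → ℝ} {L : ℝ}
    (hF : ContinuousOn F Ω) (hL : ∀ x ∈ frontier Ω, Filter.Tendsto F (𝓝[Ω] x) (𝓝 L))
    {δ : ℝ} (hδ : 0 < δ) :
    ∃ K ⊆ Ω, IsCompact K ∧ ∀ x ∈ Ω \ K, |F x - L| < δ := by
  refine ⟨{x ∈ Ω | δ ≤ |F x - L|}, fun x hx => hx.1, ?_, fun x hx => ?_⟩
  · refine Metric.isCompact_of_isClosed_isBounded ?_ (hΩb.subset fun x hx => hx.1)
    refine isClosed_of_closure_subset fun x hx => ?_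
    have hxΩ : x ∈ closure Ω := closure_mono (fun y hy => hy.1) hx
    have key : ∀ L', Filter.Tendsto F (𝓝[Ω] x) (𝓝 L') → δ ≤ |L' - L| := by
      intro L' h
      have h' : Filter.Tendsto F (𝓝[{x ∈ Ω | δ ≤ |F x - L|}] x) (𝓝 L') :=
        h.mono_left (nhdsWithin_mono _ fun y hy => hy.1)
      have : (𝓝[{x ∈ Ω | δ ≤ |F x - L|}] x).NeBot := mem_closure_iff_nhdsWithin_neBot.1 hx
      exact ge_of_tendsto (h'.sub_const L).abs
        (Filter.eventually_of_mem self_mem_nhdsWithin fun y hy => hy.2)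
    by_cases hxo : x ∈ Ω
    · exact ⟨hxo, key _ (hF x hxo)⟩
    · have := key L (hL x ⟨hxΩ, fun h => hxo (interior_subset h)⟩)
      simp at this
      linarith
  · by_contra h
    exact hx.2 ⟨hx.1, not_lt.1 h⟩

theorem pd_pd_nonpos_of_isLocalMax {w : Eu n → ℝ} {q : Eu n} (hw : ContDiffAt ℝ ∞ w q)
    (hq : IsLocalMax w q) (i : Fin n) : pd i (pd i w) q ≤ 0 := by
  by_contra! hpos
  set ℓ : ℝ → Eu n := fun t => q + t • stdVec n i with hℓ
  have hℓ0 : ℓ 0 = q := by simp [hℓ]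
  have hℓd : ∀ t, HasDerivAt ℓ (stdVec n i) t := fun t => by
    simpa [hℓ] using ((hasDerivAt_id t).smul_const (stdVec n i)).const_add q
  have hℓc : Filter.Tendsto ℓ (𝓝 0) (𝓝 q) := by
    have := (hℓd 0).continuousAt; rwa [ContinuousAt, hℓ0] at this
  have hder : ∀ v : Eu n → ℝ, ∀ t, DifferentiableAt ℝ v (ℓ t) →
      HasDerivAt (fun t => v (ℓ t)) (pd i v (ℓ t)) t := fun v t hv =>
    hv.hasFDerivAt.comp_hasDerivAt t (hℓd t)
  have h1 : deriv (fun t => w (ℓ t)) =ᶠ[𝓝 0] fun t => pd i w (ℓ t) := by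
    filter_upwards [hℓc.eventually hw.eventually_differentiableAt] with t ht
    exact (hder w t ht).deriv
  have hd0 : DifferentiableAt ℝ (pd i w) (ℓ 0) := by
    rw [hℓ0]; exact (hw.pd i).differentiableAt (by simp)
  have h2 : deriv (deriv (fun t => w (ℓ t))) 0 = pd i (pd i w) q := by
    rw [h1.deriv_eq, (hder _ 0 hd0).deriv, hℓ0]
  have hmax : IsLocalMax (fun t => w (ℓ t)) 0 := by
    have : ∀ᶠ t in 𝓝 (0 : ℝ), w (ℓ t) ≤ w q := hℓc.eventually hq
    simpa [IsLocalMax, IsMaxFilter, hℓ0] using this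
  have hcont : ContinuousAt (fun t => w (ℓ t)) 0 :=
    (hder w 0 (by rw [hℓ0]; exact hw.differentiableAt (by simp))).continuousAt
  have hmin := isLocalMin_of_deriv_deriv_pos (by rw [h2]; exact hpos) hmax.deriv_eq_zero hcont
  have hconst : (fun t => w (ℓ t)) =ᶠ[𝓝 0] fun _ => w (ℓ 0) := by
    filter_upwards [hmax, hmin] with t ht ht'
    exact le_antisymm ht ht'
  have : deriv (deriv (fun t => w (ℓ t))) 0 = 0 := by
    rw [hconst.deriv.deriv_eq]; simp
  linarith

theorem lap_nonpos_of_isLocalMax {w : Eu n → ℝ} {q : Eu n} (hw : ContDiffAt ℝ ∞ w q)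
    (hq : IsLocalMax w q) : lap n w q ≤ 0 := by
  rw [lap_eq_sum_pd]
  exact Finset.sum_nonpos fun i _ => pd_pd_nonpos_of_isLocalMax hw hq i

theorem lap_norm_sq (x : Eu n) : lap n (fun y => ‖y‖ ^ 2) x = 2 * n := by
  rw [lap_eq_sum_pd]
  have : ∀ i : Fin n, pd i (pd i fun y : Eu n => ‖y‖ ^ 2) x = 2 := fun i => by
    have h : (pd i fun y : Eu n => ‖y‖ ^ 2) = fun y => 2 * y i := by
      ext y; exact pd_norm_sq
    rw [h, pd_const_mul _ (by fun_prop), pd_coord]; simp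
  simp [this, mul_comm]

theorem le_of_lap_nonneg (hn : 0 < n) (hΩo : IsOpen Ω) (hΩb : Bornology.IsBounded Ω)
    {v : Eu n → ℝ} (hv : ContDiffOn ℝ ∞ v Ω) (hlap : ∀ x ∈ Ω, 0 ≤ lap n v x) {M : ℝ}
    (hM : ∀ δ > 0, ∃ K ⊆ Ω, IsCompact K ∧ ∀ x ∈ Ω \ K, v x < M + δ) :
    ∀ x ∈ Ω, v x ≤ M := by
  intro p hp
  by_contra! hlt
  obtain ⟨R, hR0, hR⟩ : ∃ R > 0, ∀ x ∈ Ω, ‖x‖ ≤ R := hΩb.exists_pos_norm_le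
  set δ := (v p - M) / 2 with hδ
  have hδ0 : 0 < δ := by rw [hδ]; linarith
  obtain ⟨K, hKΩ, hK, hKv⟩ := hM δ hδ0
  have hpK : p ∈ K := by
    by_contra h
    have := hKv p ⟨hp, h⟩
    linarith
  set ε := δ / R ^ 2 with hε
  have hε0 : 0 < ε := by positivity
  set w : Eu n → ℝ := fun x => v x + ε * ‖x‖ ^ 2 with hw
  have hsq : ContDiff ℝ ∞ (fun x : Eu n => ‖x‖ ^ 2) := contDiff_norm_sq ℝ
  have hwc : ContDiffOn ℝ ∞ w Ω := hv.add (contDiff_const.mul hsq).contDiffOn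
  obtain ⟨q, hqK, hq⟩ := hK.exists_isMaxOn ⟨p, hpK⟩ (hwc.continuousOn.mono hKΩ)
  have hqΩ := hKΩ hqK
  have hwp : v p ≤ w q := by
    have h1 : w p ≤ w q := hq hpK
    have h2 : 0 ≤ ε * ‖p‖ ^ 2 := by positivity
    simp only [hw] at h1 ⊢
    linarith
  have hloc : IsLocalMax w q := by
    filter_upwards [hΩo.mem_nhds hqΩ] with x hx
    by_cases hxK : x ∈ K
    · exact hq hxK
    · have h1 := hKv x ⟨hx, hxK⟩
      have h2 : ε * ‖x‖ ^ 2 ≤ δ := by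
        rw [hε, div_mul_eq_mul_div, div_le_iff₀ (by positivity)]
        have := hR x hx
        gcongr
      have : w x ≤ M + 2 * δ := by simp only [hw]; linarith
      linarith
  have h1 := lap_nonpos_of_isLocalMax (hwc.contDiffAt (hΩo.mem_nhds hqΩ)) hloc
  have h2 : lap n w q = lap n v q + ε * (2 * n) := by
    rw [hw, lap_add (hv.contDiffAt (hΩo.mem_nhds hqΩ)) (contDiff_const.mul hsq).contDiffAt,
      lap_const_mul _ hsq.contDiffAt, lap_norm_sq]
  have h3 := hlap q hqΩ
  have : 0 < ε * (2 * n) := by positivity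
  linarith

end MaximumPrinciple

/-- `u` solves `Δu = a` in `Ω`, vanishes off `Ω`, and `|∇u|² = C` on `∂Ω`. -/
structure IsOverdetermined {n : ℕ} (Ω : Set (Eu n)) (u : Eu n → ℝ) (a C : ℝ) : Prop where
  pos_dim : 0 < n
  isOpen : IsOpen Ω
  isConnected : IsConnected Ω
  isBounded : Bornology.IsBounded Ω
  continuous : Continuous u
  eq_zero : ∀ x ∉ Ω, u x = 0
  contDiffOn : ContDiffOn ℝ ∞ u Ω
  lap_eq : ∀ x ∈ Ω, lap n u x = a
  a_pos : 0 < a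
  C_pos : 0 < C
  tendsto_grad : ∀ x ∈ frontier Ω,
    Filter.Tendsto (fun y => ∑ i, pd i u y ^ 2) (𝓝[Ω] x) (𝓝 C)

namespace IsOverdetermined

variable {n : ℕ} {Ω : Set (Eu n)} {u : Eu n → ℝ} {a C : ℝ}

theorem tendsto_frontier (h : IsOverdetermined Ω u a C) {x : Eu n} (hx : x ∈ frontier Ω) :
    Filter.Tendsto u (𝓝[Ω] x) (𝓝 0) := by
  have h0 : u x = 0 := h.eq_zero x fun hxo => by
    rw [frontier, h.isOpen.interior_eq] at hx; exact hx.2 hxo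
  have := h.continuous.continuousAt (x := x)
  rw [ContinuousAt, h0] at this
  exact this.mono_left nhdsWithin_le_nhds

theorem neg (h : IsOverdetermined Ω u a C) : ∀ x ∈ Ω, u x < 0 := by
  have hle : ∀ x ∈ Ω, u x ≤ 0 := by
    refine le_of_lap_nonneg h.pos_dim h.isOpen h.isBounded h.contDiffOn
      (fun x hx => by rw [h.lap_eq x hx]; exact h.a_pos.le) fun δ hδ => ?_
    obtain ⟨K, hK, hKc, hKu⟩ := exists_compact_abs_sub_lt_of_tendsto_frontier h.isBounded
      h.contDiffOn.continuousOn (fun x hx => h.tendsto_frontier hx) hδ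
    exact ⟨K, hK, hKc, fun x hx => by linarith [(abs_lt.1 (hKu x hx)).2]⟩
  intro x hx
  refine lt_of_le_of_ne (hle x hx) fun h0 => ?_
  have hloc : IsLocalMax u x := by
    filter_upwards [h.isOpen.mem_nhds hx] with y hy
    rw [h0]; exact hle y hy
  have := lap_nonpos_of_isLocalMax (h.contDiffOn.contDiffAt (h.isOpen.mem_nhds hx)) hloc
  rw [h.lap_eq x hx] at this
  linarith [h.a_pos]

theorem exists_le_neg_of_isCompact (h : IsOverdetermined Ω u a C) {K : Set (Eu n)}
    (hK : IsCompact K) (hKΩ : K ⊆ Ω) : ∃ ε > 0, ∀ x ∈ K, u x ≤ -ε := by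
  rcases K.eq_empty_or_nonempty with rfl | hne
  · exact ⟨1, one_pos, by simp⟩
  obtain ⟨q, hq, hqm⟩ := hK.exists_isMaxOn hne h.continuous.continuousOn
  exact ⟨-u q, by linarith [h.neg q (hKΩ hq)], fun x hx => by simpa using hqm hx⟩

theorem contDiffOn_pd (h : IsOverdetermined Ω u a C) (i : Fin n) : ContDiffOn ℝ ∞ (pd i u) Ω :=
  h.contDiffOn.pd h.isOpen i

theorem contDiffOn_grad_sq (h : IsOverdetermined Ω u a C) :
    ContDiffOn ℝ ∞ (fun y => ∑ i, pd i u y ^ 2) Ω :=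
  ContDiffOn.sum fun i _ => (h.contDiffOn_pd i).pow 2

theorem pd_lap (h : IsOverdetermined Ω u a C) {x : Eu n} (hx : x ∈ Ω) (j : Fin n) :
    lap n (pd j u) x = 0 := by
  have hnh := h.isOpen.mem_nhds hx
  have hu := h.contDiffOn.contDiffAt hnh
  have h1 : ∀ i : Fin n, pd i (pd i (pd j u)) x = pd j (pd i (pd i u)) x := fun i => by
    have : pd i (pd j u) =ᶠ[𝓝 x] pd j (pd i u) := by
      filter_upwards [hnh] with y hy
      exact pd_comm (h.contDiffOn.contDiffAt (h.isOpen.mem_nhds hy))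
    rw [(this.pd i).eq_of_nhds, pd_comm (hu.pd i)]
  rw [lap_eq_sum_pd, Finset.sum_congr rfl fun i _ => h1 i, ← pd_sum]
  · have : (fun y => ∑ k, pd k (pd k u) y) =ᶠ[𝓝 x] fun _ => a := by
      filter_upwards [hnh] with y hy using h.lap_eq y hy
    rw [(this.pd j).eq_of_nhds, pd_const]
  · exact fun k _ => ((hu.pd k).pd k).differentiableAt (by simp)

theorem sum_pd_coord_mul (h : IsOverdetermined Ω u a C) {x : Eu n} (hx : x ∈ Ω) (i : Fin n) :
    pd i (fun y => ∑ j, y j * pd j u y) x = pd i u x + ∑ j, x j * pd j (pd i u) x := by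
  have hu := h.contDiffOn.contDiffAt (h.isOpen.mem_nhds hx)
  have hd : ∀ j, DifferentiableAt ℝ (pd j u) x := fun j => (hu.pd j).differentiableAt (by simp)
  rw [pd_sum _ (fun j _ => by have := hd j; fun_prop)]
  have : ∀ j, pd i (fun y => y j * pd j u y) x
      = (if i = j then pd j u x else 0) + x j * pd j (pd i u) x := fun j => by
    rw [pd_mul (by fun_prop) (hd j), pd_coord, pd_comm hu]
    split_ifs <;> simp
  simp [this, Finset.sum_add_distrib]

/-- The function `x · ∇u - 2u` is harmonic. -/
theorem lap_euler (h : IsOverdetermined Ω u a C) {x : Eu n} (hx : x ∈ Ω) :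
    lap n (fun y => (∑ j, y j * pd j u y) - 2 * u y) x = 0 := by
  have hu := h.contDiffOn.contDiffAt (h.isOpen.mem_nhds hx)
  have hs : ContDiffAt ℝ ∞ (fun y => ∑ j, y j * pd j u y) x :=
    ContDiffAt.sum fun j _ => ContDiffAt.mul (by fun_prop) (hu.pd j)
  rw [lap_sub hs (contDiffAt_const.mul hu), lap_const_mul _ hu, h.lap_eq x hx, lap_eq_sum_pd]
  have h1 : ∀ i : Fin n, pd i (pd i fun y => ∑ j, y j * pd j u y) x
      = 2 * pd i (pd i u) x + ∑ j, x j * pd i (pd i (pd j u)) x := fun i => by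
    have : (pd i fun y => ∑ j, y j * pd j u y) =ᶠ[𝓝 x]
        fun y => pd i u y + ∑ j, y j * pd i (pd j u) y := by
      filter_upwards [h.isOpen.mem_nhds hx] with y hy
      rw [h.sum_pd_coord_mul hy]
      simp only [pd_comm (h.contDiffOn.contDiffAt (h.isOpen.mem_nhds hy)) (i := i)]
    have hd : ∀ j, DifferentiableAt ℝ (pd i (pd j u)) x :=
      fun j => ((hu.pd j).pd i).differentiableAt (by simp)
    have hm : ∀ j, DifferentiableAt ℝ (fun y : Eu n => y j * pd i (pd j u) y) x :=
      fun j => by have := hd j; fun_prop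
    rw [(this.pd i).eq_of_nhds, pd_add ((hu.pd i).differentiableAt (by simp))
      (DifferentiableAt.fun_sum fun j _ => hm j), pd_sum _ fun j _ => hm j]
    have h2 : ∀ j, pd i (fun y => y j * pd i (pd j u) y) x
        = (if i = j then pd i (pd j u) x else 0) + x j * pd i (pd i (pd j u)) x := fun j => by
      rw [pd_mul (by fun_prop) (hd j), pd_coord]
      split_ifs <;> simp
    simp [h2, Finset.sum_add_distrib]; ring
  simp only [h1, Finset.sum_add_distrib, ← Finset.mul_sum]
  rw [Finset.sum_comm]
  simp only [← Finset.mul_sum, ← lap_eq_sum_pd, h.pd_lap hx, h.lap_eq x hx]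
  simp

theorem lap_grad_sq (h : IsOverdetermined Ω u a C) {x : Eu n} (hx : x ∈ Ω) :
    lap n (fun y => ∑ j, pd j u y ^ 2) x = 2 * ∑ i, ∑ j, pd i (pd j u) x ^ 2 := by
  have hu := h.contDiffOn.contDiffAt (h.isOpen.mem_nhds hx)
  have h1 : ∀ i : Fin n, pd i (pd i fun y => ∑ j, pd j u y ^ 2) x
      = 2 * ∑ j, pd i (pd j u) x ^ 2 + 2 * ∑ j, pd j u x * pd i (pd i (pd j u)) x := fun i => by
    have : (pd i fun y => ∑ j, pd j u y ^ 2) =ᶠ[𝓝 x]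
        fun y => ∑ j, 2 * (pd j u y * pd i (pd j u) y) := by
      filter_upwards [h.isOpen.mem_nhds hx] with y hy
      have hd : ∀ j, DifferentiableAt ℝ (pd j u) y :=
        fun j => (h.contDiffOn_pd j).differentiableAt_of_isOpen h.isOpen hy
      rw [pd_sum _ fun j _ => (hd j).fun_pow 2]
      refine Finset.sum_congr rfl fun j _ => ?_
      simp only [sq]
      rw [pd_mul (hd j) (hd j)]; ring
    have hd : ∀ j, DifferentiableAt ℝ (pd j u) x := fun j => (hu.pd j).differentiableAt (by simp)
    have hd' : ∀ j, DifferentiableAt ℝ (pd i (pd j u)) x :=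
      fun j => ((hu.pd j).pd i).differentiableAt (by simp)
    rw [(this.pd i).eq_of_nhds, pd_sum _ fun j _ => ((hd j).fun_mul (hd' j)).const_mul 2,
      Finset.mul_sum, Finset.mul_sum, ← Finset.sum_add_distrib]
    refine Finset.sum_congr rfl fun j _ => ?_
    rw [pd_const_mul _ ((hd j).fun_mul (hd' j)), pd_mul (hd j) (hd' j)]; ring
  rw [lap_eq_sum_pd]
  simp only [h1, Finset.sum_add_distrib, ← Finset.mul_sum]
  rw [Finset.sum_comm (f := fun i j => pd j u x * pd i (pd i (pd j u)) x)]
  simp only [← Finset.mul_sum, ← lap_eq_sum_pd, h.pd_lap hx]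
  simp

end IsOverdetermined

section Cutoff

/-- A smooth nondecreasing function equal to `0` on `(-∞, 1]` and to `1` on `[2, ∞)`. -/
def cutoff (s : ℝ) : ℝ := Real.smoothTransition (s - 1)

theorem contDiff_cutoff : ContDiff ℝ ∞ cutoff :=
  Real.smoothTransition.contDiff.comp (contDiff_id.sub contDiff_const)

theorem cutoff_of_le {s : ℝ} (hs : s ≤ 1) : cutoff s = 0 :=
  Real.smoothTransition.zero_of_nonpos (by linarith)

theorem cutoff_of_ge {s : ℝ} (hs : 2 ≤ s) : cutoff s = 1 :=
  Real.smoothTransition.one_of_one_le (by linarith)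

theorem cutoff_nonneg (s : ℝ) : 0 ≤ cutoff s := Real.smoothTransition.nonneg _

theorem cutoff_le_one (s : ℝ) : cutoff s ≤ 1 := Real.smoothTransition.le_one _

theorem monotone_cutoff : Monotone cutoff := fun _ _ h =>
  Real.smoothTransition.monotone (by linarith)

theorem deriv_cutoff_nonneg (s : ℝ) : 0 ≤ deriv cutoff s := monotone_cutoff.deriv_nonneg

theorem continuous_deriv_cutoff : Continuous (deriv cutoff) :=
  contDiff_cutoff.continuous_deriv (by simp)

theorem deriv_cutoff_of_lt {s : ℝ} (hs : s < 1) : deriv cutoff s = 0 := by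
  have : cutoff =ᶠ[𝓝 s] fun _ => 0 := by
    filter_upwards [Iio_mem_nhds hs] with t ht using cutoff_of_le (le_of_lt ht)
  rw [this.deriv_eq]; simp

theorem deriv_cutoff_of_gt {s : ℝ} (hs : 2 < s) : deriv cutoff s = 0 := by
  have : cutoff =ᶠ[𝓝 s] fun _ => 1 := by
    filter_upwards [Ioi_mem_nhds hs] with t ht using cutoff_of_ge (le_of_lt ht)
  rw [this.deriv_eq]; simp

theorem deriv_cutoff_of_le {s : ℝ} (hs : s ≤ 1) : deriv cutoff s = 0 := by
  have : closure (Iio (1 : ℝ)) ⊆ {s | deriv cutoff s = 0} :=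
    closure_minimal (fun s hs => deriv_cutoff_of_lt hs)
      (isClosed_eq continuous_deriv_cutoff continuous_const)
  rw [closure_Iio] at this
  exact this hs

theorem exists_abs_mul_deriv_cutoff_le : ∃ B, ∀ s, |s * deriv cutoff s| ≤ B := by
  obtain ⟨B, hB⟩ := (isCompact_Icc (a := (1 : ℝ)) (b := 2)).exists_bound_of_continuousOn
    (f := fun s => s * deriv cutoff s) (continuous_id.mul continuous_deriv_cutoff).continuousOn
  refine ⟨max B 0, fun s => ?_⟩
  by_cases hs : s ∈ Icc (1 : ℝ) 2
  · exact (hB s hs).trans (le_max_left _ _)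
  · have : deriv cutoff s = 0 := by
      rw [mem_Icc, not_and_or, not_le, not_le] at hs
      exact hs.elim deriv_cutoff_of_lt deriv_cutoff_of_gt
    simp [this]

/-- The primitive of `cutoff` vanishing at the origin. -/
def cutoffPrimitive (s : ℝ) : ℝ := ∫ t in (0 : ℝ)..s, cutoff t

theorem hasDerivAt_cutoffPrimitive (s : ℝ) : HasDerivAt cutoffPrimitive (cutoff s) s :=
  intervalIntegral.integral_hasDerivAt_right
    (contDiff_cutoff.continuous.intervalIntegrable _ _)
    (contDiff_cutoff.continuous.stronglyMeasurableAtFilter _ _)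
    contDiff_cutoff.continuous.continuousAt

theorem deriv_cutoffPrimitive : deriv cutoffPrimitive = cutoff :=
  funext fun s => (hasDerivAt_cutoffPrimitive s).deriv

theorem contDiff_cutoffPrimitive : ContDiff ℝ ∞ cutoffPrimitive :=
  contDiff_infty_iff_deriv.2 ⟨fun s => (hasDerivAt_cutoffPrimitive s).differentiableAt,
    by rw [deriv_cutoffPrimitive]; exact contDiff_cutoff⟩

theorem cutoffPrimitive_of_le {s : ℝ} (hs : s ≤ 1) : cutoffPrimitive s = 0 := by
  rw [cutoffPrimitive, intervalIntegral.integral_congr (g := fun _ => 0)]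
  · simp
  · intro t ht
    have : t ≤ 1 := by
      rcases mem_uIcc.1 ht with h | h <;> linarith [h.2]
    exact cutoff_of_le this

end Cutoff

namespace IsOverdetermined

variable {n : ℕ} {Ω : Set (Eu n)} {u : Eu n → ℝ} {a C : ℝ}

theorem exists_compact_cutoff (h : IsOverdetermined Ω u a C) (k : ℝ) :
    ∃ K ⊆ Ω, IsCompact K ∧ ∀ x ∉ K, ∀ᶠ y in 𝓝 x, -k * u y ≤ 1 := by
  refine ⟨{x | 1 ≤ -k * u x}, fun x hx => ?_, ?_, fun x hx => ?_⟩
  · by_contra hxo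
    simp only [mem_ofPred_eq, h.eq_zero x hxo] at hx
    linarith
  · have hcl : IsClosed {x | 1 ≤ -k * u x} :=
      isClosed_le continuous_const (continuous_const.mul h.continuous)
    refine Metric.isCompact_of_isClosed_isBounded hcl (h.isBounded.subset fun x hx => ?_)
    by_contra hxo
    simp only [mem_ofPred_eq, h.eq_zero x hxo] at hx
    linarith
  · have : -k * u x < 1 := not_le.1 hx
    exact ((continuous_const.mul h.continuous).continuousAt.eventually_lt
      continuousAt_const this).mono fun y hy => le_of_lt hy

theorem hasCompactSupport_cutoff (h : IsOverdetermined Ω u a C) (k : ℝ) {ψ : ℝ → ℝ}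
    (hψ : ∀ s ≤ 1, ψ s = 0) (F : Eu n → ℝ) :
    HasCompactSupport fun x => ψ (-k * u x) * F x := by
  obtain ⟨K, -, hKc, hK⟩ := h.exists_compact_cutoff k
  exact HasCompactSupport.intro hKc fun x hx => by
    rw [hψ _ (hK x hx).self_of_nhds, zero_mul]

theorem continuous_cutoff (h : IsOverdetermined Ω u a C) (k : ℝ) {ψ : ℝ → ℝ}
    (hψc : Continuous ψ) (hψ : ∀ s ≤ 1, ψ s = 0) {F : Eu n → ℝ} (hF : ContinuousOn F Ω) :
    Continuous fun x => ψ (-k * u x) * F x := by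
  obtain ⟨K, hKΩ, -, hK⟩ := h.exists_compact_cutoff k
  refine continuous_iff_continuousAt.2 fun x => ?_
  by_cases hx : x ∈ K
  · exact (hψc.comp (continuous_const.mul h.continuous)).continuousAt.mul
      (hF.continuousAt (h.isOpen.mem_nhds (hKΩ hx)))
  · have : (fun x => ψ (-k * u x) * F x) =ᶠ[𝓝 x] fun _ => 0 := by
      filter_upwards [hK x hx] with y hy
      rw [hψ _ hy, zero_mul]
    exact continuousAt_const.congr this.symm

theorem contDiff_cutoff (h : IsOverdetermined Ω u a C) (k : ℝ) {ψ : ℝ → ℝ}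
    (hψc : ContDiff ℝ ∞ ψ) (hψ : ∀ s ≤ 1, ψ s = 0) {F : Eu n → ℝ} (hF : ContDiffOn ℝ ∞ F Ω) :
    ContDiff ℝ ∞ fun x => ψ (-k * u x) * F x := by
  obtain ⟨K, hKΩ, -, hK⟩ := h.exists_compact_cutoff k
  refine contDiff_iff_contDiffAt.2 fun x => ?_
  by_cases hx : x ∈ K
  · have hn := h.isOpen.mem_nhds (hKΩ hx)
    exact (hψc.contDiffAt.comp x (contDiffAt_const.mul (h.contDiffOn.contDiffAt hn))).mul
      (hF.contDiffAt hn)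
  · have : (fun x => ψ (-k * u x) * F x) =ᶠ[𝓝 x] fun _ => 0 := by
      filter_upwards [hK x hx] with y hy
      rw [hψ _ hy, zero_mul]
    exact contDiffAt_const.congr_of_eventuallyEq this

theorem integrableOn_cutoff (h : IsOverdetermined Ω u a C) (k : ℝ) {ψ : ℝ → ℝ}
    (hψc : Continuous ψ) (hψ : ∀ s ≤ 1, ψ s = 0) {F : Eu n → ℝ} (hF : ContinuousOn F Ω) :
    IntegrableOn (fun x => ψ (-k * u x) * F x) Ω :=
  ((h.continuous_cutoff k hψc hψ hF).integrable_of_hasCompactSupport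
    (h.hasCompactSupport_cutoff k hψ F)).integrableOn

/-- The divergence theorem for the compactly supported field `ψ(-ku) F`. -/
theorem integral_deriv_cutoff (h : IsOverdetermined Ω u a C) (k : ℝ) {ψ : ℝ → ℝ}
    (hψc : ContDiff ℝ ∞ ψ) (hψ : ∀ s ≤ 1, ψ s = 0) (hψ' : ∀ s ≤ 1, deriv ψ s = 0)
    {F : Fin n → Eu n → ℝ} (hF : ∀ i, ContDiffOn ℝ ∞ (F i) Ω) :
    ∫ x in Ω, deriv ψ (-k * u x) * (k * ∑ i, pd i u x * F i x)
      = ∫ x in Ω, ψ (-k * u x) * ∑ i, pd i (F i) x := by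
  have hdc : Continuous (deriv ψ) := hψc.continuous_deriv (by simp)
  have key : ∀ i, ∫ x in Ω, deriv ψ (-k * u x) * (k * (pd i u x * F i x))
      = ∫ x in Ω, ψ (-k * u x) * pd i (F i) x := by
    intro i
    have hi1 := h.integrableOn_cutoff k hdc hψ' (F := fun x => k * (pd i u x * F i x))
      (continuousOn_const.mul ((h.contDiffOn_pd i).continuousOn.mul (hF i).continuousOn))
    have hi2 := h.integrableOn_cutoff k hψc.continuous hψ (F := pd i (F i))
      ((hF i).pd h.isOpen i).continuousOn
    have h0 := integral_pd_eq_zero ((h.contDiff_cutoff k hψc hψ (hF i)).of_le (by simp))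
      (h.hasCompactSupport_cutoff k hψ (F i)) i
    obtain ⟨K, hKΩ, -, hK⟩ := h.exists_compact_cutoff k
    have hoff : ∀ x ∉ Ω, pd i (fun x => ψ (-k * u x) * F i x) x = 0 := fun x hx => by
      have : (fun x => ψ (-k * u x) * F i x) =ᶠ[𝓝 x] fun _ => 0 := by
        filter_upwards [hK x fun hxK => hx (hKΩ hxK)] with y hy
        rw [hψ _ hy, zero_mul]
      rw [(this.pd i).eq_of_nhds, pd_const]
    rw [← setIntegral_eq_integral_of_forall_compl_eq_zero hoff,
      setIntegral_congr_fun h.isOpen.measurableSet (g := fun x =>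
        ψ (-k * u x) * pd i (F i) x - deriv ψ (-k * u x) * (k * (pd i u x * F i x))),
      integral_sub hi2 hi1] at h0
    · linarith
    · intro x hx
      have hu := h.contDiffOn.differentiableAt_of_isOpen h.isOpen hx
      have hFd := (hF i).differentiableAt_of_isOpen h.isOpen hx
      have hψd : HasDerivAt (fun s => ψ (-k * s)) (deriv ψ (-k * u x) * -k) (u x) := by
        have := (hψc.differentiable (by simp) (-k * u x)).hasDerivAt.comp (u x)
          ((hasDerivAt_id (u x)).const_mul (-k))
        simpa [Function.comp_def] using this
      have hd : DifferentiableAt ℝ (fun y => ψ (-k * u y)) x :=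
        hψd.differentiableAt.comp x hu
      beta_reduce
      rw [pd_mul hd hFd, pd_comp hψd hu]; ring
  have hA : ∀ i ∈ Finset.univ, IntegrableOn
      (fun x => deriv ψ (-k * u x) * (k * (pd i u x * F i x))) Ω := fun i _ =>
    h.integrableOn_cutoff k hdc hψ' (F := fun x => k * (pd i u x * F i x))
      (continuousOn_const.mul ((h.contDiffOn_pd i).continuousOn.mul (hF i).continuousOn))
  have hB : ∀ i ∈ Finset.univ, IntegrableOn (fun x => ψ (-k * u x) * pd i (F i) x) Ω :=
    fun i _ => h.integrableOn_cutoff k hψc.continuous hψ ((hF i).pd h.isOpen i).continuousOn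
  simp only [Finset.mul_sum]
  rw [integral_finsetSum _ hA, integral_finsetSum _ hB]
  exact Finset.sum_congr rfl fun i _ => key i

theorem exists_grad_sq_le (h : IsOverdetermined Ω u a C) :
    ∃ B, ∀ x ∈ Ω, ∑ i, pd i u x ^ 2 ≤ B := by
  obtain ⟨K, hKΩ, hKc, hK⟩ := exists_compact_abs_sub_lt_of_tendsto_frontier h.isBounded
    h.contDiffOn_grad_sq.continuousOn (fun x hx => h.tendsto_grad x hx) one_pos
  obtain ⟨B, hB⟩ := hKc.exists_bound_of_continuousOn (h.contDiffOn_grad_sq.continuousOn.mono hKΩ)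
  refine ⟨max B (C + 1), fun x hx => ?_⟩
  by_cases hxK : x ∈ K
  · exact (le_abs_self _).trans ((hB x hxK).trans (le_max_left _ _))
  · exact le_trans (by linarith [(abs_lt.1 (hK x ⟨hx, hxK⟩)).2]) (le_max_right _ _)

theorem exists_abs_euler_le (h : IsOverdetermined Ω u a C) :
    ∃ B, ∀ x ∈ Ω, |∑ i, x i * pd i u x| ≤ B := by
  obtain ⟨B, hB⟩ := h.exists_grad_sq_le
  obtain ⟨R, hR0, hR⟩ : ∃ R > 0, ∀ x ∈ Ω, ‖x‖ ≤ R := h.isBounded.exists_pos_norm_le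
  refine ⟨R ^ 2 + B, fun x hx => ?_⟩
  have h1 : ∀ i, |x i * pd i u x| ≤ x i ^ 2 + pd i u x ^ 2 := fun i => by
    rw [abs_mul]
    nlinarith [sq_nonneg (|x i| - |pd i u x|), sq_abs (x i), sq_abs (pd i u x),
      sq_nonneg (x i), sq_nonneg (pd i u x)]
  calc |∑ i, x i * pd i u x| ≤ ∑ i, (x i ^ 2 + pd i u x ^ 2) :=
        (Finset.abs_sum_le_sum_abs _ _).trans (Finset.sum_le_sum fun i _ => h1 i)
    _ = ‖x‖ ^ 2 + ∑ i, pd i u x ^ 2 := by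
        rw [Finset.sum_add_distrib, EuclideanSpace.norm_sq_eq]; simp
    _ ≤ R ^ 2 + B := add_le_add (by have := hR x hx; gcongr) (hB x hx)

theorem volume_lt_top (h : IsOverdetermined Ω u a C) : volume Ω < ⊤ :=
  h.isBounded.measure_lt_top

theorem integrableOn_of_bound (h : IsOverdetermined Ω u a C) {F : Eu n → ℝ}
    (hF : ContinuousOn F Ω) {B : ℝ} (hB : ∀ x ∈ Ω, |F x| ≤ B) : IntegrableOn F Ω :=
  Integrable.mono' (integrableOn_const h.volume_lt_top.ne (C := B))
    (hF.aestronglyMeasurable h.isOpen.measurableSet)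
    ((ae_restrict_iff' h.isOpen.measurableSet).2 (Filter.Eventually.of_forall hB))

theorem eventually_two_lt (h : IsOverdetermined Ω u a C) {K : Set (Eu n)}
    (hK : IsCompact K) (hKΩ : K ⊆ Ω) :
    ∀ᶠ k : ℕ in Filter.atTop, ∀ x ∈ K, 2 < -(k : ℝ) * u x := by
  obtain ⟨ε, hε, hu⟩ := h.exists_le_neg_of_isCompact hK hKΩ
  filter_upwards [(tendsto_natCast_atTop_atTop (R := ℝ)).eventually_gt_atTop (2 / ε)]
    with k hk x hx
  rw [div_lt_iff₀ hε] at hk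
  nlinarith [hu x hx, Nat.cast_nonneg (α := ℝ) k]

theorem tendsto_integral_cutoff (h : IsOverdetermined Ω u a C) {F : Eu n → ℝ}
    (hF : IntegrableOn F Ω) :
    Filter.Tendsto (fun k : ℕ => ∫ x in Ω, cutoff (-(k : ℝ) * u x) * F x) Filter.atTop
      (𝓝 (∫ x in Ω, F x)) := by
  refine tendsto_integral_of_dominated_convergence (fun x => |F x|) (fun k => ?_) hF.abs
    (fun k => ?_) ?_
  · exact (_root_.contDiff_cutoff.continuous.comp
      (continuous_const.mul h.continuous)).aestronglyMeasurable.mul hF.aestronglyMeasurable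
  · refine Filter.Eventually.of_forall fun x => ?_
    rw [norm_mul, Real.norm_eq_abs, Real.norm_eq_abs, abs_of_nonneg (cutoff_nonneg _)]
    exact mul_le_of_le_one_left (abs_nonneg _) (cutoff_le_one _)
  · refine (ae_restrict_iff' h.isOpen.measurableSet).2 (Filter.Eventually.of_forall fun x hx => ?_)
    refine tendsto_const_nhds.congr' ?_
    filter_upwards [h.eventually_two_lt isCompact_singleton (singleton_subset_iff.2 hx)] with k hk
    rw [cutoff_of_ge (hk x rfl).le, one_mul]

theorem tendsto_integral_deriv_cutoff (h : IsOverdetermined Ω u a C) {F : Eu n → ℝ}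
    (hF : IntegrableOn F Ω) :
    Filter.Tendsto (fun k : ℕ => ∫ x in Ω, deriv cutoff (-(k : ℝ) * u x) * (k * (u x * F x)))
      Filter.atTop (𝓝 0) := by
  obtain ⟨B, hB⟩ := exists_abs_mul_deriv_cutoff_le
  rw [← integral_zero (Eu n) ℝ (μ := volume.restrict Ω)]
  refine tendsto_integral_of_dominated_convergence (fun x => B * |F x|) (fun k => ?_)
    (hF.abs.const_mul B) (fun k => ?_) ?_
  · exact (continuous_deriv_cutoff.comp
      (continuous_const.mul h.continuous)).aestronglyMeasurable.mul
      ((h.continuous.aestronglyMeasurable.mul hF.aestronglyMeasurable).const_mul (k : ℝ))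
  · refine Filter.Eventually.of_forall fun x => ?_
    have : deriv cutoff (-(k : ℝ) * u x) * (k * (u x * F x))
        = -((-(k : ℝ) * u x) * deriv cutoff (-(k : ℝ) * u x)) * F x := by ring
    rw [this, norm_mul, norm_neg, Real.norm_eq_abs, Real.norm_eq_abs]
    exact mul_le_mul_of_nonneg_right (hB _) (abs_nonneg _)
  · refine (ae_restrict_iff' h.isOpen.measurableSet).2 (Filter.Eventually.of_forall fun x hx => ?_)
    refine tendsto_const_nhds.congr' ?_
    filter_upwards [h.eventually_two_lt isCompact_singleton (singleton_subset_iff.2 hx)] with k hk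
    rw [deriv_cutoff_of_gt (hk x rfl), zero_mul]

end IsOverdetermined

namespace IsOverdetermined

variable {n : ℕ} {Ω : Set (Eu n)} {u : Eu n → ℝ} {a C : ℝ}

theorem measurableSet (h : IsOverdetermined Ω u a C) : MeasurableSet Ω := h.isOpen.measurableSet

theorem exists_abs_le (h : IsOverdetermined Ω u a C) : ∃ B, ∀ x ∈ Ω, |u x| ≤ B := by
  obtain ⟨B, hB⟩ := h.isBounded.isCompact_closure.exists_bound_of_continuousOn
    h.continuous.continuousOn
  exact ⟨B, fun x hx => hB x (subset_closure hx)⟩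

theorem integrableOn (h : IsOverdetermined Ω u a C) : IntegrableOn u Ω := by
  obtain ⟨B, hB⟩ := h.exists_abs_le
  exact h.integrableOn_of_bound h.continuous.continuousOn hB

theorem contDiffOn_euler (h : IsOverdetermined Ω u a C) :
    ContDiffOn ℝ ∞ (fun x => ∑ i, x i * pd i u x) Ω :=
  ContDiffOn.sum fun i _ => ContDiffOn.mul (by fun_prop) (h.contDiffOn_pd i)

theorem integrableOn_euler (h : IsOverdetermined Ω u a C) :
    IntegrableOn (fun x => ∑ i, x i * pd i u x) Ω := by
  obtain ⟨B, hB⟩ := h.exists_abs_euler_le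
  exact h.integrableOn_of_bound h.contDiffOn_euler.continuousOn hB

theorem integrableOn_grad_sq (h : IsOverdetermined Ω u a C) :
    IntegrableOn (fun x => ∑ i, pd i u x ^ 2) Ω := by
  obtain ⟨B, hB⟩ := h.exists_grad_sq_le
  refine h.integrableOn_of_bound h.contDiffOn_grad_sq.continuousOn (B := B) fun x hx => ?_
  rw [abs_of_nonneg (Finset.sum_nonneg fun i _ => sq_nonneg _)]
  exact hB x hx

theorem differentiableAt (h : IsOverdetermined Ω u a C) {x : Eu n} (hx : x ∈ Ω) :
    DifferentiableAt ℝ u x := h.contDiffOn.differentiableAt_of_isOpen h.isOpen hx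

theorem differentiableAt_pd (h : IsOverdetermined Ω u a C) {x : Eu n} (hx : x ∈ Ω) (i : Fin n) :
    DifferentiableAt ℝ (pd i u) x := (h.contDiffOn_pd i).differentiableAt_of_isOpen h.isOpen hx

theorem sum_pd_mul_pd (h : IsOverdetermined Ω u a C) {w : Eu n → ℝ} {x : Eu n} (hx : x ∈ Ω)
    (hw : DifferentiableAt ℝ w x) :
    ∑ i, pd i (fun y => w y * pd i u y) x = (∑ i, pd i w x * pd i u x) + a * w x := by
  rw [← h.lap_eq x hx, lap_eq_sum_pd, Finset.sum_mul, ← Finset.sum_add_distrib]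
  refine Finset.sum_congr rfl fun i _ => ?_
  rw [pd_mul hw (h.differentiableAt_pd hx i)]; ring

theorem integral_euler (h : IsOverdetermined Ω u a C) :
    ∫ x in Ω, ∑ i, x i * pd i u x = -(n * ∫ x in Ω, u x) := by
  have key : ∀ k : ℕ, ∫ x in Ω, deriv cutoff (-(k : ℝ) * u x) * (k * (u x * ∑ i, x i * pd i u x))
      = ∫ x in Ω, cutoff (-(k : ℝ) * u x) * ((∑ i, x i * pd i u x) + n * u x) := fun k => by
    have := h.integral_deriv_cutoff k _root_.contDiff_cutoff (fun _ => cutoff_of_le)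
      (fun _ => deriv_cutoff_of_le) (F := fun i x => u x * x i)
      (fun i => h.contDiffOn.mul (by fun_prop))
    convert this using 1
    · refine setIntegral_congr_fun h.measurableSet fun x _ => ?_
      simp only [Finset.mul_sum]
      exact Finset.sum_congr rfl fun i _ => by ring
    · refine setIntegral_congr_fun h.measurableSet fun x hx => ?_
      have : ∀ i : Fin n, pd i (fun y => u y * y i) x = x i * pd i u x + u x := fun i => by
        rw [pd_mul (h.differentiableAt hx) (by fun_prop), pd_coord, if_pos rfl]; ring
      simp [this, Finset.sum_add_distrib]
  have h1 := h.tendsto_integral_deriv_cutoff h.integrableOn_euler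
  have h2 := h.tendsto_integral_cutoff (h.integrableOn_euler.add (h.integrableOn.const_mul (n : ℝ)))
  simp only [key] at h1
  have := tendsto_nhds_unique h1 h2
  simp only [Pi.add_apply] at this
  rw [integral_add h.integrableOn_euler (h.integrableOn.const_mul _), integral_const_mul] at this
  linarith

theorem integral_grad_sq (h : IsOverdetermined Ω u a C) :
    ∫ x in Ω, ∑ i, pd i u x ^ 2 = -(a * ∫ x in Ω, u x) := by
  have key : ∀ k : ℕ, ∫ x in Ω, deriv cutoff (-(k : ℝ) * u x) * (k * (u x * ∑ i, pd i u x ^ 2))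
      = ∫ x in Ω, cutoff (-(k : ℝ) * u x) * ((∑ i, pd i u x ^ 2) + a * u x) := fun k => by
    have := h.integral_deriv_cutoff k _root_.contDiff_cutoff (fun _ => cutoff_of_le)
      (fun _ => deriv_cutoff_of_le) (F := fun i x => u x * pd i u x)
      (fun i => h.contDiffOn.mul (h.contDiffOn_pd i))
    convert this using 1
    · refine setIntegral_congr_fun h.measurableSet fun x _ => ?_
      simp only [Finset.mul_sum]
      exact Finset.sum_congr rfl fun i _ => by ring
    · refine setIntegral_congr_fun h.measurableSet fun x hx => ?_
      rw [h.sum_pd_mul_pd hx (h.differentiableAt hx)]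
      simp only [sq]
  have h1 := h.tendsto_integral_deriv_cutoff h.integrableOn_grad_sq
  have h2 := h.tendsto_integral_cutoff (h.integrableOn_grad_sq.add (h.integrableOn.const_mul a))
  simp only [key] at h1
  have := tendsto_nhds_unique h1 h2
  simp only [Pi.add_apply] at this
  rw [integral_add h.integrableOn_grad_sq (h.integrableOn.const_mul _), integral_const_mul] at this
  linarith

theorem integral_cutoff_grad_sq (h : IsOverdetermined Ω u a C) (k : ℝ) :
    ∫ x in Ω, deriv cutoff (-k * u x) * (k * ∑ i, pd i u x ^ 2)
      = ∫ x in Ω, cutoff (-k * u x) * a := by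
  have := h.integral_deriv_cutoff k _root_.contDiff_cutoff (fun _ => cutoff_of_le)
    (fun _ => deriv_cutoff_of_le) (F := fun i => pd i u) h.contDiffOn_pd
  simp only [← sq] at this
  rw [this]
  exact setIntegral_congr_fun h.measurableSet fun x hx => by
    rw [← lap_eq_sum_pd, h.lap_eq x hx]

theorem integral_cutoff_euler (h : IsOverdetermined Ω u a C) (k : ℝ) :
    ∫ x in Ω, deriv cutoff (-k * u x) * (k * ∑ i, x i * pd i u x)
      = ∫ x in Ω, cutoff (-k * u x) * n := by
  have := h.integral_deriv_cutoff k _root_.contDiff_cutoff (fun _ => cutoff_of_le)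
    (fun _ => deriv_cutoff_of_le) (F := fun i x => x i) (fun i => by fun_prop)
  simp only [pd_coord, mul_comm (pd _ _ _)] at this
  rw [this]
  simp

theorem integral_cutoff_of_lap_eq_zero (h : IsOverdetermined Ω u a C) (k : ℝ) {w : Eu n → ℝ}
    (hw : ContDiffOn ℝ ∞ w Ω) (hlap : ∀ x ∈ Ω, lap n w x = 0) :
    ∫ x in Ω, deriv cutoff (-k * u x) * (k * ((∑ i, pd i u x ^ 2) * w x))
      = ∫ x in Ω, cutoff (-k * u x) * (a * w x) := by
  have h1 := h.integral_deriv_cutoff k _root_.contDiff_cutoff (fun _ => cutoff_of_le)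
    (fun _ => deriv_cutoff_of_le) (F := fun i x => w x * pd i u x)
    (fun i => hw.mul (h.contDiffOn_pd i))
  have h2 := h.integral_deriv_cutoff k contDiff_cutoffPrimitive (fun _ => cutoffPrimitive_of_le)
    (fun s hs => by rw [deriv_cutoffPrimitive, cutoff_of_le hs]) (F := fun i => pd i w)
    (fun i => hw.pd h.isOpen i)
  rw [deriv_cutoffPrimitive, setIntegral_congr_fun h.measurableSet
    (g := fun _ => (0 : ℝ)) (f := fun x => cutoffPrimitive (-k * u x) * _)
    (fun x hx => by beta_reduce; rw [← lap_eq_sum_pd, hlap x hx, mul_zero]), integral_zero] at h2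
  have hc : ContinuousOn (fun x => ∑ i, pd i w x * pd i u x) Ω :=
    continuousOn_finsetSum _ fun i _ =>
      (hw.pd h.isOpen i).continuousOn.mul (h.contDiffOn_pd i).continuousOn
  have h3 : k * ∫ x in Ω, cutoff (-k * u x) * (∑ i, pd i w x * pd i u x) = 0 := by
    rw [← integral_const_mul, ← h2]
    congr 1; ext x; simp only [mul_comm (pd _ u x)]; ring
  rw [setIntegral_congr_fun h.measurableSet (f := fun x => cutoff (-k * u x) * _)
    (g := fun x => cutoff (-k * u x) * (∑ i, pd i w x * pd i u x) + cutoff (-k * u x) * (a * w x))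
    (fun x hx => by
      beta_reduce
      rw [h.sum_pd_mul_pd hx (hw.differentiableAt_of_isOpen h.isOpen hx)]; ring),
    integral_add (h.integrableOn_cutoff k _root_.contDiff_cutoff.continuous
        (fun _ => cutoff_of_le) hc)
      (h.integrableOn_cutoff k _root_.contDiff_cutoff.continuous (fun _ => cutoff_of_le)
        (F := fun x => a * w x) (continuousOn_const.mul hw.continuousOn))] at h1
  have h4 : ∫ x in Ω, deriv cutoff (-k * u x) * (k * ((∑ i, pd i u x ^ 2) * w x))
      = ∫ x in Ω, deriv cutoff (-k * u x) * (k * ∑ i, pd i u x * (w x * pd i u x)) := by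
    congr 1; ext x; rw [Finset.sum_mul]; congr 2
    exact Finset.sum_congr rfl fun i _ => by ring
  rw [h4, h1]
  rcases eq_or_ne k 0 with rfl | hk
  · simp [cutoff_of_le]
  · simpa [hk] using h3

theorem integral_euler_sub (h : IsOverdetermined Ω u a C) :
    a * ∫ x in Ω, ((∑ i, x i * pd i u x) - 2 * u x) = C * n * volume.real Ω := by
  set w : Eu n → ℝ := fun x => (∑ i, x i * pd i u x) - 2 * u x with hw
  have hws : ContDiffOn ℝ ∞ w Ω := h.contDiffOn_euler.sub (contDiffOn_const.mul h.contDiffOn)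
  have hwi : IntegrableOn w Ω := h.integrableOn_euler.sub (h.integrableOn.const_mul 2)
  have hdc : ∀ s ≤ 1, deriv cutoff s = 0 := fun _ => deriv_cutoff_of_le
  have h1 := h.tendsto_integral_cutoff (hwi.const_mul a)
  have h2 := h.tendsto_integral_cutoff
    (integrableOn_const h.volume_lt_top.ne (C := (n : ℝ)) (μ := volume))
  have hlim := h1.sub (h2.const_mul C)
  obtain ⟨A, hA⟩ := h.exists_abs_euler_le
  have hA0 : 0 ≤ A := by
    obtain ⟨x, hx⟩ := h.isConnected.nonempty
    exact (abs_nonneg _).trans (hA x hx)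
  have hbound : ∀ δ > 0, δ ≤ C / 2 →
      |(∫ x in Ω, a * w x) - C * ∫ x in Ω, (n : ℝ)|
        ≤ δ * (2 * A / C + 2) * (a * volume.real Ω) := by
    intro δ hδ hδC
    obtain ⟨K, hKΩ, hKc, hK⟩ := exists_compact_abs_sub_lt_of_tendsto_frontier h.isBounded
      h.contDiffOn_grad_sq.continuousOn (fun x hx => h.tendsto_grad x hx) hδ
    obtain ⟨K', hKΩ', hKc', hK'⟩ := exists_compact_abs_sub_lt_of_tendsto_frontier h.isBounded
      h.contDiffOn.continuousOn (fun x hx => h.tendsto_frontier hx) hδ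
    refine le_of_tendsto hlim.abs ?_
    filter_upwards [h.eventually_two_lt (hKc.union hKc') (union_subset hKΩ hKΩ')] with k hk
    have hη : 0 ≤ δ * (2 * A / C + 2) := by have := h.C_pos; positivity
    have hi1 := h.integrableOn_cutoff k continuous_deriv_cutoff hdc
      (F := fun x => k * ((∑ i, pd i u x ^ 2) * w x))
      (continuousOn_const.mul (h.contDiffOn_grad_sq.continuousOn.mul hws.continuousOn))
    have hi2 := h.integrableOn_cutoff k continuous_deriv_cutoff hdc
      (F := fun x => k * ∑ i, x i * pd i u x)
      (continuousOn_const.mul h.contDiffOn_euler.continuousOn)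
    have hi3 := h.integrableOn_cutoff k continuous_deriv_cutoff hdc
      (F := fun x => k * ∑ i, pd i u x ^ 2)
      (continuousOn_const.mul h.contDiffOn_grad_sq.continuousOn)
    have hcut : ∫ x in Ω, cutoff (-(k : ℝ) * u x) * a ≤ a * volume.real Ω := by
      have hle : ∫ x in Ω, cutoff (-(k : ℝ) * u x) * a ≤ ∫ x in Ω, a := by
        refine setIntegral_mono
          (h.integrableOn_cutoff k _root_.contDiff_cutoff.continuous (fun _ => cutoff_of_le)
            continuousOn_const) (integrableOn_const h.volume_lt_top.ne) fun x => ?_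
        exact mul_le_of_le_one_left h.a_pos.le (cutoff_le_one _)
      simpa [mul_comm] using hle
    rw [← h.integral_cutoff_of_lap_eq_zero k hws (fun x hx => h.lap_euler hx),
      ← h.integral_cutoff_euler k, ← integral_const_mul, ← integral_sub hi1 (hi2.const_mul C),
      ← Real.norm_eq_abs]
    refine (norm_integral_le_of_norm_le (hi3.const_mul (δ * (2 * A / C + 2))) ?_).trans ?_
    · refine (ae_restrict_iff' h.measurableSet).2 (Filter.Eventually.of_forall fun x hx => ?_)
      by_cases hxK : x ∈ K ∪ K'
      · rw [deriv_cutoff_of_gt (hk x hxK)]; simp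
      · rw [mem_union, not_or] at hxK
        have hg := hK x ⟨hx, hxK.1⟩
        have hu := hK' x ⟨hx, hxK.2⟩
        have hE := hA x hx
        set g := ∑ i, pd i u x ^ 2 with hgdef
        set E := ∑ i, x i * pd i u x with hEdef
        have hCp := h.C_pos
        have hg2 : C / 2 ≤ g := by linarith [(abs_lt.1 hg).1]
        have hd := deriv_cutoff_nonneg (-(k : ℝ) * u x)
        have hmain : |g * w x - C * E| ≤ δ * (2 * A / C + 2) * g := by
          have e1 : g * w x - C * E = (g - C) * E - 2 * u x * g := by
            simp only [hw]; ring
          have e2 : δ * A ≤ δ * (2 * A / C) * g := by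
            have : δ * (2 * A / C) * (C / 2) = δ * A := by field_simp
            rw [← this]; gcongr
          have e3 : |(g - C) * E| ≤ δ * A := by
            rw [abs_mul]; gcongr
          have e4 : |2 * u x * g| ≤ 2 * δ * g := by
            rw [sub_zero] at hu
            rw [abs_mul, abs_mul, abs_two, abs_of_nonneg (show 0 ≤ g by linarith)]
            gcongr
          rw [e1]
          refine (abs_sub _ _).trans ?_
          nlinarith
        have e5 : deriv cutoff (-(k : ℝ) * u x) * (k * (g * w x))
            - C * (deriv cutoff (-(k : ℝ) * u x) * (k * E))
            = (deriv cutoff (-(k : ℝ) * u x) * k) * (g * w x - C * E) := by ring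
        rw [e5, Real.norm_eq_abs, abs_mul, abs_of_nonneg (by positivity)]
        calc _ ≤ deriv cutoff (-(k : ℝ) * u x) * k * (δ * (2 * A / C + 2) * g) := by gcongr
          _ = _ := by ring
    · rw [integral_const_mul, h.integral_cutoff_grad_sq]
      gcongr
  have hzero : |(∫ x in Ω, a * w x) - C * ∫ x in Ω, (n : ℝ)| ≤ 0 := by
    have ht : Filter.Tendsto (fun δ : ℝ => δ * (2 * A / C + 2) * (a * volume.real Ω)) (𝓝[>] 0)
        (𝓝 0) := by
      have : Continuous fun δ : ℝ => δ * (2 * A / C + 2) * (a * volume.real Ω) := by fun_prop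
      simpa using (this.tendsto 0).mono_left nhdsWithin_le_nhds
    refine ge_of_tendsto ht ?_
    filter_upwards [Ioc_mem_nhdsGT (half_pos h.C_pos)] with δ hδ using hbound δ hδ.1 hδ.2
  have := abs_nonpos_iff.1 hzero
  rw [integral_const_mul, setIntegral_const] at this
  simp only [smul_eq_mul] at this
  linarith

/-- The `P`-function `|∇u|² - (2a/n) u` is constant. -/
theorem grad_sq_sub_eq (h : IsOverdetermined Ω u a C) :
    ∀ x ∈ Ω, (∑ i, pd i u x ^ 2) - 2 * a / n * u x = C := by
  have hn : (0 : ℝ) < n := Nat.cast_pos.2 h.pos_dim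
  set P : Eu n → ℝ := fun x => (∑ i, pd i u x ^ 2) - 2 * a / n * u x with hP
  have hPs : ContDiffOn ℝ ∞ P Ω := h.contDiffOn_grad_sq.sub (contDiffOn_const.mul h.contDiffOn)
  have hPi : IntegrableOn P Ω := h.integrableOn_grad_sq.sub (h.integrableOn.const_mul _)
  have hle : ∀ x ∈ Ω, P x ≤ C := by
    refine le_of_lap_nonneg h.pos_dim h.isOpen h.isBounded hPs (fun x hx => ?_) fun δ hδ => ?_
    · have hnh := h.isOpen.mem_nhds hx
      have hu := h.contDiffOn.contDiffAt hnh
      rw [hP, lap_sub (h.contDiffOn_grad_sq.contDiffAt hnh) (contDiffAt_const.mul hu),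
        lap_const_mul _ hu, h.lap_eq x hx, h.lap_grad_sq hx]
      have h1 : a ^ 2 ≤ n * ∑ i, pd i (pd i u) x ^ 2 := by
        have := sq_sum_le_card_mul_sum_sq (s := Finset.univ) (f := fun i => pd i (pd i u) x)
        rwa [← lap_eq_sum_pd, h.lap_eq x hx, Finset.card_univ, Fintype.card_fin] at this
      have h2 : ∑ i, pd i (pd i u) x ^ 2 ≤ ∑ i, ∑ j, pd i (pd j u) x ^ 2 :=
        Finset.sum_le_sum fun i _ => Finset.single_le_sum
          (f := fun j => pd i (pd j u) x ^ 2) (fun j _ => sq_nonneg _) (Finset.mem_univ i)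
      have h3 : a ^ 2 / n ≤ ∑ i, ∑ j, pd i (pd j u) x ^ 2 := by
        rw [div_le_iff₀ hn]; nlinarith
      have : 2 * a / n * a = 2 * (a ^ 2 / n) := by ring
      linarith
    · have ht : ∀ x ∈ frontier Ω, Filter.Tendsto P (𝓝[Ω] x) (𝓝 C) := fun x hx => by
        simpa using (h.tendsto_grad x hx).sub ((h.tendsto_frontier hx).const_mul (2 * a / n))
      obtain ⟨K, hK, hKc, hKP⟩ := exists_compact_abs_sub_lt_of_tendsto_frontier h.isBounded
        hPs.continuousOn ht hδ
      exact ⟨K, hK, hKc, fun x hx => by linarith [(abs_lt.1 (hKP x hx)).2]⟩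
  have hInt : ∫ x in Ω, (C - P x) = 0 := by
    have hCi : IntegrableOn (fun _ : Eu n => C) Ω := integrableOn_const h.volume_lt_top.ne
    rw [integral_sub hCi hPi, hP, integral_sub h.integrableOn_grad_sq (h.integrableOn.const_mul _),
      integral_const_mul, h.integral_grad_sq, setIntegral_const]
    have h1 := h.integral_euler_sub
    rw [integral_sub h.integrableOn_euler (h.integrableOn.const_mul _), integral_const_mul,
      h.integral_euler] at h1
    simp only [smul_eq_mul]
    have h2 : C * volume.real Ω * n = a * (-(n * ∫ x in Ω, u x) - 2 * ∫ x in Ω, u x) := by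
      rw [h1]; ring
    have h3 : (volume.real Ω * C
        - (-(a * ∫ x in Ω, u x) - 2 * a / n * ∫ x in Ω, u x)) * n = 0 := by
      field_simp
      linear_combination h2
    exact (mul_eq_zero.1 h3).resolve_right hn.ne'
  have hae := (setIntegral_eq_zero_iff_of_nonneg_ae
    ((ae_restrict_iff' h.measurableSet).2 (Filter.Eventually.of_forall fun x hx => by
      simpa using hle x hx))
    ((integrableOn_const h.volume_lt_top.ne).sub hPi)).1 hInt
  intro x hx
  have := Measure.eqOn_open_of_ae_eq hae h.isOpen
    (continuousOn_const.sub hPs.continuousOn) continuousOn_const hx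
  simp only [Pi.sub_apply, Pi.zero_apply] at this
  change P x = C
  linarith

theorem pd_pd_eq (h : IsOverdetermined Ω u a C) {x : Eu n} (hx : x ∈ Ω) (i j : Fin n) :
    pd i (pd j u) x = if i = j then a / n else 0 := by
  have hn : (0 : ℝ) < n := Nat.cast_pos.2 h.pos_dim
  have hnh := h.isOpen.mem_nhds hx
  have hu := h.contDiffOn.contDiffAt hnh
  have h0 : lap n (fun y => (∑ i, pd i u y ^ 2) - 2 * a / n * u y) x = 0 := by
    have : (fun y => (∑ i, pd i u y ^ 2) - 2 * a / n * u y) =ᶠ[𝓝 x] fun _ => C := by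
      filter_upwards [hnh] with y hy using h.grad_sq_sub_eq y hy
    rw [lap_congr this, lap_eq_sum_pd]
    have h0 : ∀ i : Fin n, pd i (fun _ : Eu n => C) = fun _ => 0 := fun i =>
      funext fun y => pd_const C
    simp [h0, pd_const]
  rw [lap_sub (h.contDiffOn_grad_sq.contDiffAt hnh) (contDiffAt_const.mul hu),
    lap_const_mul _ hu, h.lap_eq x hx, h.lap_grad_sq hx] at h0
  have htr : ∑ i, pd i (pd i u) x = a := h.lap_eq x hx
  have hsum : ∑ i, ∑ j, (pd i (pd j u) x - if i = j then a / n else 0) ^ 2 = 0 := by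
    have : ∀ i j : Fin n, (pd i (pd j u) x - if i = j then a / n else 0) ^ 2
        = pd i (pd j u) x ^ 2
          + if i = j then (a / n) ^ 2 - 2 * (a / n) * pd i (pd j u) x else 0 := fun i j => by
      split_ifs <;> ring
    simp only [this, Finset.sum_add_distrib, Finset.sum_ite_eq, Finset.mem_univ, if_true,
      Finset.sum_sub_distrib, ← Finset.mul_sum, htr]
    simp only [Finset.sum_const, Finset.card_univ, Fintype.card_fin, nsmul_eq_mul]
    field_simp
    field_simp at h0
    nlinarith
  have h1 := (Finset.sum_eq_zero_iff_of_nonneg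
    (fun i _ => Finset.sum_nonneg fun j _ => sq_nonneg _)).1 hsum i (Finset.mem_univ i)
  have h2 := (Finset.sum_eq_zero_iff_of_nonneg (fun j _ => sq_nonneg _)).1 h1 j (Finset.mem_univ j)
  exact sub_eq_zero.1 (pow_eq_zero_iff two_ne_zero |>.1 h2)

/-- **Serrin's theorem**: an overdetermined domain is a ball. -/
theorem exists_eq_ball (h : IsOverdetermined Ω u a C) :
    ∃ (x₀ : Eu n) (R : ℝ), 0 < R ∧ Ω = Metric.ball x₀ R := by
  have hn : (0 : ℝ) < n := Nat.cast_pos.2 h.pos_dim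
  have ha := h.a_pos
  set b := a / n with hb
  have hb0 : 0 < b := by positivity
  obtain ⟨p, hp⟩ := h.isConnected.nonempty
  have hlin : ∀ j, ∃ c, ∀ x ∈ Ω, pd j u x = b * (x j - c) := fun j => by
    have hd : ∀ x ∈ Ω, DifferentiableAt ℝ (fun y => pd j u y - b * y j) x := fun x hx => by
      have := h.differentiableAt_pd hx j
      fun_prop
    have hz : ∀ x ∈ Ω, fderiv ℝ (fun y => pd j u y - b * y j) x = 0 := fun x hx => by
      refine fderiv_eq_zero_of_pd fun i => ?_
      rw [pd_sub (h.differentiableAt_pd hx j) (by fun_prop), pd_const_mul _ (by fun_prop),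
        pd_coord, h.pd_pd_eq hx]
      split_ifs <;> simp [hb]
    obtain ⟨c, hc⟩ := h.isOpen.exists_is_const_of_fderiv_eq_zero h.isConnected.isPreconnected
      (fun x hx => (hd x hx).differentiableWithinAt) hz
    refine ⟨-c / b, fun x hx => ?_⟩
    have := hc x hx
    field_simp
    linarith
  choose c hc using hlin
  set x₀ : Eu n := WithLp.toLp 2 c with hx₀
  set R := Real.sqrt C / b with hR
  have hRp : 0 < R := div_pos (Real.sqrt_pos.2 h.C_pos) hb0
  have hR2 : b ^ 2 * R ^ 2 = C := by
    rw [hR, ← mul_pow, mul_div_cancel₀ _ hb0.ne', Real.sq_sqrt h.C_pos.le]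
  have hform : ∀ x ∈ Ω, 2 * u x = b * (‖x - x₀‖ ^ 2 - R ^ 2) := fun x hx => by
    have h1 := h.grad_sq_sub_eq x hx
    have h2 : ∑ i, pd i u x ^ 2 = b ^ 2 * ‖x - x₀‖ ^ 2 := by
      rw [EuclideanSpace.norm_sq_eq, Finset.mul_sum]
      refine Finset.sum_congr rfl fun i _ => ?_
      rw [hc i x hx]
      simp [hx₀, mul_pow]
    rw [h2, ← hR2] at h1
    have h3 : 2 * a / n * u x = b * (2 * u x) := by rw [hb]; ring
    rw [h3] at h1
    have : b * (2 * u x) = b * (b * (‖x - x₀‖ ^ 2 - R ^ 2)) := by linarith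
    exact mul_left_cancel₀ hb0.ne' this
  have hsub : Ω ⊆ Metric.ball x₀ R := fun x hx => by
    rw [mem_ball_iff_norm]
    have h1 := hform x hx
    have h2 := h.neg x hx
    have : ‖x - x₀‖ ^ 2 < R ^ 2 := by nlinarith
    exact lt_of_pow_lt_pow_left₀ 2 hRp.le this
  have hfr : ∀ x ∈ frontier Ω, ‖x - x₀‖ = R := fun x hx => by
    have hxc : x ∈ closure Ω := frontier_subset_closure hx
    have hcl : closure Ω ⊆ {y | 2 * u y = b * (‖y - x₀‖ ^ 2 - R ^ 2)} :=
      closure_minimal hform (isClosed_eq (continuous_const.mul h.continuous) (by fun_prop))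
    have h1 : 2 * u x = b * (‖x - x₀‖ ^ 2 - R ^ 2) := hcl hxc
    have h0 : u x = 0 := h.eq_zero x fun hxo => by
      rw [frontier, h.isOpen.interior_eq] at hx; exact hx.2 hxo
    rw [h0, mul_zero] at h1
    have h2 := (mul_eq_zero.1 h1.symm).resolve_left hb0.ne'
    exact (sq_eq_sq₀ (norm_nonneg _) hRp.le).1 (by linarith)
  refine ⟨x₀, R, hRp, hsub.antisymm ?_⟩
  have hpre : IsPreconnected (Metric.ball x₀ R) := (convex_ball x₀ R).isPreconnected
  refine hpre.subset_of_closure_inter_subset h.isOpen ⟨p, hsub hp, hp⟩ fun x hx => ?_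
  by_contra hxo
  have : x ∈ frontier Ω := by
    rw [frontier, h.isOpen.interior_eq]; exact ⟨hx.1, hxo⟩
  have h1 := hfr x this
  have h2 := mem_ball_iff_norm.1 hx.2
  linarith

end IsOverdetermined

section Kernels

variable {n : ℕ}

theorem exists_smooth_cutoff {K O : Set (Eu n)} (hK : IsCompact K) (hO : IsOpen O) (hKO : K ⊆ O) :
    ∃ η : Eu n → ℝ, ContDiff ℝ ∞ η ∧ HasCompactSupport η ∧ tsupport η ⊆ O ∧
      (∀ᶠ x in 𝓝ˢ K, η x = 1) ∧ ∀ x, η x ∈ Icc (0 : ℝ) 1 := by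
  obtain ⟨L, hL, hKL, hLO⟩ := exists_compact_between hK hO hKO
  obtain ⟨η, h1, h0, h⟩ := exists_contMDiffMap_one_nhds_of_subset_interior (n := ⊤)
    (modelWithCornersSelf ℝ (Eu n)) hK.isClosed hKL
  have hsub : tsupport η ⊆ L := closure_minimal (fun x hx => by
    by_contra hxL; exact hx (h0 x hxL)) hL.isClosed
  exact ⟨η, η.contMDiff.contDiff, hL.of_isClosed_subset (isClosed_tsupport _) hsub,
    hsub.trans hLO, h1, h⟩

/-- A function smooth near a compact set agrees there with a smooth compactly supported one. -/
theorem exists_contDiff_hasCompactSupport_eq {K O : Set (Eu n)} (hK : IsCompact K)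
    (hO : IsOpen O) (hKO : K ⊆ O) {g : Eu n → ℝ} (hg : ContDiffOn ℝ ∞ g O) :
    ∃ g' : Eu n → ℝ, ContDiff ℝ ∞ g' ∧ HasCompactSupport g' ∧ ∀ᶠ x in 𝓝ˢ K, g' x = g x := by
  obtain ⟨η, hη, hηc, hηO, hη1, -⟩ := exists_smooth_cutoff hK hO hKO
  refine ⟨fun x => η x * g x, contDiff_iff_contDiffAt.2 fun x => ?_, hηc.mul_right,
    hη1.mono fun x hx => by simp [hx]⟩
  by_cases hx : x ∈ tsupport η
  · exact hη.contDiffAt.mul (hg.contDiffAt (hO.mem_nhds (hηO hx)))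
  · have : (fun x => η x * g x) =ᶠ[𝓝 x] fun _ => 0 := by
      filter_upwards [notMem_tsupport_iff_eventuallyEq.1 hx] with y hy
      simp [hy]
    exact contDiffAt_const.congr_of_eventuallyEq this

variable {m : Measure (Eu n)} {f : Eu n → ℝ}

theorem integrable_comp_sub_mul {g : Eu n → ℝ} (hg : Continuous g)
    (hgc : HasCompactSupport g) (hf : Integrable f m) (y : Eu n) :
    Integrable (fun z => g (y - z) * f z) m := by
  obtain ⟨B, hB⟩ := hg.bounded_above_of_compact_support hgc
  exact hf.bdd_mul (hg.comp (continuous_const.sub continuous_id)).aestronglyMeasurable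
    (Filter.Eventually.of_forall fun z => hB _)

theorem pd_integral_comp_sub {g : Eu n → ℝ} (hg : ContDiff ℝ ∞ g) (hgc : HasCompactSupport g)
    (hf : Integrable f m) (i : Fin n) (p : Eu n) :
    pd i (fun y => ∫ z, g (y - z) * f z ∂m) p = ∫ z, pd i g (p - z) * f z ∂m := by
  have hdg : Continuous (fderiv ℝ g) := hg.continuous_fderiv (by simp)
  obtain ⟨B, hB⟩ := hdg.bounded_above_of_compact_support (hgc.fderiv (𝕜 := ℝ))
  have hInt : Integrable (fun z => f z • fderiv ℝ g (p - z)) m := by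
    refine (hf.norm.mul_const B).mono' (hf.aestronglyMeasurable.smul
      (hdg.comp (continuous_const.sub continuous_id)).aestronglyMeasurable)
      (Filter.Eventually.of_forall fun z => ?_)
    rw [norm_smul]
    exact mul_le_mul_of_nonneg_left (hB _) (norm_nonneg _)
  have h := hasFDerivAt_integral_of_dominated_of_fderiv_le (μ := m)
    (F := fun y z => g (y - z) * f z) (F' := fun y z => f z • fderiv ℝ g (y - z)) (x₀ := p)
    (bound := fun z => ‖f z‖ * B) Filter.univ_mem
    (Filter.Eventually.of_forall fun y =>
      (integrable_comp_sub_mul hg.continuous hgc hf y).aestronglyMeasurable)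
    (integrable_comp_sub_mul hg.continuous hgc hf p) hInt.aestronglyMeasurable
    (Filter.Eventually.of_forall fun z y _ => by
      rw [norm_smul]; exact mul_le_mul_of_nonneg_left (hB _) (norm_nonneg _))
    (hf.norm.mul_const B)
    (Filter.Eventually.of_forall fun z y _ => by
      have h1 : HasFDerivAt (fun y => g (y - z)) (fderiv ℝ g (y - z)) y := by
        have := (hg.differentiable (by simp) (y - z)).hasFDerivAt
        exact (hasFDerivAt_comp_sub z).2 this
      exact h1.mul_const (f z))
  rw [h.pd_eq, ContinuousLinearMap.integral_apply hInt]
  congr 1; ext z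
  simp [pd, mul_comm]

/-- Differentiation under the integral sign for potentials, away from the singularities of the
kernel. -/
theorem contDiffAt_potential [SFinite m] {g : Eu n → ℝ} {O T : Set (Eu n)} (hO : IsOpen O)
    (hg : ContDiffOn ℝ ∞ g O) (hT : IsCompact T) (hf : Integrable f m)
    (hfT : ∀ᵐ z ∂m, z ∉ T → f z = 0) {p : Eu n} (hp : ∀ z ∈ T, p - z ∈ O) :
    ContDiffAt ℝ ∞ (fun y => ∫ z, g (y - z) * f z ∂m) p ∧
      ∀ i, pd i (fun y => ∫ z, g (y - z) * f z ∂m) p = ∫ z, pd i g (p - z) * f z ∂m := by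
  have hK : IsCompact ((fun z => p - z) '' T) := hT.image (continuous_const.sub continuous_id)
  obtain ⟨g', hg', hgc', hgg⟩ := exists_contDiff_hasCompactSupport_eq hK hO
    (image_subset_iff.2 hp) hg
  have hnear : ∀ᶠ y in 𝓝 p, ∀ z ∈ T, ∀ᶠ x in 𝓝 (y - z), g' x = g x := by
    have h1 : ∀ z ∈ T, ∀ᶠ q : Eu n × Eu n in 𝓝 (p, z),
        ∀ᶠ x in 𝓝 (q.1 - q.2), g' x = g x := fun z hz => by
      have h2 : ∀ᶠ x in 𝓝 (p - z), g' x = g x :=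
        (hgg.filter_mono (nhds_le_nhdsSet (mem_image_of_mem _ hz)))
      have h3 : ContinuousAt (fun q : Eu n × Eu n => q.1 - q.2) (p, z) :=
        (continuous_fst.sub continuous_snd).continuousAt
      exact h3.eventually h2.eventually_nhds
    exact hT.eventually_forall_of_forall_eventually h1
  have heq : (fun y => ∫ z, g (y - z) * f z ∂m) =ᶠ[𝓝 p] fun y => ∫ z, g' (y - z) * f z ∂m := by
    filter_upwards [hnear] with y hy
    refine integral_congr_ae ?_
    filter_upwards [hfT] with z hz
    by_cases hzT : z ∈ T
    · rw [(hy z hzT).self_of_nhds]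
    · rw [hz hzT, mul_zero, mul_zero]
  refine ⟨ContDiffAt.congr_of_eventuallyEq ?_ heq, fun i => ?_⟩
  · have := hgc'.contDiff_convolution_right (ContinuousLinearMap.mul ℝ ℝ).flip
      hf.locallyIntegrable hg' (μ := m)
    exact this.contDiffAt
  · rw [(heq.pd i).eq_of_nhds, pd_integral_comp_sub hg' hgc' hf]
    refine integral_congr_ae ?_
    filter_upwards [hfT] with z hz
    by_cases hzT : z ∈ T
    · have : g' =ᶠ[𝓝 (p - z)] g := hnear.self_of_nhds z hzT
      rw [(this.pd i).eq_of_nhds]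
    · rw [hz hzT, mul_zero, mul_zero]

theorem integrable_potential {g : Eu n → ℝ} {O T : Set (Eu n)}
    (hg : ContinuousOn g O) (hgm : Measurable g) (hT : IsCompact T) (hf : Integrable f m)
    (hfT : ∀ᵐ z ∂m, z ∉ T → f z = 0) {p : Eu n} (hp : ∀ z ∈ T, p - z ∈ O) :
    Integrable (fun z => g (p - z) * f z) m := by
  obtain ⟨B, hB⟩ := hT.exists_bound_of_continuousOn (f := fun z => g (p - z))
    (hg.comp (by fun_prop) hp)
  refine (hf.norm.const_mul B).mono' ((hgm.comp
    (measurable_const.sub measurable_id)).aestronglyMeasurable.mul hf.aestronglyMeasurable) ?_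
  filter_upwards [hfT] with z hz
  by_cases hzT : z ∈ T
  · rw [norm_mul]; exact mul_le_mul_of_nonneg_right (hB z hzT) (norm_nonneg _)
  · simp [hz hzT]

theorem eventually_forall_sub_mem {O T : Set (Eu n)} (hO : IsOpen O) (hT : IsCompact T)
    {p : Eu n} (hp : ∀ z ∈ T, p - z ∈ O) : ∀ᶠ y in 𝓝 p, ∀ z ∈ T, y - z ∈ O :=
  hT.eventually_forall_of_forall_eventually fun z hz =>
    (continuous_fst.sub continuous_snd).continuousAt.eventually (hO.mem_nhds (hp z hz))

theorem lap_potential [SFinite m] {g : Eu n → ℝ} {O T : Set (Eu n)} (hO : IsOpen O)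
    (hg : ContDiffOn ℝ ∞ g O) (hT : IsCompact T) (hf : Integrable f m)
    (hfT : ∀ᵐ z ∂m, z ∉ T → f z = 0) {p : Eu n} (hp : ∀ z ∈ T, p - z ∈ O) :
    lap n (fun y => ∫ z, g (y - z) * f z ∂m) p = ∫ z, lap n g (p - z) * f z ∂m := by
  have h1 : ∀ i : Fin n, pd i (pd i fun y => ∫ z, g (y - z) * f z ∂m) p
      = ∫ z, pd i (pd i g) (p - z) * f z ∂m := fun i => by
    have : (pd i fun y => ∫ z, g (y - z) * f z ∂m) =ᶠ[𝓝 p]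
        fun y => ∫ z, pd i g (y - z) * f z ∂m := by
      filter_upwards [eventually_forall_sub_mem hO hT hp] with y hy
      exact (contDiffAt_potential hO hg hT hf hfT hy).2 i
    rw [(this.pd i).eq_of_nhds]
    exact (contDiffAt_potential hO (hg.pd hO i) hT hf hfT hp).2 i
  have hmeas : ∀ v : Eu n → ℝ, ∀ i, Measurable (pd i v) := fun v i =>
    measurable_fderiv_apply_const ℝ v _
  rw [lap_eq_sum_pd, Finset.sum_congr rfl fun i _ => h1 i, ← integral_finsetSum]
  · simp only [← Finset.sum_mul, ← lap_eq_sum_pd]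
  · exact fun i _ => integrable_potential ((hg.pd hO i).pd hO i).continuousOn (hmeas _ i)
      hT hf hfT hp

end Kernels

section Newton

/-- The primitive of `τ ^ (-n/2)` vanishing at `1`. -/
def radial (n : ℕ) (s : ℝ) : ℝ := ∫ τ in (1 : ℝ)..s, τ ^ (-(n : ℝ) / 2)

/-- The Newtonian kernel, regularized by `s`; for `s = 0` this is a multiple of the fundamental
solution of the Laplacian. -/
def newton {n : ℕ} (s : ℝ) (x : Eu n) : ℝ := radial n (‖x‖ ^ 2 + s) / 2

/-- The `i`-th partial derivative of `newton s`. -/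
def newtonGrad {n : ℕ} (s : ℝ) (i : Fin n) (x : Eu n) : ℝ :=
  x i * (‖x‖ ^ 2 + s) ^ (-(n : ℝ) / 2)

variable {n : ℕ}

theorem hasDerivAt_radial {s : ℝ} (hs : 0 < s) :
    HasDerivAt (radial n) (s ^ (-(n : ℝ) / 2)) s := by
  have hc : ContinuousOn (fun τ : ℝ => τ ^ (-(n : ℝ) / 2)) (Ioi 0) :=
    continuousOn_id.rpow_const fun τ hτ => Or.inl (ne_of_gt hτ)
  have hsub : uIcc 1 s ⊆ Ioi (0 : ℝ) := fun τ hτ => lt_of_lt_of_le (lt_min one_pos hs) hτ.1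
  exact intervalIntegral.integral_hasDerivAt_right (hc.mono hsub).intervalIntegrable
    (hc.stronglyMeasurableAtFilter isOpen_Ioi s hs) (hc.continuousAt (Ioi_mem_nhds hs))

theorem contDiffOn_rpow (p : ℝ) : ContDiffOn ℝ ∞ (fun τ : ℝ => τ ^ p) (Ioi 0) := fun _ hτ =>
  (Real.contDiffAt_rpow_const_of_ne (ne_of_gt hτ)).contDiffWithinAt

theorem contDiffOn_radial : ContDiffOn ℝ ∞ (radial n) (Ioi 0) := by
  rw [contDiffOn_infty_iff_deriv_of_isOpen isOpen_Ioi]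
  exact ⟨fun s hs => (hasDerivAt_radial hs).differentiableAt.differentiableWithinAt,
    (contDiffOn_rpow _).congr fun s hs => (hasDerivAt_radial hs).deriv⟩

theorem abs_radial_le (hn : 2 ≤ n) {s : ℝ} (hs : 0 < s) :
    |radial n s| ≤ 4 * s ^ (3 / 4 - (n : ℝ) / 2) + s := by
  have hn' : (2 : ℝ) ≤ n := by exact_mod_cast hn
  have hc : ∀ p : ℝ, ContinuousOn (fun τ : ℝ => τ ^ p) (Ioi 0) := fun p =>
    continuousOn_id.rpow_const fun τ hτ => Or.inl (ne_of_gt hτ)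
  have hp : 0 < s ^ (3 / 4 - (n : ℝ) / 2) := Real.rpow_pos_of_pos hs _
  rcases le_total 1 s with h1 | h1
  · have hb : ‖radial n s‖ ≤ 1 * |s - 1| :=
      intervalIntegral.norm_integral_le_of_norm_le_const fun τ hτ => by
        rw [uIoc_of_le h1] at hτ
        have hτ0 : 0 < τ := one_pos.trans hτ.1
        rw [Real.norm_eq_abs, abs_of_pos (Real.rpow_pos_of_pos hτ0 _)]
        exact Real.rpow_le_one_of_one_le_of_nonpos hτ.1.le (by linarith)
    rw [Real.norm_eq_abs, one_mul, abs_of_nonneg (sub_nonneg.2 h1)] at hb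
    linarith
  · have hsub : uIcc s 1 ⊆ Ioi (0 : ℝ) := fun τ hτ => lt_of_lt_of_le (lt_min hs one_pos) hτ.1
    have e1 : radial n s = -∫ τ in s..1, τ ^ (-(n : ℝ) / 2) := intervalIntegral.integral_symm _ _
    have h0 : 0 ≤ ∫ τ in s..1, τ ^ (-(n : ℝ) / 2) :=
      intervalIntegral.integral_nonneg h1 fun τ hτ => Real.rpow_nonneg (hs.le.trans hτ.1) _
    have hle : ∫ τ in s..1, τ ^ (-(n : ℝ) / 2)
        ≤ ∫ τ in s..1, s ^ (3 / 4 - (n : ℝ) / 2) * τ ^ (-(3 / 4) : ℝ) := by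
      refine intervalIntegral.integral_mono_on h1 ((hc _).mono hsub).intervalIntegrable
        (((hc _).mono hsub).intervalIntegrable.const_mul _) fun τ hτ => ?_
      have hτ0 : 0 < τ := hs.trans_le hτ.1
      calc τ ^ (-(n : ℝ) / 2) = τ ^ (3 / 4 - (n : ℝ) / 2) * τ ^ (-(3 / 4) : ℝ) := by
            rw [← Real.rpow_add hτ0]; congr 1; ring
        _ ≤ _ := mul_le_mul_of_nonneg_right
            (Real.rpow_le_rpow_of_nonpos hs hτ.1 (by linarith)) (Real.rpow_nonneg hτ0.le _)
    rw [intervalIntegral.integral_const_mul, 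
      integral_rpow (a := s) (b := 1) (r := (-(3 / 4) : ℝ)) (Or.inl (by norm_num))] at hle
    have hs4 : 0 < s ^ (-(3 / 4) + 1 : ℝ) := Real.rpow_pos_of_pos hs _
    rw [e1, abs_neg, abs_of_nonneg h0]
    rw [Real.one_rpow] at hle
    have : (1 - s ^ (-(3 / 4) + 1 : ℝ)) / (-(3 / 4) + 1 : ℝ) ≤ 4 := by
      norm_num; norm_num at hs4; linarith
    nlinarith

theorem isOpen_norm_sq_add_pos (s : ℝ) : IsOpen {x : Eu n | 0 < ‖x‖ ^ 2 + s} :=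
  isOpen_lt continuous_const (by fun_prop)

theorem norm_sq_add_pos_of_ne {x : Eu n} (hx : x ≠ 0) : 0 < ‖x‖ ^ 2 + 0 := by
  have := norm_pos_iff.2 hx; positivity

theorem contDiff_norm_sq_add (s : ℝ) : ContDiff ℝ ∞ fun x : Eu n => ‖x‖ ^ 2 + s :=
  (contDiff_norm_sq ℝ).add contDiff_const

theorem contDiffOn_newton (s : ℝ) : ContDiffOn ℝ ∞ (newton (n := n) s) {x | 0 < ‖x‖ ^ 2 + s} :=
  (contDiffOn_radial.comp (contDiff_norm_sq_add s).contDiffOn fun _ hx => hx).div_const 2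

theorem contDiffOn_newtonGrad (s : ℝ) (i : Fin n) :
    ContDiffOn ℝ ∞ (newtonGrad (n := n) s i) {x | 0 < ‖x‖ ^ 2 + s} :=
  ContDiffOn.mul (by fun_prop)
    ((contDiffOn_rpow _).comp (contDiff_norm_sq_add s).contDiffOn fun _ hx => hx)

theorem pd_norm_sq_add (s : ℝ) (i : Fin n) (x : Eu n) :
    pd i (fun y : Eu n => ‖y‖ ^ 2 + s) x = 2 * x i := by
  rw [pd_add ((contDiff_norm_sq (n := 1) ℝ).contDiffAt.differentiableAt (by simp)) (by fun_prop),
    pd_norm_sq, pd_const, add_zero]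

theorem pd_newton {s : ℝ} {x : Eu n} (hx : 0 < ‖x‖ ^ 2 + s) (i : Fin n) :
    pd i (newton s) x = newtonGrad s i x := by
  have h := pd_comp (i := i) (v := fun y : Eu n => ‖y‖ ^ 2 + s)
    ((hasDerivAt_radial (n := n) hx).div_const 2)
    ((contDiff_norm_sq_add s).contDiffAt.differentiableAt (by simp))
  rw [pd_norm_sq_add] at h
  exact h.trans (by rw [newtonGrad]; ring)

theorem lap_newton {s : ℝ} {x : Eu n} (hx : 0 < ‖x‖ ^ 2 + s) :
    lap n (newton s) x = n * s * (‖x‖ ^ 2 + s) ^ (-(n : ℝ) / 2 - 1) := by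
  have h1 : ∀ i : Fin n, pd i (pd i (newton s)) x
      = (‖x‖ ^ 2 + s) ^ (-(n : ℝ) / 2)
        - n * x i ^ 2 * (‖x‖ ^ 2 + s) ^ (-(n : ℝ) / 2 - 1) := fun i => by
    have h2 : pd i (newton s) =ᶠ[𝓝 x] newtonGrad s i := by
      filter_upwards [(isOpen_norm_sq_add_pos s).mem_nhds hx] with y hy using pd_newton hy i
    have hd : DifferentiableAt ℝ (fun y : Eu n => ‖y‖ ^ 2 + s) x :=
      (contDiff_norm_sq_add s).contDiffAt.differentiableAt (by simp)
    have hr := Real.hasDerivAt_rpow_const (x := ‖x‖ ^ 2 + s) (p := -(n : ℝ) / 2)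
      (Or.inl hx.ne')
    have h3 := pd_comp (i := i) (v := fun y : Eu n => ‖y‖ ^ 2 + s) hr hd
    have h4 := pd_mul (i := i) (x := x) (v := fun y => y i)
      (w := fun y => (‖y‖ ^ 2 + s) ^ (-(n : ℝ) / 2)) (by fun_prop)
      (hr.differentiableAt.comp x hd)
    rw [(h2.pd i).eq_of_nhds]
    refine h4.trans ?_
    rw [h3, pd_norm_sq_add, pd_coord, if_pos rfl]; ring
  rw [lap_eq_sum_pd, Finset.sum_congr rfl fun i _ => h1 i, Finset.sum_sub_distrib,
    ← Finset.sum_mul, ← Finset.mul_sum]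
  have h5 : ∑ i, x i ^ 2 = ‖x‖ ^ 2 := by simp [EuclideanSpace.norm_sq_eq]
  have h6 : (‖x‖ ^ 2 + s) ^ (-(n : ℝ) / 2)
      = (‖x‖ ^ 2 + s) * (‖x‖ ^ 2 + s) ^ (-(n : ℝ) / 2 - 1) := by
    rw [Real.rpow_sub_one hx.ne', mul_div_cancel₀ _ hx.ne']
  rw [h5, h6]
  simp only [Finset.sum_const, Finset.card_univ, Fintype.card_fin, nsmul_eq_mul]
  ring

theorem measurable_newton {s : ℝ} (hs : 0 ≤ s) : Measurable (newton (n := n) s) := by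
  refine measurable_of_continuousOn_compl_singleton 0
    ((contDiffOn_newton s).continuousOn.mono fun x hx => ?_)
  have := norm_pos_iff.2 hx
  simp only [mem_ofPred_eq]; positivity

theorem measurable_newtonGrad (s : ℝ) (i : Fin n) : Measurable (newtonGrad (n := n) s i) := by
  unfold newtonGrad; fun_prop

/-- A locally integrable bound for the kernels `newton s` and their gradients. -/
def newtonBound (n : ℕ) (r : ℝ) : ℝ :=
  2 * r ^ (3 / 2 - (n : ℝ)) + (r ^ 2 + 1) / 2 + r ^ (1 - (n : ℝ))

theorem abs_newton_le (hn : 2 ≤ n) {s : ℝ} (hs : 0 ≤ s) (hs1 : s ≤ 1) {x : Eu n} (hx : x ≠ 0) :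
    |newton s x| ≤ newtonBound n ‖x‖ := by
  have hx0 := norm_pos_iff.2 hx
  have hn' : (2 : ℝ) ≤ n := by exact_mod_cast hn
  have h1 := abs_radial_le hn (show 0 < ‖x‖ ^ 2 + s by positivity)
  have h2 : (‖x‖ ^ 2 + s) ^ (3 / 4 - (n : ℝ) / 2) ≤ ‖x‖ ^ (3 / 2 - (n : ℝ)) := by
    have : ‖x‖ ^ (3 / 2 - (n : ℝ)) = (‖x‖ ^ 2) ^ (3 / 4 - (n : ℝ) / 2) := by
      rw [← Real.rpow_natCast_mul hx0.le]; congr 1; push_cast; ring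
    rw [this]
    exact Real.rpow_le_rpow_of_nonpos (by positivity) (by linarith) (by linarith)
  have h3 : 0 < ‖x‖ ^ (1 - (n : ℝ)) := Real.rpow_pos_of_pos hx0 _
  rw [newton, abs_div, abs_two, newtonBound]
  linarith

theorem abs_newtonGrad_le {s : ℝ} (hs : 0 ≤ s) (i : Fin n) {x : Eu n} (hx : x ≠ 0) :
    |newtonGrad s i x| ≤ newtonBound n ‖x‖ := by
  have hx0 := norm_pos_iff.2 hx
  have h1 : |newtonGrad s i x| ≤ ‖x‖ ^ (1 - (n : ℝ)) := by
    have : ‖x‖ ^ (1 - (n : ℝ)) = ‖x‖ * (‖x‖ ^ 2) ^ (-(n : ℝ) / 2) := by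
      rw [← Real.rpow_natCast_mul hx0.le, Real.rpow_sub hx0, Real.rpow_one, div_eq_mul_inv,
        ← Real.rpow_neg hx0.le]
      congr 2; push_cast; ring
    rw [this, newtonGrad, abs_mul, abs_of_pos (Real.rpow_pos_of_pos (by positivity) _)]
    gcongr ?_ * ?_
    · exact PiLp.norm_apply_le x i
    · exact Real.rpow_le_rpow_of_nonpos (by positivity) (by linarith)
        (by have := Nat.cast_nonneg (α := ℝ) n; linarith)
  have h2 : 0 < ‖x‖ ^ (3 / 2 - (n : ℝ)) := Real.rpow_pos_of_pos hx0 _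
  rw [newtonBound]
  nlinarith [sq_nonneg ‖x‖]

theorem integrableOn_norm_rpow (hn : 0 < n) {p : ℝ} (hp : -(n : ℝ) < p) (R : ℝ) :
    IntegrableOn (fun x : Eu n => ‖x‖ ^ p) (Metric.ball 0 R) := by
  have : Nonempty (Fin n) := ⟨⟨0, hn⟩⟩
  rw [integrableOn_fun_norm_addHaar (μ := volume) (E := Eu n) (f := fun r => r ^ p),
    finrank_euclideanSpace_fin]
  rcases le_or_gt R 0 with hR | hR
  · simp [Ioo_eq_empty_of_le hR]
  have h1 : IntegrableOn (fun y : ℝ => y ^ ((n : ℝ) - 1 + p)) (Ioo 0 R) :=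
    (intervalIntegral.integrableOn_Ioo_rpow_iff hR).2 (by linarith)
  refine h1.congr_fun (fun y hy => ?_) measurableSet_Ioo
  simp only [smul_eq_mul]
  rw [Real.rpow_add hy.1, ← Nat.cast_pred hn, Real.rpow_natCast]

theorem integrableOn_newtonBound (hn : 2 ≤ n) (R : ℝ) :
    IntegrableOn (fun x : Eu n => newtonBound n ‖x‖) (Metric.ball 0 R) := by
  have hn' : (2 : ℝ) ≤ n := by exact_mod_cast hn
  refine (((integrableOn_norm_rpow (by omega) (by linarith) R).const_mul 2).add ?_).add
    (integrableOn_norm_rpow (by omega) (by linarith) R)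
  have : Continuous fun x : Eu n => (‖x‖ ^ 2 + 1) / 2 := by fun_prop
  exact (this.continuousOn.integrableOn_compact (isCompact_closedBall 0 R)).mono_set
    Metric.ball_subset_closedBall

theorem ae_ne_zero (hn : 0 < n) : ∀ᵐ x : Eu n, x ≠ 0 := by
  have : Nonempty (Fin n) := ⟨⟨0, hn⟩⟩
  exact Measure.ae_ne volume 0

theorem integrableOn_newton (hn : 2 ≤ n) {s : ℝ} (hs : 0 ≤ s) (hs1 : s ≤ 1) (R : ℝ) :
    IntegrableOn (newton (n := n) s) (Metric.ball 0 R) :=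
  (integrableOn_newtonBound hn R).mono' (measurable_newton hs).aestronglyMeasurable
    (ae_restrict_of_ae ((ae_ne_zero (by omega)).mono fun _ hx => abs_newton_le hn hs hs1 hx))

theorem integrableOn_newtonGrad (hn : 2 ≤ n) {s : ℝ} (hs : 0 ≤ s) (i : Fin n) (R : ℝ) :
    IntegrableOn (newtonGrad (n := n) s i) (Metric.ball 0 R) :=
  (integrableOn_newtonBound hn R).mono' (measurable_newtonGrad s i).aestronglyMeasurable
    (ae_restrict_of_ae ((ae_ne_zero (by omega)).mono fun _ hx => abs_newtonGrad_le hs i hx))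

theorem tendsto_integral_abs_newton_sub (hn : 2 ≤ n) (R : ℝ) :
    Filter.Tendsto (fun s => ∫ x in Metric.ball (0 : Eu n) R, |newton s x - newton 0 x|)
      (𝓝[>] 0) (𝓝 0) := by
  rw [show 𝓝 (0 : ℝ) = 𝓝 (∫ _ in Metric.ball (0 : Eu n) R, (0 : ℝ)) by simp]
  have hev : ∀ᶠ s : ℝ in 𝓝[>] 0, s ∈ Ioc (0 : ℝ) 1 := Ioc_mem_nhdsGT one_pos
  refine tendsto_integral_filter_of_dominated_convergence
    (fun x => 2 * newtonBound n ‖x‖) ?_ ?_ ((integrableOn_newtonBound hn R).const_mul 2) ?_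
  · filter_upwards [hev] with s hs
    exact ((measurable_newton hs.1.le).sub
      (measurable_newton le_rfl)).abs.aestronglyMeasurable
  · filter_upwards [hev] with s hs
    refine ae_restrict_of_ae ((ae_ne_zero (by omega)).mono fun x hx => ?_)
    rw [Real.norm_eq_abs, abs_abs]
    refine (abs_sub _ _).trans ?_
    linarith [abs_newton_le hn hs.1.le hs.2 hx, abs_newton_le hn le_rfl zero_le_one hx]
  · refine ae_restrict_of_ae ((ae_ne_zero (by omega)).mono fun x hx => ?_)
    have hc : ContinuousAt (fun s : ℝ => |newton s x - newton 0 x|) 0 := by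
      have : ContinuousAt (radial n) (‖x‖ ^ 2 + 0) :=
        (hasDerivAt_radial (norm_sq_add_pos_of_ne hx)).continuousAt
      have h1 : ContinuousAt (fun s : ℝ => newton s x) 0 :=
        (ContinuousAt.comp (f := fun s : ℝ => ‖x‖ ^ 2 + s) this (by fun_prop)).div_const 2
      exact (h1.sub continuousAt_const).abs
    simpa [ContinuousAt] using hc.tendsto.mono_left (nhdsWithin_le_nhds (s := Ioi 0))

theorem tendsto_integral_abs_newtonGrad_sub (hn : 2 ≤ n) (i : Fin n) (R : ℝ) :
    Filter.Tendsto
      (fun s => ∫ x in Metric.ball (0 : Eu n) R, |newtonGrad s i x - newtonGrad 0 i x|)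
      (𝓝[>] 0) (𝓝 0) := by
  rw [show 𝓝 (0 : ℝ) = 𝓝 (∫ _ in Metric.ball (0 : Eu n) R, (0 : ℝ)) by simp]
  have hev : ∀ᶠ s : ℝ in 𝓝[>] 0, s ∈ Ioi (0 : ℝ) := self_mem_nhdsWithin
  refine tendsto_integral_filter_of_dominated_convergence
    (fun x => 2 * newtonBound n ‖x‖) ?_ ?_ ((integrableOn_newtonBound hn R).const_mul 2) ?_
  · exact Filter.Eventually.of_forall fun s => ((measurable_newtonGrad s i).sub
      (measurable_newtonGrad 0 i)).abs.aestronglyMeasurable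
  · filter_upwards [hev] with s hs
    refine ae_restrict_of_ae ((ae_ne_zero (by omega)).mono fun x hx => ?_)
    rw [Real.norm_eq_abs, abs_abs]
    refine (abs_sub _ _).trans ?_
    linarith [abs_newtonGrad_le (le_of_lt hs) i hx, abs_newtonGrad_le le_rfl i hx]
  · refine ae_restrict_of_ae ((ae_ne_zero (by omega)).mono fun x hx => ?_)
    have hc : ContinuousAt (fun s : ℝ => |newtonGrad s i x - newtonGrad 0 i x|) 0 := by
      have : ContinuousAt (fun τ : ℝ => τ ^ (-(n : ℝ) / 2)) (‖x‖ ^ 2 + 0) :=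
        Real.continuousAt_rpow_const _ _ (Or.inl (norm_sq_add_pos_of_ne hx).ne')
      have h1 : ContinuousAt (fun s : ℝ => newtonGrad s i x) 0 :=
        continuousAt_const.mul
          (ContinuousAt.comp (f := fun s : ℝ => ‖x‖ ^ 2 + s) this (by fun_prop))
      exact (h1.sub continuousAt_const).abs
    simpa [ContinuousAt] using hc.tendsto.mono_left (nhdsWithin_le_nhds (s := Ioi 0))

end Newton

section VolumePotential

variable {n : ℕ}

theorem newton_neg (s : ℝ) (x : Eu n) : newton s (-x) = newton s x := by
  simp [newton]

theorem newton_sub_comm (s : ℝ) (x y : Eu n) : newton s (x - y) = newton s (y - x) := by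
  rw [← newton_neg, neg_sub]

theorem sum_smul_proj_stdVec (c : Fin n → ℝ) (i : Fin n) :
    (∑ j, c j • (EuclideanSpace.proj j : Eu n →L[ℝ] ℝ)) (stdVec n i) = c i := by
  simp [stdVec]

theorem hasFDerivAt_sum_pd {v : Eu n → ℝ} {x : Eu n} (hv : DifferentiableAt ℝ v x) :
    HasFDerivAt v (∑ i, pd i v x • (EuclideanSpace.proj i : Eu n →L[ℝ] ℝ)) x := by
  convert hv.hasFDerivAt using 1
  refine ContinuousLinearMap.coe_inj.1
    ((EuclideanSpace.basisFun (Fin n) ℝ).toBasis.ext fun i => ?_)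
  simp [stdVec, pd]

theorem lap_eq_zero_of_notMem_tsupport {v : Eu n → ℝ} {x : Eu n} (hx : x ∉ tsupport v) :
    lap n v x = 0 := by
  have h0 : ∀ i : Fin n, pd i (0 : Eu n → ℝ) = 0 := fun i => funext fun x => pd_const 0
  rw [lap_congr (notMem_tsupport_iff_eventuallyEq.1 hx), lap_eq_sum_pd]
  simp [h0]

section

variable {f g h : Eu n → ℝ} {R : ℝ} {y : Eu n}

theorem indicator_ball_sub_mul (hf0 : ∀ z ∉ Metric.ball 0 R, f z = 0)
    (hy : y ∈ Metric.ball 0 R) (g : Eu n → ℝ) (z : Eu n) :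
    (Metric.ball 0 (2 * R)).indicator g (y - z) * f z = g (y - z) * f z := by
  by_cases hz : z ∈ Metric.ball 0 R
  · rw [indicator_of_mem]
    rw [mem_ball_zero_iff] at *
    exact (norm_sub_le _ _).trans_lt (by linarith)
  · rw [hf0 z hz, mul_zero, mul_zero]

theorem integrable_comp_sub_mul_of_bound (hfm : Measurable f) (hf1 : ∀ z, |f z| ≤ 1)
    (hf0 : ∀ z ∉ Metric.ball 0 R, f z = 0) (hg : IntegrableOn g (Metric.ball 0 (2 * R)))
    (hy : y ∈ Metric.ball 0 R) : Integrable fun z => g (y - z) * f z := by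
  simp_rw [← indicator_ball_sub_mul hf0 hy g]
  refine Integrable.mul_bdd (c := 1) (((integrable_indicator_iff Metric.isOpen_ball.measurableSet).2
    hg).comp_sub_left y) hfm.aestronglyMeasurable (Filter.Eventually.of_forall hf1)

theorem abs_integral_comp_sub_mul_sub_le (hfm : Measurable f) (hf1 : ∀ z, |f z| ≤ 1)
    (hf0 : ∀ z ∉ Metric.ball 0 R, f z = 0) (hg : IntegrableOn g (Metric.ball 0 (2 * R)))
    (hh : IntegrableOn h (Metric.ball 0 (2 * R))) (hy : y ∈ Metric.ball 0 R) :
    |(∫ z, g (y - z) * f z) - ∫ z, h (y - z) * f z|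
      ≤ ∫ x in Metric.ball 0 (2 * R), |g x - h x| := by
  rw [← integral_sub (integrable_comp_sub_mul_of_bound hfm hf1 hf0 hg hy)
    (integrable_comp_sub_mul_of_bound hfm hf1 hf0 hh hy)]
  have hInt : Integrable ((Metric.ball (0 : Eu n) (2 * R)).indicator fun x => |g x - h x|) :=
    (integrable_indicator_iff Metric.isOpen_ball.measurableSet).2 (hg.sub hh).abs
  rw [← integral_indicator Metric.isOpen_ball.measurableSet,
    ← integral_sub_left_eq_self (indicator _ _) volume y,
    ← Real.norm_eq_abs]
  refine norm_integral_le_of_norm_le (hInt.comp_sub_left y)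
    (Filter.Eventually.of_forall fun z => ?_)
  rw [← sub_mul, ← indicator_ball_sub_mul hf0 hy (fun x => g x - h x), norm_mul]
  have : ‖(Metric.ball 0 (2 * R)).indicator (fun x => g x - h x) (y - z)‖
      = (Metric.ball 0 (2 * R)).indicator (fun x => |g x - h x|) (y - z) :=
    norm_indicator_eq_indicator_norm _ _
  rw [this]
  exact mul_le_of_le_one_right (indicator_nonneg (fun _ _ => abs_nonneg _) _) (hf1 z)

theorem hasFDerivAt_newton_potential (hn : 2 ≤ n) (hfm : Measurable f) (hf1 : ∀ z, |f z| ≤ 1)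
    (hf0 : ∀ z ∉ Metric.ball 0 R, f z = 0) (hy : y ∈ Metric.ball 0 R) :
    HasFDerivAt (fun y => ∫ z, newton 0 (y - z) * f z)
      (∑ i, (∫ z, newtonGrad 0 i (y - z) * f z) • (EuclideanSpace.proj i : Eu n →L[ℝ] ℝ)) y ∧
    ∀ i, ContinuousAt (fun y => ∫ z, newtonGrad 0 i (y - z) * f z) y := by
  set s : ℕ → ℝ := fun k => 1 / (k + 1) with hs
  have hs0 : ∀ k, 0 < s k := fun k => by positivity
  have hs1 : ∀ k, s k ≤ 1 := fun k => by
    rw [hs]; exact (div_le_one (by positivity)).2 (by simp)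
  have hst : Filter.Tendsto s Filter.atTop (𝓝[>] 0) :=
    tendsto_nhdsWithin_iff.2 ⟨tendsto_one_div_add_atTop_nhds_zero_nat,
      Filter.Eventually.of_forall hs0⟩
  have hball := Metric.isOpen_ball (x := (0 : Eu n)) (ε := R)
  have hfi : Integrable f := by
    refine Integrable.mono' (g := (Metric.ball (0 : Eu n) R).indicator fun _ => (1 : ℝ))
      ((integrable_indicator_iff hball.measurableSet).2 (integrableOn_const
        measure_ball_lt_top.ne)) hfm.aestronglyMeasurable
      (Filter.Eventually.of_forall fun z => ?_)
    by_cases hz : z ∈ Metric.ball 0 R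
    · rw [indicator_of_mem hz]; exact hf1 z
    · rw [hf0 z hz, norm_zero]; exact indicator_nonneg (fun _ _ => zero_le_one) _
  have hpot : ∀ k (p : Eu n), ContDiffAt ℝ ∞ (fun y => ∫ z, newton (s k) (y - z) * f z) p ∧
      ∀ i, pd i (fun y => ∫ z, newton (s k) (y - z) * f z) p
        = ∫ z, newtonGrad (s k) i (p - z) * f z := fun k p => by
    have hO : ∀ x : Eu n, 0 < ‖x‖ ^ 2 + s k := fun x => by have := hs0 k; positivity
    have := contDiffAt_potential (m := volume) (isOpen_norm_sq_add_pos (s k))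
      (contDiffOn_newton (s k)) (isCompact_closedBall (0 : Eu n) R) hfi
      (Filter.Eventually.of_forall fun z hz => hf0 z fun h =>
        hz (Metric.ball_subset_closedBall h)) (p := p) (fun z _ => hO _)
    refine ⟨this.1, fun i => ?_⟩
    rw [this.2 i]
    simp_rw [pd_newton (hO _)]
  have hgrad : ∀ i, ∀ k, ∀ x ∈ Metric.ball (0 : Eu n) R,
      |(∫ z, newtonGrad (s k) i (x - z) * f z) - ∫ z, newtonGrad 0 i (x - z) * f z|
      ≤ ∫ z in Metric.ball 0 (2 * R), |newtonGrad (s k) i z - newtonGrad 0 i z| :=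
    fun i k x hx => abs_integral_comp_sub_mul_sub_le hfm hf1 hf0
      (integrableOn_newtonGrad hn (hs0 k).le i _) (integrableOn_newtonGrad hn le_rfl i _) hx
  have hgt := fun i => (tendsto_integral_abs_newtonGrad_sub hn i (2 * R)).comp hst
  have hcont : ∀ i k (p : Eu n),
      ContinuousAt (fun y => ∫ z, newtonGrad (s k) i (y - z) * f z) p := fun i k p => by
    have := ((hpot k p).1.pd i).continuousAt
    simpa only [funext fun q => (hpot k q).2 i] using this
  refine ⟨hasFDerivAt_of_tendstoUniformlyOn (l := Filter.atTop)
    (f := fun k y => ∫ z, newton (s k) (y - z) * f z)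
    (f' := fun k y => ∑ i, (∫ z, newtonGrad (s k) i (y - z) * f z) •
      (EuclideanSpace.proj i : Eu n →L[ℝ] ℝ))
    (g' := fun y => ∑ i, (∫ z, newtonGrad 0 i (y - z) * f z) •
      (EuclideanSpace.proj i : Eu n →L[ℝ] ℝ)) hball ?_ ?_ ?_ hy, fun i => ?_⟩
  · rw [Metric.tendstoUniformlyOn_iff]
    intro ε hε
    have h1 : Filter.Tendsto (fun k => ∑ i, (∫ z in Metric.ball (0 : Eu n) (2 * R),
        |newtonGrad (s k) i z - newtonGrad 0 i z|) * ‖(EuclideanSpace.proj i : Eu n →L[ℝ] ℝ)‖)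
        Filter.atTop (𝓝 (∑ i : Fin n, 0 * ‖(EuclideanSpace.proj i : Eu n →L[ℝ] ℝ)‖)) :=
      tendsto_finsetSum _ fun i _ => (hgt i).mul_const _
    simp only [zero_mul, Finset.sum_const_zero] at h1
    filter_upwards [h1.eventually_lt_const hε] with k hk x hx
    refine lt_of_le_of_lt ?_ hk
    rw [dist_eq_norm', ← Finset.sum_sub_distrib]
    refine (norm_sum_le _ _).trans (Finset.sum_le_sum fun i _ => ?_)
    rw [← sub_smul, norm_smul]
    exact mul_le_mul_of_nonneg_right (hgrad i k x hx) (norm_nonneg _)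
  · intro k x _
    have := hasFDerivAt_sum_pd ((hpot k x).1.differentiableAt (by simp))
    simpa only [(hpot k x).2] using this
  · intro x hx
    rw [tendsto_iff_dist_tendsto_zero]
    refine squeeze_zero (fun _ => dist_nonneg) (fun k => ?_)
      ((tendsto_integral_abs_newton_sub hn (2 * R)).comp hst)
    exact abs_integral_comp_sub_mul_sub_le hfm hf1 hf0
      (integrableOn_newton hn (hs0 k).le (hs1 k) _)
      (integrableOn_newton hn le_rfl zero_le_one _) hx
  · have : TendstoUniformlyOn (fun k y => ∫ z, newtonGrad (s k) i (y - z) * f z)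
        (fun y => ∫ z, newtonGrad 0 i (y - z) * f z) Filter.atTop (Metric.ball 0 R) := by
      rw [Metric.tendstoUniformlyOn_iff]
      intro ε hε
      filter_upwards [(hgt i).eventually_lt_const hε] with k hk x hx
      rw [dist_comm]
      exact (hgrad i k x hx).trans_lt hk
    exact (this.continuousOn (Filter.Frequently.of_forall fun k x _ =>
      (hcont i k x).continuousWithinAt)).continuousAt (hball.mem_nhds hy)

end

/-- The total mass of the Laplacian of the Newtonian kernel. -/
def newtonMass (n : ℕ) : ℝ := ∫ x : Eu n, n * (1 + ‖x‖ ^ 2) ^ (-((n : ℝ) + 2) / 2)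

theorem integrable_newtonMass (n : ℕ) :
    Integrable fun x : Eu n => n * (1 + ‖x‖ ^ 2) ^ (-((n : ℝ) + 2) / 2) :=
  (integrable_rpow_neg_one_add_norm_sq (by simp)).const_mul _

theorem newtonMass_pos (hn : 0 < n) : 0 < newtonMass n := by
  have hpos : ∀ x : Eu n, 0 < n * (1 + ‖x‖ ^ 2) ^ (-((n : ℝ) + 2) / 2) := fun x =>
    mul_pos (Nat.cast_pos.2 hn) (Real.rpow_pos_of_pos (by positivity) _)
  refine (integral_pos_iff_support_of_nonneg (fun x => (hpos x).le)
    (integrable_newtonMass n)).2 ?_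
  rw [show Function.support (fun x : Eu n => n * (1 + ‖x‖ ^ 2) ^ (-((n : ℝ) + 2) / 2)) = univ from
    eq_univ_of_forall fun x => (hpos x).ne']
  exact Measure.measure_univ_pos.2 (NeZero.ne _)

theorem pd_comp_sub_left {v : Eu n → ℝ} {p x : Eu n} (i : Fin n) :
    pd i (fun z => v (p - z)) x = -pd i v (p - x) := by
  simp only [pd, sub_eq_add_neg]
  have h1 := fderiv_comp_smul (𝕜 := ℝ) (f := fun z => v (p + z)) (x := x) (-1)
  simp only [neg_smul, one_smul, fderiv_comp_add_left] at h1
  rw [h1]; rfl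

theorem lap_comp_sub_left {v : Eu n → ℝ} {p x : Eu n} :
    lap n (fun z => v (p - z)) x = lap n v (p - x) := by
  simp only [lap_eq_sum_pd]
  refine Finset.sum_congr rfl fun i _ => ?_
  rw [show pd i (fun z => v (p - z)) = fun x => -pd i v (p - x) from
    funext fun x => pd_comp_sub_left i]
  have h1 := pd_comp_sub_left (v := pd i v) (p := p) (x := x) i
  rw [pd, fderiv_fun_neg, neg_apply, ← pd, h1, neg_neg]

theorem integral_newton_mul_lap_of_pos {s : ℝ} (hs : 0 < s) {ψ : Eu n → ℝ} (hψ : ContDiff ℝ ∞ ψ)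
    (hψc : HasCompactSupport ψ) : ∫ x, newton s x * lap n ψ x
      = ∫ x : Eu n, n * (1 + ‖x‖ ^ 2) ^ (-((n : ℝ) + 2) / 2) * ψ (Real.sqrt s • x) := by
  have hpos : ∀ x : Eu n, 0 < ‖x‖ ^ 2 + s := fun x => by positivity
  have hN : ContDiff ℝ ∞ (newton (n := n) s) := contDiffOn_univ.1
    ((contDiffOn_newton s).mono fun x _ => hpos x)
  have h1 : ∫ x, newton s x * lap n ψ x = ∫ x, lap n (newton s) x * ψ x := by
    simp only [lap_eq_sum_pd, Finset.mul_sum, Finset.sum_mul]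
    have hInt : ∀ v w : Eu n → ℝ, ContDiff ℝ ∞ v → ContDiff ℝ ∞ w → HasCompactSupport w →
        Integrable fun x => v x * w x := fun v w hv hw hwc =>
      (hv.continuous.mul hw.continuous).integrable_of_hasCompactSupport hwc.mul_left
    rw [integral_finsetSum _ fun i _ => hInt _ _ hN ((hψ.pd i).pd i) ((hψc.pd i).pd i),
      integral_finsetSum _ fun i _ => hInt _ _ ((hN.pd i).pd i) hψ hψc]
    refine Finset.sum_congr rfl fun i _ => ?_
    rw [integral_mul_pd_eq_neg (hN.of_le (by simp)) ((hψ.pd i).of_le (by simp)) (hψc.pd i),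
      integral_mul_pd_eq_neg ((hN.pd i).of_le (by simp)) (hψ.of_le (by simp)) hψc, neg_neg]
  rw [h1]
  have hsq : 0 < Real.sqrt s := Real.sqrt_pos.2 hs
  have h2 := Measure.integral_comp_smul volume (fun x : Eu n => lap n (newton s) x * ψ x)
    (Real.sqrt s)
  have hsn : 0 < Real.sqrt s ^ n := by positivity
  rw [finrank_euclideanSpace_fin, abs_of_pos (by positivity), smul_eq_mul] at h2
  have h3 : ∫ x, lap n (newton s) x * ψ x
      = Real.sqrt s ^ n * ∫ x, lap n (newton s) (Real.sqrt s • x) * ψ (Real.sqrt s • x) := by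
    rw [h2]; field_simp
  rw [h3, ← integral_const_mul]
  congr 1; ext x
  rw [lap_newton (hpos _), norm_smul, Real.norm_of_nonneg hsq.le, mul_pow, Real.sq_sqrt hs.le,
    show s * ‖x‖ ^ 2 + s = s * (1 + ‖x‖ ^ 2) by ring, Real.mul_rpow hs.le (by positivity),
    show -((n : ℝ) + 2) / 2 = -(n : ℝ) / 2 - 1 by ring, Real.rpow_sub_one hs.ne']
  have h4 : Real.sqrt s ^ n * s ^ (-(n : ℝ) / 2) = 1 := by
    rw [Real.sqrt_eq_rpow, ← Real.rpow_mul_natCast hs.le, ← Real.rpow_add hs]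
    rw [show 1 / 2 * (n : ℝ) + -(n : ℝ) / 2 = 0 by ring, Real.rpow_zero]
  calc _ = (Real.sqrt s ^ n * s ^ (-(n : ℝ) / 2)) * (n * (s / s) *
        (1 + ‖x‖ ^ 2) ^ (-(n : ℝ) / 2 - 1) * ψ (Real.sqrt s • x)) := by ring
    _ = _ := by rw [h4, div_self hs.ne']; ring

/-- The Newtonian kernel is a fundamental solution of the Laplacian, up to normalization. -/
theorem integral_newton_mul_lap (hn : 2 ≤ n) {ψ : Eu n → ℝ} (hψ : ContDiff ℝ ∞ ψ)
    (hψc : HasCompactSupport ψ) : ∫ x, newton 0 x * lap n ψ x = newtonMass n * ψ 0 := by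
  have hlapc : Continuous (lap n ψ) :=
    continuous_finsetSum _ fun i _ => ((hψ.pd i).pd i).continuous
  have hlaps : HasCompactSupport (lap n ψ) := by
    refine hψc.mono' fun x hx => ?_
    by_contra h
    exact hx (lap_eq_zero_of_notMem_tsupport h)
  obtain ⟨R, hR⟩ := hlaps.isCompact.isBounded.subset_ball (0 : Eu n)
  obtain ⟨B, hB⟩ := hlapc.bounded_above_of_compact_support hlaps
  obtain ⟨D, hD⟩ := hψ.continuous.bounded_above_of_compact_support hψc
  have heq : ∀ s : ℝ, ∫ x, newton s x * lap n ψ x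
      = ∫ x in Metric.ball 0 R, newton s x * lap n ψ x := fun s =>
    (setIntegral_eq_integral_of_forall_compl_eq_zero fun x hx => by
      rw [image_eq_zero_of_notMem_tsupport fun h => hx (hR h), mul_zero]).symm
  have hInt : ∀ s : ℝ, 0 ≤ s → s ≤ 1 →
      IntegrableOn (fun x => newton s x * lap n ψ x) (Metric.ball 0 R) := fun s hs hs1 =>
    (integrableOn_newton hn hs hs1 R).mul_bdd hlapc.aestronglyMeasurable
      (Filter.Eventually.of_forall hB)
  have hev : ∀ᶠ s : ℝ in 𝓝[>] 0, s ∈ Ioc (0 : ℝ) 1 := Ioc_mem_nhdsGT one_pos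
  have h1 : Filter.Tendsto (fun s => ∫ x, newton s x * lap n ψ x) (𝓝[>] 0)
      (𝓝 (∫ x, newton 0 x * lap n ψ x)) := by
    rw [tendsto_iff_dist_tendsto_zero]
    have h2 := (tendsto_integral_abs_newton_sub hn R).mul_const B
    rw [zero_mul] at h2
    refine squeeze_zero' (Filter.Eventually.of_forall fun _ => dist_nonneg) ?_ h2
    filter_upwards [hev] with s hs
    rw [heq, heq, dist_eq_norm, ← integral_sub (hInt s hs.1.le hs.2) (hInt 0 le_rfl zero_le_one),
      ← integral_mul_const]
    refine norm_integral_le_of_norm_le (((integrableOn_newton hn hs.1.le hs.2 R).sub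
      (integrableOn_newton hn le_rfl zero_le_one R)).abs.mul_const B)
      (Filter.Eventually.of_forall fun x => ?_)
    rw [← sub_mul, norm_mul]
    exact mul_le_mul_of_nonneg_left (hB x) (norm_nonneg _)
  have h2 : Filter.Tendsto (fun s => ∫ x, newton s x * lap n ψ x) (𝓝[>] 0)
      (𝓝 (newtonMass n * ψ 0)) := by
    rw [newtonMass, ← integral_mul_const]
    have : Filter.Tendsto (fun s : ℝ => ∫ x : Eu n,
        n * (1 + ‖x‖ ^ 2) ^ (-((n : ℝ) + 2) / 2) * ψ (Real.sqrt s • x)) (𝓝[>] 0)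
        (𝓝 (∫ x : Eu n, n * (1 + ‖x‖ ^ 2) ^ (-((n : ℝ) + 2) / 2) * ψ 0)) := by
      refine tendsto_integral_filter_of_dominated_convergence
        (fun x => n * (1 + ‖x‖ ^ 2) ^ (-((n : ℝ) + 2) / 2) * D)
        (Filter.Eventually.of_forall fun s => ?_)
        (Filter.Eventually.of_forall fun s => Filter.Eventually.of_forall fun x => ?_)
        ((integrable_newtonMass n).mul_const D) (Filter.Eventually.of_forall fun x => ?_)
      · exact (integrable_newtonMass n).aestronglyMeasurable.mul
          (hψ.continuous.comp (continuous_const_smul _)).aestronglyMeasurable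
      · rw [norm_mul, Real.norm_of_nonneg (by positivity)]
        exact mul_le_mul_of_nonneg_left (hD _) (by positivity)
      · have hc : Continuous fun s : ℝ => ψ (Real.sqrt s • x) :=
          hψ.continuous.comp (Real.continuous_sqrt.smul continuous_const)
        have := (hc.tendsto 0).mono_left (nhdsWithin_le_nhds (s := Ioi 0))
        rw [Real.sqrt_zero, zero_smul] at this
        exact this.const_mul _
    refine this.congr' ?_
    filter_upwards [hev] with s hs
    exact (integral_newton_mul_lap_of_pos hs.1 hψ hψc).symm
  exact tendsto_nhds_unique h1 h2

/-- The Newtonian potential of a bounded open set is smooth inside the set, where its Laplacian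
is constant. -/
theorem newton_potential_indicator (hn : 2 ≤ n) {Ω : Set (Eu n)} (hΩ : IsOpen Ω)
    (hΩb : Bornology.IsBounded Ω) {p : Eu n} (hp : p ∈ Ω) :
    ContDiffAt ℝ ∞ (fun y => ∫ z, newton 0 (y - z) * Ω.indicator 1 z) p ∧
      lap n (fun y => ∫ z, newton 0 (y - z) * Ω.indicator 1 z) p = newtonMass n := by
  obtain ⟨R, hR⟩ := hΩb.subset_ball (0 : Eu n)
  obtain ⟨χ, hχ, hχc, hχΩ, hχ1, hχI⟩ :=
    exists_smooth_cutoff (isCompact_singleton (x := p)) hΩ (singleton_subset_iff.2 hp)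
  rw [nhdsSet_singleton] at hχ1
  have hχ0 : ∀ z ∉ Metric.ball 0 R, χ z = 0 := fun z hz =>
    image_eq_zero_of_notMem_tsupport fun h => hz (hR (hχΩ h))
  have hχabs : ∀ z, |χ z| ≤ 1 := fun z => abs_le.2 ⟨by linarith [(hχI z).1], (hχI z).2⟩
  have hind0 : ∀ z ∉ Metric.ball 0 R, Ω.indicator (1 : Eu n → ℝ) z = 0 := fun z hz =>
    indicator_of_notMem (fun h => hz (hR h)) _
  have hindabs : ∀ z, |Ω.indicator (1 : Eu n → ℝ) z| ≤ 1 := fun z => by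
    by_cases h : z ∈ Ω <;> simp [h]
  have hindm : Measurable (Ω.indicator (1 : Eu n → ℝ)) := measurable_one.indicator hΩ.measurableSet
  set f : Eu n → ℝ := fun z => Ω.indicator 1 z - χ z with hf
  have hloc := integrableOn_newton hn le_rfl zero_le_one (2 * R)
  -- the smooth part
  have hfi : Integrable ((Metric.ball (0 : Eu n) (2 * R)).indicator (newton 0)) :=
    (integrable_indicator_iff Metric.isOpen_ball.measurableSet).2 hloc
  have hA := contDiffAt_potential (m := volume) isOpen_univ hχ.contDiffOn
    (isCompact_closedBall (0 : Eu n) (2 * R)) hfi (Filter.Eventually.of_forall fun z hz =>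
      indicator_of_notMem (fun h => hz (Metric.ball_subset_closedBall h)) _)
    (p := p) (fun _ _ => mem_univ _)
  have hAl := lap_potential (m := volume) isOpen_univ hχ.contDiffOn
    (isCompact_closedBall (0 : Eu n) (2 * R)) hfi (Filter.Eventually.of_forall fun z hz =>
      indicator_of_notMem (fun h => hz (Metric.ball_subset_closedBall h)) _)
    (p := p) (fun _ _ => mem_univ _)
  -- the harmonic part
  have hfint : Integrable f := by
    refine Integrable.sub ?_ (hχ.continuous.integrable_of_hasCompactSupport hχc)
    exact (integrable_indicator_iff hΩ.measurableSet).2 (integrableOn_const hΩb.measure_lt_top.ne)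
  set T := Metric.closedBall (0 : Eu n) R \ interior {x | χ x = 1} with hT
  have hTc : IsCompact T := (isCompact_closedBall _ _).diff isOpen_interior
  have hfT : ∀ z ∉ T, f z = 0 := fun z hz => by
    by_cases hzR : z ∈ Metric.ball 0 R
    · have h1 : χ z = 1 := interior_subset (s := {x | χ x = 1}) (by
        by_contra h; exact hz ⟨Metric.ball_subset_closedBall hzR, h⟩)
      have h2 : z ∈ Ω := hχΩ (subset_tsupport _ (by rw [Function.mem_support, h1]; simp))
      simp [hf, h1, h2]
    · simp only [hf]; rw [hind0 z hzR, hχ0 z hzR, sub_zero]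
  have hTO : ∀ z ∈ T, p - z ∈ {x : Eu n | 0 < ‖x‖ ^ 2 + 0} := fun z hz =>
    norm_sq_add_pos_of_ne (sub_ne_zero.2 fun h => hz.2 (h ▸ mem_interior_iff_mem_nhds.2 hχ1))
  have hB := contDiffAt_potential (m := volume) (isOpen_norm_sq_add_pos 0) (contDiffOn_newton 0)
    hTc hfint (Filter.Eventually.of_forall hfT) hTO
  have hBl := lap_potential (m := volume) (isOpen_norm_sq_add_pos 0) (contDiffOn_newton 0)
    hTc hfint (Filter.Eventually.of_forall hfT) hTO
  have hBl0 : ∫ z, lap n (newton 0) (p - z) * f z = 0 := by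
    refine integral_eq_zero_of_ae (Filter.Eventually.of_forall fun z => ?_)
    change lap n (newton 0) (p - z) * f z = 0
    by_cases hz : z ∈ T
    · rw [lap_newton (hTO z hz)]; ring
    · rw [hfT z hz, mul_zero]
  have hAl0 : ∫ z, lap n χ (p - z) * (Metric.ball (0 : Eu n) (2 * R)).indicator (newton 0) z
      = newtonMass n := by
    have h1 := integral_newton_mul_lap hn (ψ := fun z => χ (p - z))
      (hχ.comp (contDiff_const.sub contDiff_id))
      (hχc.comp_homeomorph (Homeomorph.subLeft p))
    rw [sub_zero, hχ1.self_of_nhds, mul_one] at h1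
    rw [← h1]
    congr 1; ext z
    rw [lap_comp_sub_left, mul_comm]
    by_cases hz : z ∈ Metric.ball 0 (2 * R)
    · rw [indicator_of_mem hz]
    · have : lap n χ (p - z) = 0 := by
        have : p - z ∉ tsupport χ := fun h => hz (by
          have h1 := hR (hχΩ h)
          have h2 := hR hp
          rw [mem_ball_zero_iff] at *
          calc ‖z‖ = ‖p - (p - z)‖ := by congr 1; abel
            _ ≤ ‖p‖ + ‖p - z‖ := norm_sub_le _ _
            _ < 2 * R := by linarith)
        exact lap_eq_zero_of_notMem_tsupport this
      rw [this, mul_zero, mul_zero]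
  have heq : (fun y => ∫ z, newton 0 (y - z) * Ω.indicator 1 z) =ᶠ[𝓝 p]
      (fun y => ∫ z, χ (y - z) * (Metric.ball (0 : Eu n) (2 * R)).indicator (newton 0) z)
        + fun y => ∫ z, newton 0 (y - z) * f z := by
    filter_upwards [Metric.isOpen_ball.mem_nhds (hR hp)] with y hy
    have h1 : ∫ z, χ (y - z) * (Metric.ball (0 : Eu n) (2 * R)).indicator (newton 0) z
        = ∫ z, newton 0 (y - z) * χ z := by
      rw [← integral_sub_left_eq_self _ volume y]
      congr 1; ext z
      rw [sub_sub_cancel, mul_comm, indicator_ball_sub_mul hχ0 hy]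
    rw [Pi.add_apply, h1, ← integral_add
      (integrable_comp_sub_mul_of_bound hχ.continuous.measurable hχabs hχ0 hloc hy)]
    · congr 1; ext z
      simp only [hf]; ring
    · have := (integrable_comp_sub_mul_of_bound hindm hindabs hind0 hloc hy).sub
        (integrable_comp_sub_mul_of_bound hχ.continuous.measurable hχabs hχ0 hloc hy)
      refine this.congr (Filter.Eventually.of_forall fun z => ?_)
      simp only [Pi.sub_apply, hf]; ring
  refine ⟨(hA.1.add hB.1).congr_of_eventuallyEq heq, ?_⟩
  rw [lap_congr heq]
  refine (lap_add hA.1 hB.1).trans ?_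
  rw [hAl, hBl, hAl0, hBl0, add_zero]

end VolumePotential

section Flatness

theorem HasCkBoundary.exists_local_defining {n : ℕ} {Ω : Set (Eu n)} (hΩ : HasCkBoundary ⊤ Ω)
    {x₀ : Eu n} (hx₀ : x₀ ∈ frontier Ω) :
    ∃ (ν : Eu n) (F : Eu n → ℝ), ‖ν‖ = 1 ∧ ∀ ε > 0, ∃ r > 0, ∀ y ∈ Metric.ball x₀ r,
      (y ∈ Ω ↔ F y < 0) ∧ (y ∈ frontier Ω ↔ F y = 0) ∧
      ∀ z ∈ Metric.ball x₀ r, |F y - F z - inner ℝ ν (y - z)| ≤ ε * ‖y - z‖ := by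
  obtain ⟨U, f, hU, hxU, hf, hg, hin, hbd⟩ := hΩ x₀ hx₀
  set g := gradient f x₀ with hgdef
  have hg0 : 0 < ‖g‖ := norm_pos_iff.2 (hg x₀ hxU)
  have hs : HasStrictFDerivAt f (fderiv ℝ f x₀) x₀ :=
    (hf.contDiffAt (hU.mem_nhds hxU)).hasStrictFDerivAt (by simp)
  refine ⟨‖g‖⁻¹ • g, fun y => ‖g‖⁻¹ * f y, ?_, fun ε hε => ?_⟩
  · rw [norm_smul, norm_inv, norm_norm, inv_mul_cancel₀ hg0.ne']
  have h1 := hs.isLittleO.def (mul_pos hε hg0)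
  have h2 : ∀ᶠ y in 𝓝 x₀, y ∈ U := hU.mem_nhds hxU
  obtain ⟨r₁, hr₁, hb₁⟩ := Metric.eventually_nhds_iff_ball.1 h1
  obtain ⟨r₂, hr₂, hb₂⟩ := Metric.eventually_nhds_iff_ball.1 h2
  refine ⟨min r₁ r₂, lt_min hr₁ hr₂, fun y hy => ?_⟩
  have hyU := hb₂ y (Metric.ball_subset_ball (min_le_right _ _) hy)
  refine ⟨?_, ?_, fun z hz => ?_⟩
  · have := Set.ext_iff.1 hin y
    simp only [mem_inter_iff, hyU, and_true, mem_ofPred_eq, true_and] at this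
    rw [this, mul_neg_iff]
    have := inv_pos.2 hg0
    constructor
    · exact fun h => Or.inl ⟨this, h⟩
    · rintro (h | h)
      · exact h.2
      · linarith [h.1]
  · have := Set.ext_iff.1 hbd y
    simp only [mem_inter_iff, hyU, and_true, mem_ofPred_eq, true_and] at this
    rw [this, mul_eq_zero, or_iff_right (inv_pos.2 hg0).ne']
  · have h3 := hb₁ (y, z) (by
      rw [Metric.mem_ball, Prod.dist_eq]
      exact max_lt (Metric.ball_subset_ball (min_le_left _ _) hy)
        (Metric.ball_subset_ball (min_le_left _ _) hz))
    have h4 : fderiv ℝ f x₀ (y - z) = inner ℝ g (y - z) := by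
      rw [hgdef, gradient, InnerProductSpace.toDual_symm_apply]
    rw [h4, Real.norm_eq_abs] at h3
    rw [inner_smul_left, ← mul_sub, conj_trivial, ← mul_sub, abs_mul, abs_inv, abs_norm,
      inv_mul_le_iff₀ hg0]
    linarith

theorem exists_projection {m : ℕ} {ν : Eu (m + 1)} (hν : ‖ν‖ = 1) :
    ∃ π : Eu (m + 1) →L[ℝ] Eu m, (∀ v, ‖π v‖ ^ 2 + inner ℝ ν v ^ 2 = ‖v‖ ^ 2) ∧ π ν = 0 ∧
      ∀ a, ∃ w, π w = a ∧ inner ℝ ν w = 0 := by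
  have : Fact (Module.finrank ℝ (Eu (m + 1)) = m + 1) := ⟨by simp⟩
  have hν0 : ν ≠ 0 := fun h => by simp [h] at hν
  set b := OrthonormalBasis.fromOrthogonalSpanSingleton (𝕜 := ℝ) m hν0
  set S := (Submodule.span ℝ {ν})ᗮ with hS
  have hmem : ∀ w : S, inner ℝ ν (w : Eu (m + 1)) = 0 := fun w =>
    Submodule.mem_orthogonal_singleton_iff_inner_right.1 w.2
  have hP : ∀ v, ‖S.orthogonalProjectionOnto v‖ ^ 2 + inner ℝ ν v ^ 2 = ‖v‖ ^ 2 := fun v => by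
    rw [Submodule.norm_sq_eq_add_norm_sq_starProjection v (Submodule.span ℝ {ν}),
      Submodule.starProjection_unit_singleton ℝ hν, norm_smul, hν, mul_one, Real.norm_eq_abs,
      sq_abs, add_comm]
    rfl
  refine ⟨(b.repr.toContinuousLinearEquiv : S →L[ℝ] Eu m) ∘L S.orthogonalProjectionOnto,
    fun v => ?_, ?_, fun a => ⟨b.repr.symm a, ?_, hmem _⟩⟩
  · simpa using hP v
  · have h1 := hP ν
    rw [real_inner_self_eq_norm_sq, hν] at h1
    have : S.orthogonalProjectionOnto ν = 0 := by
      rw [← norm_eq_zero]; nlinarith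
    simp [this]
  · simp

variable {m : ℕ} {ν : Eu (m + 1)} {π : Eu (m + 1) →L[ℝ] Eu m}

theorem norm_projection_le (hπ : ∀ v, ‖π v‖ ^ 2 + inner ℝ ν v ^ 2 = ‖v‖ ^ 2) (v : Eu (m + 1)) :
    ‖π v‖ ≤ ‖v‖ :=
  abs_le_of_sq_le_sq' (by nlinarith [hπ v, sq_nonneg (inner ℝ ν v)]) (norm_nonneg _) |>.2

theorem norm_le_projection_add (hπ : ∀ v, ‖π v‖ ^ 2 + inner ℝ ν v ^ 2 = ‖v‖ ^ 2)
    (v : Eu (m + 1)) : ‖v‖ ≤ ‖π v‖ + |inner ℝ ν v| := by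
  refine (abs_le_of_sq_le_sq' ?_ (by positivity)).2
  nlinarith [hπ v, sq_abs (inner ℝ ν v), mul_nonneg (norm_nonneg (π v)) (abs_nonneg (inner ℝ ν v))]

/-- The projection of the surface measure of an almost flat set is bounded above. -/
theorem map_hausdorffMeasure_le {N : Set (Eu (m + 1))} {L : NNReal}
    (hL : ∀ y ∈ N, ∀ z ∈ N, ‖y - z‖ ≤ L * ‖π (y - z)‖) :
    (μH[(m : ℝ)].restrict N).map π ≤ (L : ENNReal) ^ (m : ℝ) • (μH[(m : ℝ)] : Measure (Eu m)) := by
  refine Measure.le_iff.2 fun A hA => ?_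
  have hinj : InjOn π N := fun y hy z hz h => by
    have := hL y hy z hz
    rw [map_sub, h, sub_self, norm_zero, mul_zero] at this
    exact sub_eq_zero.1 (norm_le_zero_iff.1 this)
  have hleft := hinj.leftInvOn_invFunOn
  rw [Measure.map_apply π.measurable hA, Measure.restrict_apply (π.measurable hA),
    Measure.smul_apply, smul_eq_mul]
  have hlip : LipschitzOnWith L (Function.invFunOn π N) (π '' (π ⁻¹' A ∩ N)) := by
    refine LipschitzOnWith.of_dist_le_mul ?_
    rintro _ ⟨y, hy, rfl⟩ _ ⟨z, hz, rfl⟩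
    rw [hleft hy.2, hleft hz.2, dist_eq_norm, dist_eq_norm, ← map_sub]
    exact hL y hy.2 z hz.2
  have h1 := hlip.hausdorffMeasure_image_le (d := (m : ℝ)) (Nat.cast_nonneg m)
  rw [(hleft.mono inter_subset_right).image_image] at h1
  refine h1.trans ?_
  gcongr
  rintro _ ⟨y, hy, rfl⟩
  exact hy.1

/-- The projection of a surface measure dominates Lebesgue measure on the shadow of the surface. -/
theorem restrict_hausdorffMeasure_le_map (hπ : ∀ v, ‖π v‖ ^ 2 + inner ℝ ν v ^ 2 = ‖v‖ ^ 2)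
    {N : Set (Eu (m + 1))} {B : Set (Eu m)} (hB : B ⊆ π '' N) :
    (μH[(m : ℝ)] : Measure (Eu m)).restrict B ≤ (μH[(m : ℝ)].restrict N).map π := by
  refine Measure.le_iff.2 fun A hA => ?_
  rw [Measure.map_apply π.measurable hA, Measure.restrict_apply (π.measurable hA),
    Measure.restrict_apply hA]
  have hlip : LipschitzWith 1 π := LipschitzWith.of_dist_le_mul fun y z => by
    rw [dist_eq_norm, dist_eq_norm, ← map_sub, NNReal.coe_one, one_mul]
    exact norm_projection_le hπ _
  have h1 := hlip.hausdorffMeasure_image_le (d := (m : ℝ)) (Nat.cast_nonneg m) (π ⁻¹' A ∩ N)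
  rw [ENNReal.coe_one, ENNReal.one_rpow, one_mul] at h1
  refine le_trans (measure_mono ?_) h1
  rintro a ⟨haA, haB⟩
  obtain ⟨z, hz, rfl⟩ := hB haB
  exact ⟨z, ⟨haA, hz⟩, rfl⟩

end Flatness

section HalfSpaceKernel

/-- The half-space Poisson kernel, without its normalizing constant. -/
def halfSpaceKernel {m : ℕ} (t : ℝ) (a : Eu m) : ℝ := t * (‖a‖ ^ 2 + t ^ 2) ^ (-((m : ℝ) + 1) / 2)

/-- The integral of the unnormalized half-space kernel. -/
def halfSpaceMass (m : ℕ) : ℝ := ∫ a : Eu m, halfSpaceKernel 1 a ∂μH[(m : ℝ)]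

variable {m : ℕ}

instance isAddHaarMeasure_hausdorffMeasure_eu :
    (μH[(m : ℝ)] : Measure (Eu m)).IsAddHaarMeasure := by
  have := isAddHaarMeasure_hausdorffMeasure (E := Eu m)
  rwa [finrank_euclideanSpace_fin] at this

theorem halfSpaceKernel_pos {t : ℝ} (ht : 0 < t) (a : Eu m) : 0 < halfSpaceKernel t a :=
  mul_pos ht (Real.rpow_pos_of_pos (by positivity) _)

theorem continuous_halfSpaceKernel {t : ℝ} (ht : 0 < t) : Continuous (halfSpaceKernel (m := m) t) :=
  continuous_const.mul (Continuous.rpow_const (by fun_prop) fun a => Or.inl (by positivity))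

theorem integrable_halfSpaceKernel_one :
    Integrable (halfSpaceKernel (m := m) 1) μH[(m : ℝ)] := by
  have := integrable_rpow_neg_one_add_norm_sq (E := Eu m) (μ := μH[(m : ℝ)]) (r := m + 1) (by simp)
  refine this.congr (Filter.Eventually.of_forall fun a => ?_)
  simp only [halfSpaceKernel]
  rw [one_mul, one_pow, add_comm]

theorem halfSpaceMass_pos : 0 < halfSpaceMass m := by
  refine (integral_pos_iff_support_of_nonneg (fun a => (halfSpaceKernel_pos one_pos a).le)
    integrable_halfSpaceKernel_one).2 ?_
  rw [show Function.support (halfSpaceKernel (m := m) 1) = univ from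
    eq_univ_of_forall fun x => (halfSpaceKernel_pos one_pos x).ne']
  exact Measure.measure_univ_pos.2 (NeZero.ne _)

theorem halfSpaceKernel_eq {t : ℝ} (ht : 0 < t) (a : Eu m) :
    halfSpaceKernel t a = (t ^ m)⁻¹ * halfSpaceKernel 1 (t⁻¹ • a) := by
  have h1 : ‖a‖ ^ 2 + t ^ 2 = t ^ 2 * (‖t⁻¹ • a‖ ^ 2 + 1 ^ 2) := by
    rw [norm_smul, norm_inv, Real.norm_of_nonneg ht.le]; field_simp
  have h2 : (t ^ 2) ^ (-((m : ℝ) + 1) / 2) = (t ^ (m + 1))⁻¹ := by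
    rw [← Real.rpow_natCast_mul ht.le, ← Real.rpow_natCast t (m + 1), ← Real.rpow_neg ht.le]
    congr 1; push_cast; ring
  rw [halfSpaceKernel, h1, Real.mul_rpow (by positivity) (by positivity), h2, halfSpaceKernel]
  field_simp
  ring

theorem integrable_halfSpaceKernel {t : ℝ} (ht : 0 < t) (p : Eu m) :
    Integrable (fun a => halfSpaceKernel t (a - p)) μH[(m : ℝ)] := by
  simp_rw [halfSpaceKernel_eq ht]
  exact ((integrable_halfSpaceKernel_one.comp_smul
    (inv_ne_zero ht.ne')).comp_sub_right p).const_mul _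

theorem setIntegral_halfSpaceKernel {t : ℝ} (ht : 0 < t) (p : Eu m) (ρ : ℝ) :
    ∫ a in Metric.ball p ρ, halfSpaceKernel t (a - p) ∂μH[(m : ℝ)]
      = ∫ a in Metric.ball (0 : Eu m) (ρ / t), halfSpaceKernel 1 a ∂μH[(m : ℝ)] := by
  rw [← integral_indicator Metric.isOpen_ball.measurableSet,
    ← integral_indicator Metric.isOpen_ball.measurableSet,
    ← integral_sub_right_eq_self (indicator (Metric.ball (0 : Eu m) (ρ / t)) _) (t⁻¹ • p)]
  have h1 := Measure.integral_comp_smul (μH[(m : ℝ)] : Measure (Eu m)) (fun a =>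
    (Metric.ball (0 : Eu m) (ρ / t)).indicator (halfSpaceKernel 1) (a - t⁻¹ • p)) t⁻¹
  rw [finrank_euclideanSpace_fin, inv_pow, inv_inv, abs_of_pos (by positivity), smul_eq_mul] at h1
  have ht' : t ^ m ≠ 0 := by positivity
  refine mul_left_cancel₀ ht' ?_
  rw [← h1, ← integral_const_mul]
  congr 1; ext a
  rw [← smul_sub]
  by_cases ha : a ∈ Metric.ball p ρ
  · rw [indicator_of_mem ha, indicator_of_mem, halfSpaceKernel_eq ht]
    · field_simp
    · rw [mem_ball_zero_iff, norm_smul, norm_inv, Real.norm_of_nonneg ht.le,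
        inv_mul_lt_iff₀ ht, mul_div_cancel₀ _ ht.ne', ← dist_eq_norm]
      exact ha
  · rw [indicator_of_notMem ha, indicator_of_notMem, mul_zero]
    rw [mem_ball_zero_iff, norm_smul, norm_inv, Real.norm_of_nonneg ht.le,
        inv_mul_lt_iff₀ ht, mul_div_cancel₀ _ ht.ne', ← dist_eq_norm]
    exact ha

theorem integral_halfSpaceKernel {t : ℝ} (ht : 0 < t) (p : Eu m) :
    ∫ a, halfSpaceKernel t (a - p) ∂μH[(m : ℝ)] = halfSpaceMass m := by
  have h1 := (aecover_ball (μ := (μH[(m : ℝ)] : Measure (Eu m))) (x := p)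
    (Filter.tendsto_id)).integral_tendsto_of_countably_generated (integrable_halfSpaceKernel ht p)
  have h2 := (aecover_ball (μ := (μH[(m : ℝ)] : Measure (Eu m))) (x := 0)
    (Filter.tendsto_id.atTop_div_const ht)).integral_tendsto_of_countably_generated
    integrable_halfSpaceKernel_one
  simp only [id, setIntegral_halfSpaceKernel ht p] at h1
  exact tendsto_nhds_unique h1 h2

end HalfSpaceKernel

section Reflection

theorem abs_rpow_sub_rpow_le {k : ℝ} (hk : 0 ≤ k) {c a b : ℝ} (hc : 0 < c) (ha : c ≤ a)
    (hb : c ≤ b) : |a ^ (-k) - b ^ (-k)| ≤ k * c ^ (-k - 1) * |a - b| := by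
  have h := (convex_Ici c).norm_image_sub_le_of_norm_hasDerivWithin_le
    (f := fun s : ℝ => s ^ (-k)) (f' := fun s => -k * s ^ (-k - 1)) (C := k * c ^ (-k - 1))
    (fun s hs => (Real.hasDerivAt_rpow_const (Or.inl (hc.trans_le hs).ne')).hasDerivWithinAt)
    (fun s hs => ?_) hb ha
  · simpa using h
  · have hs0 : 0 < s := hc.trans_le hs
    rw [norm_mul, norm_neg, Real.norm_of_nonneg hk, Real.norm_of_nonneg (by positivity)]
    exact mul_le_mul_of_nonneg_left (Real.rpow_le_rpow_of_nonpos hc hs (by linarith)) hk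

theorem abs_radial_sub_radial_le {n : ℕ} {c a b : ℝ} (hc : 0 < c) (ha : c ≤ a) (hb : c ≤ b) :
    |radial n a - radial n b| ≤ c ^ (-(n : ℝ) / 2) * |a - b| := by
  refine (convex_Ici c).norm_image_sub_le_of_norm_hasDerivWithin_le
    (fun s hs => (hasDerivAt_radial (hc.trans_le hs)).hasDerivWithinAt)
    (fun s hs => ?_) hb ha
  have hs0 : 0 < s := hc.trans_le hs
  rw [Real.norm_of_nonneg (by positivity)]
  refine Real.rpow_le_rpow_of_nonpos hc hs ?_
  have : (0 : ℝ) ≤ n := Nat.cast_nonneg n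
  linarith

/-- The constant in the comparison of Newtonian kernels with half-space kernels. -/
def reflectionConst (n : ℕ) : ℝ := 24 * n * 2 ^ ((n : ℝ) / 2)

variable {m : ℕ} {ν : Eu (m + 1)} {π : Eu (m + 1) →L[ℝ] Eu m}

theorem norm_sq_add_smul (hπ : ∀ v, ‖π v‖ ^ 2 + inner ℝ ν v ^ 2 = ‖v‖ ^ 2) (hν : ‖ν‖ = 1)
    (hπν : π ν = 0) (v : Eu (m + 1)) (t : ℝ) :
    ‖v + t • ν‖ ^ 2 = ‖π v‖ ^ 2 + (inner ℝ ν v + t) ^ 2 := by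
  rw [← hπ (v + t • ν), map_add, map_smul, hπν, smul_zero, add_zero, inner_add_right,
    inner_smul_right, real_inner_self_eq_norm_sq, hν]
  ring

set_option maxHeartbeats 1000000 in
theorem newton_reflection_estimates (hπ : ∀ v, ‖π v‖ ^ 2 + inner ℝ ν v ^ 2 = ‖v‖ ^ 2)
    (hν : ‖ν‖ = 1) (hπν : π ν = 0) {ε t : ℝ} (hε : 0 < ε) (hε8 : ε ≤ 1 / 8) (ht : 0 < t)
    {v : Eu (m + 1)} (hv : |inner ℝ ν v| ≤ ε * ‖v‖) (hv2 : ‖v‖ ≤ 2) :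
    (∀ i, |newtonGrad 0 i (-v - t • ν) - newtonGrad 0 i (-v + t • ν)
        + 2 * ν i * halfSpaceKernel t (π v)|
      ≤ reflectionConst (m + 1) * ε * halfSpaceKernel t (π v)) ∧
    |newton 0 (-v - t • ν) - newton 0 (-v + t • ν)|
      ≤ reflectionConst (m + 1) * ε * halfSpaceKernel t (π v) := by
  set s := inner ℝ ν v with hs
  set q := ‖π v‖ with hq
  have hq0 : 0 ≤ q := norm_nonneg _
  have hA : ‖-v - t • ν‖ ^ 2 = q ^ 2 + (s + t) ^ 2 := by
    rw [← norm_sq_add_smul hπ hν hπν, ← norm_neg]; congr 2; abel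
  have hB : ‖-v + t • ν‖ ^ 2 = q ^ 2 + (s - t) ^ 2 := by
    rw [sub_eq_add_neg, ← norm_sq_add_smul hπ hν hπν, ← norm_neg]; congr 2; simp [add_comm]
  set A := q ^ 2 + (s + t) ^ 2 with hAdef
  set B := q ^ 2 + (s - t) ^ 2 with hBdef
  set Q := q ^ 2 + t ^ 2 with hQdef
  have hQ : 0 < Q := by positivity
  have hvq : ‖v‖ ≤ q + |s| := norm_le_projection_add hπ v
  have hqv : q ≤ ‖v‖ := norm_projection_le hπ v
  have hs0 : 0 ≤ |s| := abs_nonneg s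
  have hsq : |s| ≤ 2 * ε * q := by nlinarith
  have hv2q : ‖v‖ ≤ 2 * q := by nlinarith
  have hsε : s ^ 2 ≤ 2 * ε * q ^ 2 := by
    rw [← sq_abs]
    have : |s| ^ 2 ≤ (2 * ε * q) ^ 2 := pow_le_pow_left₀ hs0 hsq 2
    nlinarith [mul_nonneg hε.le (sq_nonneg q)]
  have hst : |2 * s * t| ≤ 2 * ε * Q := by
    rw [abs_mul, abs_mul, abs_two, abs_of_pos ht]
    have : |s| * t ≤ 2 * ε * q * t := mul_le_mul_of_nonneg_right hsq ht.le
    nlinarith [mul_nonneg hε.le (sq_nonneg (q - t))]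
  have hst' := abs_le.1 hst
  have hsε' : 2 * ε * q ^ 2 ≤ 2 * ε * Q := by
    have : q ^ 2 ≤ Q := by rw [hQdef]; linarith [sq_nonneg t]
    gcongr
  have hAQ : |A - Q| ≤ 4 * ε * Q := by
    rw [show A - Q = s ^ 2 + 2 * s * t by rw [hAdef, hQdef]; ring, abs_le]
    constructor <;> linarith [sq_nonneg s]
  have hBQ : |B - Q| ≤ 4 * ε * Q := by
    rw [show B - Q = s ^ 2 - 2 * s * t by rw [hBdef, hQdef]; ring, abs_le]
    constructor <;> linarith [sq_nonneg s]
  have h4 : 4 * ε * Q ≤ Q / 2 := by linarith [mul_le_mul_of_nonneg_right hε8 hQ.le]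
  have hA2 : Q / 2 ≤ A := by linarith [(abs_le.1 hAQ).1]
  have hB2 : Q / 2 ≤ B := by linarith [(abs_le.1 hBQ).1]
  have hAB : |A - B| ≤ 8 * ε * t * q := by
    rw [show A - B = 4 * t * s by rw [hAdef, hBdef]; ring, abs_mul, abs_of_pos (by positivity)]
    linarith [mul_le_mul_of_nonneg_left hsq (by positivity : (0 : ℝ) ≤ 4 * t)]
  set n : ℝ := ((m + 1 : ℕ) : ℝ) with hn
  have hn1 : 1 ≤ n := by rw [hn]; push_cast; linarith [(Nat.cast_nonneg m : (0 : ℝ) ≤ m)]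
  have hQh : 0 < Q / 2 := by positivity
  set X := (Q / 2) ^ (-(n / 2)) with hX
  have hX0 : 0 < X := Real.rpow_pos_of_pos hQh _
  have hX1 : (Q / 2) ^ (-(n / 2) - 1) * (Q / 2) = X := by
    rw [Real.rpow_sub_one hQh.ne', div_mul_cancel₀ _ hQh.ne']
  set Y := (Q / 2) ^ (-(n / 2) - 1) with hY
  have hY0 : 0 < Y := Real.rpow_pos_of_pos hQh _
  have hψ : halfSpaceKernel t (π v) = t * Q ^ (-(n / 2)) := by
    rw [halfSpaceKernel, ← hq, hn]; push_cast; rw [neg_div]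
  have hXψ : reflectionConst (m + 1) * ε * halfSpaceKernel t (π v) = 24 * n * ε * (t * X) := by
    rw [reflectionConst, ← hn, hψ, hX, Real.div_rpow hQ.le zero_le_two,
      Real.rpow_neg zero_le_two (n / 2)]
    field_simp
  have hp : -n / 2 = -(n / 2) := neg_div _ _
  rw [hXψ]
  constructor
  · intro i
    simp only [newtonGrad]
    rw [add_zero, add_zero, hA, hB, ← hn, hp, hψ]
    have hvi : |v i| ≤ 2 * q := (PiLp.norm_apply_le v i).trans hv2q
    have hνi : |ν i| ≤ 1 := (PiLp.norm_apply_le ν i).trans hν.le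
    have e : (-v - t • ν) i * A ^ (-(n / 2)) - (-v + t • ν) i * B ^ (-(n / 2))
        + 2 * ν i * (t * Q ^ (-(n / 2)))
        = -(v i) * (A ^ (-(n / 2)) - B ^ (-(n / 2)))
          - ν i * (t * ((A ^ (-(n / 2)) - Q ^ (-(n / 2)))
            + (B ^ (-(n / 2)) - Q ^ (-(n / 2))))) := by
      simp; ring
    have h1 := abs_rpow_sub_rpow_le (k := n / 2) (by positivity) hQh hA2 hB2
    have h2 := abs_rpow_sub_rpow_le (k := n / 2) (by positivity) hQh hA2 (by linarith : Q / 2 ≤ Q)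
    have h3 := abs_rpow_sub_rpow_le (k := n / 2) (by positivity) hQh hB2 (by linarith : Q / 2 ≤ Q)
    rw [← hY] at h1 h2 h3
    rw [e]
    refine (abs_sub _ _).trans ?_
    rw [abs_mul, abs_mul, abs_mul, abs_neg, abs_of_pos ht]
    have hnY : 0 ≤ n / 2 * Y := by positivity
    have e1 : |v i| * |A ^ (-(n / 2)) - B ^ (-(n / 2))|
        ≤ 2 * q * (n / 2 * Y * (8 * ε * t * q)) := by
      refine mul_le_mul hvi (h1.trans ?_) (abs_nonneg _) (by positivity)
      gcongr
    have e2 : |A ^ (-(n / 2)) - Q ^ (-(n / 2)) + (B ^ (-(n / 2)) - Q ^ (-(n / 2)))|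
        ≤ n / 2 * Y * (4 * ε * Q) + n / 2 * Y * (4 * ε * Q) := by
      refine (abs_add_le _ _).trans (add_le_add (h2.trans ?_) (h3.trans ?_)) <;> gcongr
    have e3 : |ν i| * (t * |A ^ (-(n / 2)) - Q ^ (-(n / 2)) + (B ^ (-(n / 2)) - Q ^ (-(n / 2)))|)
        ≤ 1 * (t * (n / 2 * Y * (4 * ε * Q) + n / 2 * Y * (4 * ε * Q))) := by
      gcongr
    have e4 : 2 * q * (n / 2 * Y * (8 * ε * t * q)) ≤ 8 * n * ε * t * Y * Q := by
      have : q ^ 2 ≤ Q := by rw [hQdef]; linarith [sq_nonneg t]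
      calc _ = 8 * n * ε * t * Y * q ^ 2 := by ring
        _ ≤ _ := by gcongr
    rw [← hX1]
    linarith
  · simp only [newton]
    rw [add_zero, add_zero, hA, hB, ← sub_div, abs_div, abs_two]
    have h1 := abs_radial_sub_radial_le (n := m + 1) hQh hA2 hB2
    rw [← hn, hp, ← hX] at h1
    have h2 : X * |A - B| ≤ X * (8 * ε * t * 2) := by
      refine mul_le_mul_of_nonneg_left (hAB.trans ?_) hX0.le
      have := hqv.trans hv2
      gcongr
    have h3 : 8 * (ε * (t * X)) ≤ 24 * n * (ε * (t * X)) := by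
      gcongr; linarith
    linarith

end Reflection

section BoundaryGeometry

variable {n m : ℕ}

/-- In the ball of radius `r` about `x₀`, the set `Ω` is the sublevel set of a function that
differs from a linear function with unit gradient `ν` by an `ε`-Lipschitz function. -/
def IsFlatNear (Ω : Set (Eu n)) (x₀ ν : Eu n) (F : Eu n → ℝ) (ε r : ℝ) : Prop :=
  ∀ y ∈ Metric.ball x₀ r, (y ∈ Ω ↔ F y < 0) ∧ (y ∈ frontier Ω ↔ F y = 0) ∧
    ∀ z ∈ Metric.ball x₀ r, |F y - F z - inner ℝ ν (y - z)| ≤ ε * ‖y - z‖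

namespace IsFlatNear

variable {Ω : Set (Eu n)} {x₀ ν : Eu n} {F : Eu n → ℝ} {ε r : ℝ}

theorem mono (h : IsFlatNear Ω x₀ ν F ε r) {r' : ℝ} (hr : r' ≤ r) : IsFlatNear Ω x₀ ν F ε r' :=
  fun y hy =>
    have hy' := h y (Metric.ball_subset_ball hr hy)
    ⟨hy'.1, hy'.2.1, fun z hz => hy'.2.2 z (Metric.ball_subset_ball hr hz)⟩

theorem abs_inner_sub_le (h : IsFlatNear Ω x₀ ν F ε r) {y z : Eu n}
    (hy : y ∈ frontier Ω ∩ Metric.ball x₀ r) (hz : z ∈ frontier Ω ∩ Metric.ball x₀ r) :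
    |inner ℝ ν (y - z)| ≤ ε * ‖y - z‖ := by
  have h1 := (h y hy.2).2.2 z hz.2
  rwa [(h y hy.2).2.1.1 hy.1, (h z hz.2).2.1.1 hz.1, sub_zero, zero_sub, abs_neg] at h1

theorem abs_sub_le (h : IsFlatNear Ω x₀ ν F ε r) (hν : ‖ν‖ = 1) {y z : Eu n}
    (hy : y ∈ Metric.ball x₀ r) (hz : z ∈ Metric.ball x₀ r) :
    |F y - F z| ≤ (1 + ε) * ‖y - z‖ := by
  have h1 := abs_le.1 ((h y hy).2.2 z hz)
  have h2 := abs_le.1 (abs_real_inner_le_norm ν (y - z))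
  rw [hν, one_mul] at h2
  rw [abs_le]
  constructor <;> linarith [h1.1, h1.2, h2.1, h2.2]

theorem continuousOn (h : IsFlatNear Ω x₀ ν F ε r) (hν : ‖ν‖ = 1) (hε : 0 < ε) :
    ContinuousOn F (Metric.ball x₀ r) := by
  refine (LipschitzOnWith.of_dist_le_mul (K := NNReal.mk (1 + ε) (by positivity))
    fun y hy z hz => ?_).continuousOn
  rw [Real.dist_eq, dist_eq_norm]
  exact h.abs_sub_le hν hy hz

/-- Along the normal direction the defining function has slope close to one. -/
theorem abs_add_smul_sub_le (h : IsFlatNear Ω x₀ ν F ε r) (hν : ‖ν‖ = 1) {y : Eu n} {t : ℝ}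
    (hy : y ∈ Metric.ball x₀ r) (hyt : y + t • ν ∈ Metric.ball x₀ r) :
    |F (y + t • ν) - F y - t| ≤ ε * |t| := by
  have h1 := (h _ hyt).2.2 y hy
  rwa [add_sub_cancel_left, inner_smul_right, real_inner_self_eq_norm_sq, hν, one_pow, mul_one,
    norm_smul, hν, mul_one, Real.norm_eq_abs] at h1

theorem exists_mem_frontier (h : IsFlatNear Ω x₀ ν F ε r) (hν : ‖ν‖ = 1) (hε : 0 < ε) {y : Eu n}
    {a b : ℝ} (hab : a ≤ b) (hy : ∀ t ∈ Icc a b, y + t • ν ∈ Metric.ball x₀ r)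
    (ha : F (y + a • ν) ≤ 0) (hb : 0 ≤ F (y + b • ν)) :
    ∃ t ∈ Icc a b, y + t • ν ∈ frontier Ω ∩ Metric.ball x₀ r := by
  have hc : ContinuousOn (fun t : ℝ => F (y + t • ν)) (Icc a b) :=
    (h.continuousOn hν hε).comp (by fun_prop) hy
  obtain ⟨t, ht, ht0⟩ := intermediate_value_Icc hab hc ⟨ha, hb⟩
  exact ⟨t, ht, (h _ (hy t ht)).2.1.2 ht0, hy t ht⟩

theorem mem_ball_add_smul (hν : ‖ν‖ = 1) {y : Eu n} {t : ℝ} (h : ‖y - x₀‖ + |t| < r) :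
    y + t • ν ∈ Metric.ball x₀ r := by
  rw [mem_ball_iff_norm, add_sub_right_comm]
  refine (norm_add_le _ _).trans_lt ?_
  rwa [norm_smul, hν, mul_one, Real.norm_eq_abs]

theorem exists_reflection (h : IsFlatNear Ω x₀ ν F ε r) (hν : ‖ν‖ = 1) (hε : 0 < ε)
    (hε8 : ε ≤ 1 / 8) (hΩ : IsOpen Ω) (hx₀ : x₀ ∈ frontier Ω) {y : Eu n} (hy : y ∈ Ω)
    (hyr : 7 * ‖y - x₀‖ < r) :
    ∃ t, 0 < t ∧ t ≤ 3 * ‖y - x₀‖ ∧ y + t • ν ∈ frontier Ω ∩ Metric.ball x₀ r ∧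
      y + (2 * t) • ν ∉ closure Ω := by
  have hne : y ≠ x₀ := fun h => by
    rw [hΩ.frontier_eq] at hx₀; exact hx₀.2 (h ▸ hy)
  set d := ‖y - x₀‖ with hd
  have hd0 : 0 < d := norm_pos_iff.2 (sub_ne_zero.2 hne)
  have hyb : y ∈ Metric.ball x₀ r := by rw [mem_ball_iff_norm]; linarith
  have hxb : x₀ ∈ Metric.ball x₀ r := Metric.mem_ball_self (by linarith)
  have hFx : F x₀ = 0 := (h x₀ hxb).2.1.1 hx₀
  have hFy : F y < 0 := (h y hyb).1.1 hy
  have hFy2 := (abs_le.1 (h.abs_sub_le hν hyb hxb)).1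
  rw [hFx, sub_zero, ← hd] at hFy2
  have hball : ∀ t, |t| ≤ 6 * d → y + t • ν ∈ Metric.ball x₀ r := fun t ht =>
    mem_ball_add_smul hν (by linarith)
  have hεd : ε * d ≤ 1 / 8 * d := mul_le_mul_of_nonneg_right hε8 hd0.le
  have h3 := (abs_le.1 (h.abs_add_smul_sub_le hν hyb (hball (3 * d) (by
    rw [abs_of_pos (by positivity)]; linarith)))).1
  rw [abs_of_pos (by positivity : 0 < 3 * d)] at h3
  obtain ⟨t, ht, htf⟩ := h.exists_mem_frontier hν hε (y := y) (a := 0) (b := 3 * d)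
    (by positivity) (fun t ht => hball t (by rw [abs_of_nonneg ht.1]; linarith [ht.2]))
    (by simpa using hFy.le) (by nlinarith)
  have ht0 : 0 < t := by
    refine lt_of_le_of_ne ht.1 fun h0 => ?_
    rw [← h0, zero_smul, add_zero] at htf
    exact hFy.ne ((h y hyb).2.1.1 htf.1)
  refine ⟨t, ht0, ht.2, htf, fun hcl => ?_⟩
  have hb2 := hball (2 * t) (by rw [abs_of_pos (by positivity)]; linarith [ht.2])
  have e : y + (2 * t) • ν = y + t • ν + t • ν := by rw [two_mul, add_smul, add_assoc]
  rw [e] at hcl hb2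
  have h4 := (abs_le.1 (h.abs_add_smul_sub_le hν htf.2 hb2)).1
  rw [(h _ htf.2).2.1.1 htf.1, abs_of_pos ht0] at h4
  have hpos : 0 < F (y + t • ν + t • ν) := by nlinarith
  rw [closure_eq_self_union_frontier] at hcl
  rcases hcl with hcl | hcl
  · exact hpos.not_gt ((h _ hb2).1.1 hcl)
  · exact hpos.ne' ((h _ hb2).2.1.1 hcl)

variable {Ω : Set (Eu (m + 1))} {x₀ ν : Eu (m + 1)} {F : Eu (m + 1) → ℝ}
  {π : Eu (m + 1) →L[ℝ] Eu m}

theorem ball_subset_image (h : IsFlatNear Ω x₀ ν F ε r) (hν : ‖ν‖ = 1) (hε : 0 < ε)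
    (hε8 : ε ≤ 1 / 8) (hr : 0 < r) (hx₀ : x₀ ∈ frontier Ω)
    (hπ : ∀ v, ‖π v‖ ^ 2 + inner ℝ ν v ^ 2 = ‖v‖ ^ 2) (hπν : π ν = 0)
    (hsurj : ∀ a, ∃ w, π w = a ∧ inner ℝ ν w = 0) :
    Metric.ball (π x₀) (r / 3) ⊆ π '' (frontier Ω ∩ Metric.ball x₀ r) := by
  intro a ha
  obtain ⟨w, hw, hνw⟩ := hsurj (a - π x₀)
  have hwn : ‖w‖ < r / 3 := by
    refine (norm_le_projection_add hπ w).trans_lt ?_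
    rw [hw, hνw, abs_zero, add_zero]
    exact mem_ball_iff_norm.1 ha
  have hball : ∀ t, |t| ≤ r / 3 → x₀ + w + t • ν ∈ Metric.ball x₀ r := fun t ht =>
    mem_ball_add_smul hν (by rw [add_sub_cancel_left]; linarith)
  have hxb : x₀ ∈ Metric.ball x₀ r := Metric.mem_ball_self hr
  have hr3 : |r / 3| = r / 3 := abs_of_pos (by positivity)
  have hest : ∀ t, |t| = r / 3 → |F (x₀ + w + t • ν) - t| ≤ 1 / 8 * (r / 3 + r / 3) :=
      fun t ht => by
    have h1 := (h _ (hball t ht.le)).2.2 x₀ hxb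
    rw [(h x₀ hxb).2.1.1 hx₀, sub_zero, add_assoc, add_sub_cancel_left, inner_add_right, hνw,
      inner_smul_right, real_inner_self_eq_norm_sq, hν, one_pow, mul_one, zero_add,
      ← add_assoc] at h1
    refine h1.trans (mul_le_mul hε8 ((norm_add_le _ _).trans ?_) (norm_nonneg _) (by norm_num))
    rw [norm_smul, hν, mul_one, Real.norm_eq_abs, ht]
    linarith
  obtain ⟨t, -, ht⟩ := h.exists_mem_frontier hν hε (y := x₀ + w) (a := -(r / 3)) (b := r / 3)
    (by linarith) (fun t ht => hball t (abs_le.2 ht))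
    (by linarith [(abs_le.1 (hest (-(r / 3)) (by rw [abs_neg, hr3]))).2])
    (by linarith [(abs_le.1 (hest (r / 3) hr3)).1])
  exact ⟨_, ht, by simp [hπν, hw]⟩

theorem map_hausdorffMeasure_le (h : IsFlatNear Ω x₀ ν F ε r)
    (hε8 : ε ≤ 1 / 8) (hπ : ∀ v, ‖π v‖ ^ 2 + inner ℝ ν v ^ 2 = ‖v‖ ^ 2) :
    (μH[(m : ℝ)].restrict (frontier Ω ∩ Metric.ball x₀ r)).map π
      ≤ ENNReal.ofReal ((1 - ε)⁻¹ ^ m) • (μH[(m : ℝ)] : Measure (Eu m)) := by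
  have hε1 : 0 < 1 - ε := by linarith
  have h1 := _root_.map_hausdorffMeasure_le (π := π) (N := frontier Ω ∩ Metric.ball x₀ r)
    (L := NNReal.mk (1 - ε)⁻¹ (by positivity)) fun y hy z hz => by
      have h2 := h.abs_inner_sub_le hy hz
      have h3 := norm_le_projection_add hπ (y - z)
      rw [NNReal.coe_mk, ← div_eq_inv_mul, le_div_iff₀ hε1]
      linarith
  refine h1.trans (le_of_eq ?_)
  rw [ENNReal.rpow_natCast, ENNReal.ofReal_pow (by positivity),
    ENNReal.ofReal_eq_coe_nnreal (by positivity)]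

end IsFlatNear

end BoundaryGeometry

section SurfaceMass

variable {m : ℕ}

namespace IsFlatNear

variable {Ω : Set (Eu (m + 1))} {x₀ ν : Eu (m + 1)} {F : Eu (m + 1) → ℝ}
  {π : Eu (m + 1) →L[ℝ] Eu m} {ε r : ℝ}

theorem integrableOn_halfSpaceKernel (h : IsFlatNear Ω x₀ ν F ε r) (hε8 : ε ≤ 1 / 8)
    (hπ : ∀ v, ‖π v‖ ^ 2 + inner ℝ ν v ^ 2 = ‖v‖ ^ 2) {t : ℝ} (ht : 0 < t) (x : Eu (m + 1)) :
    IntegrableOn (fun z => halfSpaceKernel t (π (z - x))) (frontier Ω ∩ Metric.ball x₀ r)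
      μH[(m : ℝ)] ∧
    ∫ z in frontier Ω ∩ Metric.ball x₀ r, halfSpaceKernel t (π (z - x)) ∂μH[(m : ℝ)]
      ≤ (1 - ε)⁻¹ ^ m * halfSpaceMass m := by
  have hε1 : 0 < 1 - ε := by linarith
  have hle := h.map_hausdorffMeasure_le hε8 hπ
  have hc : Continuous fun a => halfSpaceKernel t (a - π x) :=
    (continuous_halfSpaceKernel ht).comp (by fun_prop)
  have hInt := (integrable_halfSpaceKernel ht (π x)).smul_measure
    (c := ENNReal.ofReal ((1 - ε)⁻¹ ^ m)) (by simp)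
  have h1 := hInt.mono_measure hle
  simp_rw [map_sub]
  refine ⟨(integrable_map_measure hc.aestronglyMeasurable π.measurable.aemeasurable).1 h1, ?_⟩
  rw [← integral_map (φ := π) π.measurable.aemeasurable hc.aestronglyMeasurable]
  refine (integral_mono_measure hle (Filter.Eventually.of_forall fun a =>
    (halfSpaceKernel_pos ht _).le) hInt).trans_eq ?_
  rw [integral_smul_measure, integral_halfSpaceKernel ht, ENNReal.toReal_ofReal (by positivity),
    smul_eq_mul]

theorem le_setIntegral_halfSpaceKernel (h : IsFlatNear Ω x₀ ν F ε r) (hν : ‖ν‖ = 1) (hε : 0 < ε)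
    (hε8 : ε ≤ 1 / 8) (hr : 0 < r) (hx₀ : x₀ ∈ frontier Ω)
    (hπ : ∀ v, ‖π v‖ ^ 2 + inner ℝ ν v ^ 2 = ‖v‖ ^ 2) (hπν : π ν = 0)
    (hsurj : ∀ a, ∃ w, π w = a ∧ inner ℝ ν w = 0) {t : ℝ} (ht : 0 < t) {x : Eu (m + 1)}
    (hx : ‖x - x₀‖ ≤ r / 6) :
    ∫ a in Metric.ball (0 : Eu m) (r / 6 / t), halfSpaceKernel 1 a ∂μH[(m : ℝ)]
      ≤ ∫ z in frontier Ω ∩ Metric.ball x₀ r, halfSpaceKernel t (π (z - x)) ∂μH[(m : ℝ)] := by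
  have hc : Continuous fun a => halfSpaceKernel t (a - π x) :=
    (continuous_halfSpaceKernel ht).comp (by fun_prop)
  have hsub : Metric.ball (π x) (r / 6) ⊆ π '' (frontier Ω ∩ Metric.ball x₀ r) := by
    refine Subset.trans (fun a ha => ?_)
      (h.ball_subset_image hν hε hε8 hr hx₀ hπ hπν hsurj)
    have h1 : dist (π x) (π x₀) ≤ r / 6 := by
      rw [dist_eq_norm, ← map_sub]; exact (norm_projection_le hπ _).trans hx
    rw [Metric.mem_ball] at ha ⊢
    linarith [dist_triangle a (π x) (π x₀)]
  have hInt := (h.integrableOn_halfSpaceKernel hε8 hπ ht x).1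
  simp_rw [map_sub] at hInt ⊢
  rw [← integral_map (φ := π) π.measurable.aemeasurable hc.aestronglyMeasurable,
    ← setIntegral_halfSpaceKernel ht (π x)]
  exact integral_mono_measure (restrict_hausdorffMeasure_le_map hπ hsub)
    (Filter.Eventually.of_forall fun a => (halfSpaceKernel_pos ht _).le)
    ((integrable_map_measure hc.aestronglyMeasurable π.measurable.aemeasurable).2 hInt)

end IsFlatNear

theorem tendsto_setIntegral_halfSpaceKernel :
    Filter.Tendsto (fun R => ∫ a in Metric.ball (0 : Eu m) R, halfSpaceKernel 1 a ∂μH[(m : ℝ)])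
      Filter.atTop (𝓝 (halfSpaceMass m)) :=
  (aecover_ball (μ := (μH[(m : ℝ)] : Measure (Eu m))) (x := 0)
    Filter.tendsto_id).integral_tendsto_of_countably_generated integrable_halfSpaceKernel_one

/-- Points of `Ω` near the boundary have exterior reflections for which the difference of the
Newtonian kernels is, up to a small relative error, a half-space kernel on the boundary. -/
theorem HasCkBoundary.exists_reflection {Ω : Set (Eu (m + 1))} (hΩ : HasCkBoundary ⊤ Ω)
    (hΩo : IsOpen Ω) {x₀ : Eu (m + 1)} (hx₀ : x₀ ∈ frontier Ω) :
    ∃ ν : Eu (m + 1), ‖ν‖ = 1 ∧ ∀ δ > 0, ∃ r > 0, ∃ ρ > 0, ∀ y ∈ Ω, ‖y - x₀‖ < ρ →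
      ∃ y' ∉ closure Ω, ‖y' - x₀‖ ≤ 7 * ‖y - x₀‖ ∧ ∃ ψ : Eu (m + 1) → ℝ,
        IntegrableOn ψ (frontier Ω ∩ Metric.ball x₀ r) μH[(m : ℝ)] ∧
        |(∫ z in frontier Ω ∩ Metric.ball x₀ r, ψ z ∂μH[(m : ℝ)]) - halfSpaceMass m| ≤ δ ∧
        ∀ z ∈ frontier Ω ∩ Metric.ball x₀ r,
          (∀ i, |newtonGrad 0 i (y - z) - newtonGrad 0 i (y' - z) + 2 * ν i * ψ z| ≤ δ * ψ z) ∧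
          |newton 0 (y - z) - newton 0 (y' - z)| ≤ δ * ψ z := by
  obtain ⟨ν, F, hν, hF⟩ := hΩ.exists_local_defining hx₀
  obtain ⟨π, hπ, hπν, hsurj⟩ := exists_projection hν
  refine ⟨ν, hν, fun δ hδ => ?_⟩
  obtain ⟨ε, ⟨hεδ, hε8, hεM⟩, hε⟩ : ∃ ε : ℝ, (reflectionConst (m + 1) * ε ≤ δ ∧ ε ≤ 1 / 8 ∧
      (1 - ε)⁻¹ ^ m * halfSpaceMass m ≤ halfSpaceMass m + δ) ∧ 0 < ε := by
    have h1 : ∀ᶠ ε in 𝓝 (0 : ℝ), reflectionConst (m + 1) * ε < δ :=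
      ContinuousAt.eventually_lt (by fun_prop) continuousAt_const (by simpa using hδ)
    have h2 : ∀ᶠ ε in 𝓝 (0 : ℝ), ε < 1 / 8 := eventually_lt_nhds (by norm_num)
    have h3 : ∀ᶠ ε in 𝓝 (0 : ℝ), (1 - ε)⁻¹ ^ m * halfSpaceMass m < halfSpaceMass m + δ :=
      ContinuousAt.eventually_lt
        (((ContinuousAt.inv₀ (by fun_prop) (by norm_num)).pow m).mul continuousAt_const)
        continuousAt_const (by simpa using hδ)
    have h4 := (h1.and (h2.and h3)).filter_mono (nhdsWithin_le_nhds (s := Ioi 0))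
    obtain ⟨ε, ⟨e1, e2, e3⟩, e4⟩ := (h4.and self_mem_nhdsWithin).exists
    exact ⟨ε, ⟨e1.le, e2.le, e3.le⟩, e4⟩
  obtain ⟨r₀, hr₀, hF⟩ := hF ε hε
  have h : IsFlatNear Ω x₀ ν F ε (min r₀ 1) := (show IsFlatNear Ω x₀ ν F ε r₀ from hF).mono
    (min_le_left _ _)
  have hr : 0 < min r₀ 1 := lt_min hr₀ one_pos
  have hr1 : min r₀ 1 ≤ 1 := min_le_right _ _
  generalize min r₀ 1 = r at h hr hr1
  obtain ⟨R, hR, hR0⟩ := ((Filter.eventually_forall_ge_atTop.2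
    ((tendsto_setIntegral_halfSpaceKernel (m := m)).eventually
      (lt_mem_nhds (sub_lt_self _ hδ)))).and (Filter.eventually_gt_atTop 0)).exists
  refine ⟨r, hr, min (r / 24) (r / 18 / R), by positivity, fun y hy hyρ => ?_⟩
  have hy1 : ‖y - x₀‖ < r / 24 := hyρ.trans_le (min_le_left _ _)
  have hy2 : ‖y - x₀‖ < r / 18 / R := hyρ.trans_le (min_le_right _ _)
  obtain ⟨t, ht, ht3, hx, hy'⟩ := h.exists_reflection hν hε hε8 hΩo hx₀ hy (by linarith)
  have hmass := h.integrableOn_halfSpaceKernel hε8 hπ ht (y + t • ν)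
  refine ⟨_, hy', ?_, fun z => halfSpaceKernel t (π (z - (y + t • ν))), hmass.1, ?_, fun z hz => ?_⟩
  · rw [add_sub_right_comm]
    refine (norm_add_le _ _).trans ?_
    rw [norm_smul, hν, mul_one, Real.norm_of_nonneg (by positivity)]
    linarith
  · rw [abs_le]
    refine ⟨?_, by linarith [hmass.2]⟩
    have h1 := h.le_setIntegral_halfSpaceKernel hν hε hε8 hr hx₀ hπ hπν hsurj ht
      (x := y + t • ν) (by
        rw [add_sub_right_comm]
        refine (norm_add_le _ _).trans ?_
        rw [norm_smul, hν, mul_one, Real.norm_of_nonneg ht.le]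
        linarith)
    have h2 := hR (r / 6 / t) (by
      rw [le_div_iff₀ ht]
      rw [lt_div_iff₀ hR0] at hy2
      nlinarith)
    linarith
  · have h1 := h.abs_inner_sub_le hz hx
    have h2 : ‖z - (y + t • ν)‖ ≤ 2 := by
      rw [← dist_eq_norm]
      linarith [dist_triangle_right z (y + t • ν) x₀, Metric.mem_ball.1 hz.2,
        Metric.mem_ball.1 hx.2]
    have h3 := newton_reflection_estimates hπ hν hπν hε hε8 ht h1 h2
    have e1 : -(z - (y + t • ν)) - t • ν = y - z := by abel
    have e2 : -(z - (y + t • ν)) + t • ν = y + (2 * t) • ν - z := by rw [two_mul, add_smul]; abel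
    rw [e1, e2] at h3
    have h4 := mul_le_mul_of_nonneg_right hεδ (halfSpaceKernel_pos ht (π (z - (y + t • ν)))).le
    exact ⟨fun i => (h3.1 i).trans h4, h3.2.trans h4⟩

end SurfaceMass

section JumpRelation

variable {n : ℕ}

theorem sub_mem_norm_sq_add_pos {T : Set (Eu n)} {y : Eu n} (hy : y ∉ T) :
    ∀ z ∈ T, y - z ∈ {x : Eu n | 0 < ‖x‖ ^ 2 + 0} := fun _ hz =>
  norm_sq_add_pos_of_ne (sub_ne_zero.2 fun h => hy (h ▸ hz))

theorem integrableOn_comp_sub {μ : Measure (Eu n)} {T : Set (Eu n)} (hT : IsCompact T)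
    (hμT : μ T < ⊤) {g : Eu n → ℝ} (hg : ContDiffOn ℝ ∞ g {x | 0 < ‖x‖ ^ 2 + 0})
    (hgm : Measurable g) {y : Eu n} (hy : y ∉ T) : IntegrableOn (fun z => g (y - z)) T μ := by
  have : IsFiniteMeasure (μ.restrict T) := ⟨by simpa using hμT⟩
  have h := integrable_potential (m := μ.restrict T) (f := fun _ => 1) hg.continuousOn hgm hT
    (integrable_const 1)
    ((ae_restrict_mem hT.measurableSet).mono fun z hz h => absurd hz h) (sub_mem_norm_sq_add_pos hy)
  simp only [mul_one] at h
  exact h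

theorem contDiffAt_setIntegral_comp_sub {μ : Measure (Eu n)} {T : Set (Eu n)} (hT : IsCompact T)
    (hμT : μ T < ⊤) {g : Eu n → ℝ} (hg : ContDiffOn ℝ ∞ g {x | 0 < ‖x‖ ^ 2 + 0})
    {y : Eu n} (hy : y ∉ T) :
    ContDiffAt ℝ ∞ (fun y => ∫ z in T, g (y - z) ∂μ) y ∧
      (∀ i, pd i (fun y => ∫ z in T, g (y - z) ∂μ) y = ∫ z in T, pd i g (y - z) ∂μ) ∧
      lap n (fun y => ∫ z in T, g (y - z) ∂μ) y = ∫ z in T, lap n g (y - z) ∂μ := by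
  have : IsFiniteMeasure (μ.restrict T) := ⟨by simpa using hμT⟩
  have hae : ∀ᵐ z ∂μ.restrict T, z ∉ T → (1 : ℝ) = 0 :=
    (ae_restrict_mem hT.measurableSet).mono fun z hz h => absurd hz h
  have h1 := contDiffAt_potential (m := μ.restrict T) (f := fun _ => 1) (isOpen_norm_sq_add_pos 0)
    hg hT (integrable_const 1) hae (sub_mem_norm_sq_add_pos hy)
  have h2 := lap_potential (m := μ.restrict T) (f := fun _ => 1) (isOpen_norm_sq_add_pos 0)
    hg hT (integrable_const 1) hae (sub_mem_norm_sq_add_pos hy)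
  simp only [mul_one] at h1 h2
  exact ⟨h1.1, h1.2, h2⟩

/-- The jump relation: a field that is continuous across the boundary and agrees outside with a
layer potential differs from it inside by the jump of the kernel. -/
theorem tendsto_sub_setIntegral {μ : Measure (Eu n)} {Ω : Set (Eu n)} (hΩo : IsOpen Ω)
    (hΩb : Bornology.IsBounded Ω) (hμ : μ (frontier Ω) < ⊤) {x₀ : Eu n} {g Θ : Eu n → ℝ}
    (hg : ContDiffOn ℝ ∞ g {x | 0 < ‖x‖ ^ 2 + 0}) (hgm : Measurable g) {β c κ : ℝ}
    (hΘ : ContinuousAt Θ x₀)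
    (hext : ∀ y ∉ closure Ω, Θ y = c * ∫ z in frontier Ω, g (y - z) ∂μ)
    (href : ∀ δ > 0, ∃ r > 0, ∃ ρ > 0, ∀ y ∈ Ω, ‖y - x₀‖ < ρ →
      ∃ y' ∉ closure Ω, ‖y' - x₀‖ ≤ 7 * ‖y - x₀‖ ∧ ∃ ψ : Eu n → ℝ,
        IntegrableOn ψ (frontier Ω ∩ Metric.ball x₀ r) μ ∧
        |(∫ z in frontier Ω ∩ Metric.ball x₀ r, ψ z ∂μ) - κ| ≤ δ ∧
        ∀ z ∈ frontier Ω ∩ Metric.ball x₀ r, |g (y - z) - g (y' - z) + β * ψ z| ≤ δ * ψ z) :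
    Filter.Tendsto (fun y => Θ y - c * ∫ z in frontier Ω, g (y - z) ∂μ) (𝓝[Ω] x₀)
      (𝓝 (c * β * κ)) := by
  have hcomp : IsCompact (frontier Ω) := hΩb.isCompact_closure.of_isClosed_subset
    isClosed_frontier frontier_subset_closure
  rw [Metric.tendsto_nhdsWithin_nhds]
  intro η hη
  obtain ⟨δ, hδη, hδ⟩ : ∃ δ : ℝ, |c| * (δ * (κ + δ) + |β| * δ) < η / 3 ∧ 0 < δ := by
    have h1 : ∀ᶠ δ in 𝓝 (0 : ℝ), |c| * (δ * (κ + δ) + |β| * δ) < η / 3 :=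
      ContinuousAt.eventually_lt (by fun_prop) continuousAt_const (by simpa using hη)
    exact ((h1.filter_mono (nhdsWithin_le_nhds (s := Ioi 0))).and self_mem_nhdsWithin).exists
  obtain ⟨r, hr, ρ, hρ, href⟩ := href δ hδ
  have hfarT : IsCompact (frontier Ω \ Metric.ball x₀ r) := hcomp.diff Metric.isOpen_ball
  have hfar : ContinuousAt (fun y => ∫ z in frontier Ω \ Metric.ball x₀ r, g (y - z) ∂μ) x₀ :=
    (contDiffAt_setIntegral_comp_sub hfarT ((measure_mono sdiff_subset).trans_lt hμ) hg
      (fun h => h.2 (Metric.mem_ball_self hr))).1.continuousAt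
  obtain ⟨ρ₁, hρ₁, h₁⟩ := Metric.continuousAt_iff.1 hΘ (η / 6) (by positivity)
  obtain ⟨ρ₂, hρ₂, h₂⟩ := Metric.continuousAt_iff.1 hfar (η / 6 / (|c| + 1)) (by positivity)
  refine ⟨min ρ (min (ρ₁ / 7) (ρ₂ / 7)), by positivity, fun y hy hyd => ?_⟩
  obtain ⟨hd0, hd1, hd2⟩ := by simpa only [lt_min_iff] using hyd
  obtain ⟨y', hy', hy'd, ψ, hψ, hψκ, hψg⟩ := href y hy (by rwa [← dist_eq_norm])
  rw [← dist_eq_norm, ← dist_eq_norm] at hy'd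
  have hyf : y ∉ frontier Ω := fun h => (hΩo.frontier_eq ▸ h).2 hy
  have hyf' : y' ∉ frontier Ω := fun h => hy' (frontier_subset_closure h)
  have hi := integrableOn_comp_sub hcomp hμ hg hgm hyf
  have hi' := integrableOn_comp_sub hcomp hμ hg hgm hyf'
  have hball : MeasurableSet (Metric.ball x₀ r) := Metric.isOpen_ball.measurableSet
  have hs := integral_inter_add_sdiff hball hi
  have hs' := integral_inter_add_sdiff hball hi'
  have hext' := hext y' hy'
  have hdist : 0 ≤ dist y x₀ := dist_nonneg
  have a1 := h₁ (x := y) (by linarith)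
  have a2 := h₁ (x := y') (by linarith)
  have b1 := h₂ (x := y) (by linarith)
  have b2 := h₂ (x := y') (by linarith)
  have hnear : |(∫ z in frontier Ω ∩ Metric.ball x₀ r, g (y - z) ∂μ)
      - (∫ z in frontier Ω ∩ Metric.ball x₀ r, g (y' - z) ∂μ)
      + β * ∫ z in frontier Ω ∩ Metric.ball x₀ r, ψ z ∂μ|
      ≤ δ * ∫ z in frontier Ω ∩ Metric.ball x₀ r, ψ z ∂μ := by
    have j := hi.mono_set (inter_subset_left (t := Metric.ball x₀ r))
    have j' := hi'.mono_set (inter_subset_left (t := Metric.ball x₀ r))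
    have jj : IntegrableOn (fun z => g (y - z) - g (y' - z)) (frontier Ω ∩ Metric.ball x₀ r) μ :=
      j.sub j'
    rw [← integral_sub j j', ← integral_const_mul, ← integral_const_mul,
      ← integral_add jj (hψ.const_mul β)]
    exact norm_integral_le_of_norm_le (hψ.const_mul δ)
      ((ae_restrict_mem (hcomp.measurableSet.inter hball)).mono fun z hz =>
        (Real.norm_eq_abs _).trans_le (hψg z hz))
  rw [Real.dist_eq] at a1 a2 b1 b2 ⊢
  rw [← hs]
  rw [← hs'] at hext'
  generalize (∫ z in frontier Ω ∩ Metric.ball x₀ r, g (y - z) ∂μ) = p at *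
  generalize (∫ z in frontier Ω ∩ Metric.ball x₀ r, g (y' - z) ∂μ) = p' at *
  generalize (∫ z in frontier Ω \ Metric.ball x₀ r, g (y - z) ∂μ) = q at *
  generalize (∫ z in frontier Ω \ Metric.ball x₀ r, g (y' - z) ∂μ) = q' at *
  generalize (∫ z in frontier Ω \ Metric.ball x₀ r, g (x₀ - z) ∂μ) = q₀ at *
  generalize (∫ z in frontier Ω ∩ Metric.ball x₀ r, ψ z ∂μ) = w at *
  have hq : |c| * |q' - q| ≤ η / 3 := by
    have h1 : |q' - q| ≤ η / 3 / (|c| + 1) := by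
      rw [show q' - q = (q' - q₀) - (q - q₀) by ring]
      refine (abs_sub _ _).trans ?_
      have : η / 3 / (|c| + 1) = η / 6 / (|c| + 1) + η / 6 / (|c| + 1) := by ring
      linarith
    calc |c| * |q' - q| ≤ (|c| + 1) * (η / 3 / (|c| + 1)) := by gcongr; linarith
      _ = η / 3 := by field_simp
  have hw : |p' - p - β * κ| ≤ δ * (κ + δ) + |β| * δ := by
    rw [show p' - p - β * κ = -(p - p' + β * w) + β * (w - κ) by ring]
    refine (abs_add_le _ _).trans (add_le_add ?_ ?_)
    · rw [abs_neg]
      exact hnear.trans (mul_le_mul_of_nonneg_left (by linarith [(abs_le.1 hψκ).2]) hδ.le)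
    · rw [abs_mul]
      exact mul_le_mul_of_nonneg_left hψκ (abs_nonneg _)
  have hw' := mul_le_mul_of_nonneg_left hw (abs_nonneg c)
  rw [← abs_mul] at hq hw'
  rw [show Θ y - c * (p + q) - c * β * κ = (Θ y - Θ x₀) - (Θ y' - Θ x₀) + c * (q' - q)
    + c * (p' - p - β * κ) by rw [hext']; ring]
  refine (abs_add_le _ _).trans_lt ?_
  have := abs_add_le (Θ y - Θ x₀ - (Θ y' - Θ x₀)) (c * (q' - q))
  have := abs_sub (Θ y - Θ x₀) (Θ y' - Θ x₀)
  linarith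

end JumpRelation

section MeanValue

/-- The Newtonian potential of the uniform density on `Ω`. -/
def volumePotential {n : ℕ} (Ω : Set (Eu n)) (y : Eu n) : ℝ :=
  ∫ z, newton 0 (y - z) * Ω.indicator 1 z

/-- The partial derivatives of `volumePotential Ω`. -/
def volumePotentialGrad {n : ℕ} (Ω : Set (Eu n)) (i : Fin n) (y : Eu n) : ℝ :=
  ∫ z, newtonGrad 0 i (y - z) * Ω.indicator 1 z

section

variable {n : ℕ} {Ω : Set (Eu n)}

theorem volumePotential_eq_setIntegral (hΩ : IsOpen Ω) (y : Eu n) :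
    volumePotential Ω y = ∫ z in Ω, newton 0 (y - z) := by
  rw [volumePotential, ← integral_indicator hΩ.measurableSet]
  congr 1 with z
  by_cases hz : z ∈ Ω <;> simp [hz]

theorem differentiableAt_volumePotential (hn : 2 ≤ n) (hΩ : IsOpen Ω)
    (hΩb : Bornology.IsBounded Ω) (y : Eu n) :
    DifferentiableAt ℝ (volumePotential Ω) y ∧
      (∀ i, pd i (volumePotential Ω) y = volumePotentialGrad Ω i y) ∧
      ∀ i, ContinuousAt (volumePotentialGrad Ω i) y := by
  obtain ⟨R, hR⟩ := hΩb.subset_ball 0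
  have h := hasFDerivAt_newton_potential (R := max R (‖y‖ + 1)) (y := y) hn
    (f := Ω.indicator 1) (measurable_one.indicator hΩ.measurableSet)
    (fun z => by by_cases hz : z ∈ Ω <;> simp [hz])
    (fun z hz => indicator_of_notMem (fun h =>
      hz (Metric.ball_subset_ball (le_max_left _ _) (hR h))) _)
    (mem_ball_zero_iff.2 ((lt_add_one _).trans_le (le_max_right _ _)))
  exact ⟨h.1.differentiableAt, fun i => (h.1.pd_eq i).trans (sum_smul_proj_stdVec _ i), h.2⟩

theorem lap_comp_sub_right (v : Eu n → ℝ) (x z : Eu n) :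
    lap n (fun y => v (y - z)) x = lap n v (x - z) := by
  simp only [lap_eq_sum_pd]
  refine Finset.sum_congr rfl fun i _ => ?_
  rw [← pd_comp_sub_right (v := pd i v) z]
  congr 1
  ext y
  exact pd_comp_sub_right z

theorem lap_newton_zero {x : Eu n} (hx : 0 < ‖x‖ ^ 2 + 0) : lap n (newton 0) x = 0 := by
  rw [lap_newton hx]; ring

theorem isOverdetermined_of_layer_potential {Ω : Set (Eu n)} (hn : 2 ≤ n) (hΩo : IsOpen Ω)
    (hΩconn : IsConnected Ω) (hΩb : Bornology.IsBounded Ω) {μ : Measure (Eu n)}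
    (hμ : μ (frontier Ω) < ⊤) {c κ : ℝ} (hc : 0 < c) (hκ : 0 < κ)
    (hext : ∀ y ∉ closure Ω, volumePotential Ω y = c * ∫ z in frontier Ω, newton 0 (y - z) ∂μ)
    (href : ∀ x₀ ∈ frontier Ω, ∃ ν : Eu n, ‖ν‖ = 1 ∧ ∀ δ > 0, ∃ r > 0, ∃ ρ > 0, ∀ y ∈ Ω,
      ‖y - x₀‖ < ρ → ∃ y' ∉ closure Ω, ‖y' - x₀‖ ≤ 7 * ‖y - x₀‖ ∧ ∃ ψ : Eu n → ℝ,
        IntegrableOn ψ (frontier Ω ∩ Metric.ball x₀ r) μ ∧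
        |(∫ z in frontier Ω ∩ Metric.ball x₀ r, ψ z ∂μ) - κ| ≤ δ ∧
        ∀ z ∈ frontier Ω ∩ Metric.ball x₀ r,
          (∀ i, |newtonGrad 0 i (y - z) - newtonGrad 0 i (y' - z) + 2 * ν i * ψ z| ≤ δ * ψ z) ∧
          |newton 0 (y - z) - newton 0 (y' - z)| ≤ δ * ψ z) :
    IsOverdetermined Ω
      (Ω.indicator fun y => volumePotential Ω y - c * ∫ z in frontier Ω, newton 0 (y - z) ∂μ)
      (newtonMass n) ((2 * c * κ) ^ 2) := by
  have hcomp : IsCompact (frontier Ω) := hΩb.isCompact_closure.of_isClosed_subset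
    isClosed_frontier frontier_subset_closure
  set S : Eu n → ℝ := fun y => ∫ z in frontier Ω, newton 0 (y - z) ∂μ with hS
  have hSd : ∀ y ∉ frontier Ω, ContDiffAt ℝ ∞ S y ∧
      (∀ i, pd i S y = ∫ z in frontier Ω, newtonGrad 0 i (y - z) ∂μ) ∧ lap n S y = 0 := by
    intro y hy
    obtain ⟨h1, h2, h3⟩ := contDiffAt_setIntegral_comp_sub hcomp hμ (contDiffOn_newton 0) hy
    refine ⟨h1, fun i => (h2 i).trans ?_, h3.trans ?_⟩
    · exact setIntegral_congr_fun hcomp.measurableSet fun z hz =>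
        pd_newton (sub_mem_norm_sq_add_pos hy z hz) i
    · exact setIntegral_eq_zero_of_forall_eq_zero fun z hz =>
        lap_newton_zero (sub_mem_norm_sq_add_pos hy z hz)
  have hΩf : ∀ y ∈ Ω, y ∉ frontier Ω := fun y hy h => (hΩo.frontier_eq ▸ h).2 hy
  have hV := differentiableAt_volumePotential hn hΩo hΩb
  have hVΩ : ∀ y ∈ Ω, ContDiffAt ℝ ∞ (volumePotential Ω) y ∧
      lap n (volumePotential Ω) y = newtonMass n := fun y hy =>
    newton_potential_indicator hn hΩo hΩb hy
  set u := Ω.indicator fun y => volumePotential Ω y - c * S y with hu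
  have hueq : ∀ y ∈ Ω, u =ᶠ[𝓝 y] fun y => volumePotential Ω y - c * S y := fun y hy => by
    filter_upwards [hΩo.mem_nhds hy] with z hz using indicator_of_mem hz _
  have huc : ∀ y ∈ Ω, ContDiffAt ℝ ∞ u y := fun y hy =>
    ((hVΩ y hy).1.sub (contDiffAt_const.mul (hSd y (hΩf y hy)).1)).congr_of_eventuallyEq (hueq y hy)
  have hgext : ∀ i, ∀ y ∉ closure Ω, volumePotentialGrad Ω i y
      = c * ∫ z in frontier Ω, newtonGrad 0 i (y - z) ∂μ := fun i y hy => by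
    have hyf : y ∉ frontier Ω := fun h => hy (frontier_subset_closure h)
    have h1 : volumePotential Ω =ᶠ[𝓝 y] fun y => c * S y := by
      filter_upwards [isClosed_closure.isOpen_compl.mem_nhds hy] with z hz using hext z hz
    rw [← (hV y).2.1 i, (h1.pd i).eq_of_nhds, pd_const_mul c
      ((hSd y hyf).1.differentiableAt (by simp)), (hSd y hyf).2.1 i]
  have hgrad : ∀ i, ∀ y ∈ Ω, pd i u y
      = volumePotentialGrad Ω i y - c * ∫ z in frontier Ω, newtonGrad 0 i (y - z) ∂μ :=
    fun i y hy => by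
      have hd := (hSd y (hΩf y hy)).1.differentiableAt (by simp)
      rw [((hueq y hy).pd i).eq_of_nhds, pd_sub (hV y).1 (hd.const_mul c), pd_const_mul c hd,
        (hV y).2.1 i, (hSd y (hΩf y hy)).2.1 i]
  have hzero : ∀ y ∉ Ω, u y = 0 := fun y hy => indicator_of_notMem hy _
  refine ⟨by omega, hΩo, hΩconn, hΩb, continuous_iff_continuousAt.2 fun x => ?_, hzero,
    fun y hy => (huc y hy).contDiffWithinAt, fun y hy => ?_, newtonMass_pos (by omega),
    by positivity, fun x hx => ?_⟩
  · by_cases hx : x ∈ Ω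
    · exact (huc x hx).continuousAt
    by_cases hxc : x ∈ closure Ω
    · have hxf : x ∈ frontier Ω := by rw [hΩo.frontier_eq]; exact ⟨hxc, hx⟩
      obtain ⟨ν, -, hν⟩ := href x hxf
      have h1 := tendsto_sub_setIntegral (β := 0) (κ := κ) hΩo hΩb hμ (contDiffOn_newton 0)
        (measurable_newton le_rfl) (hV x).1.continuousAt hext fun δ hδ => by
          obtain ⟨r, hr, ρ, hρ, h⟩ := hν δ hδ
          refine ⟨r, hr, ρ, hρ, fun y hy hyρ => ?_⟩
          obtain ⟨y', hy', h7, ψ, h8, h9, h10⟩ := h y hy hyρ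
          exact ⟨y', hy', h7, ψ, h8, h9, fun z hz => by simpa using (h10 z hz).2⟩
      rw [mul_zero, zero_mul] at h1
      rw [ContinuousAt, hzero x hx, nhds_eq_nhdsWithin_sup_nhdsWithin x (union_compl_self Ω).symm,
        Filter.tendsto_sup]
      refine ⟨h1.congr' ?_, tendsto_const_nhds.congr' ?_⟩
      · filter_upwards [self_mem_nhdsWithin] with y hy
          using (hueq y hy).eq_of_nhds.symm
      · filter_upwards [self_mem_nhdsWithin] with y hy using (hzero y hy).symm
    · have : u =ᶠ[𝓝 x] fun _ => (0 : ℝ) := by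
        filter_upwards [isClosed_closure.isOpen_compl.mem_nhds hxc] with y hy
          using hzero y fun h => hy (subset_closure h)
      exact continuousAt_const.congr this.symm
  · have hSy := hSd y (hΩf y hy)
    rw [lap_congr (hueq y hy), lap_sub (hVΩ y hy).1 (contDiffAt_const.mul hSy.1),
      lap_const_mul c hSy.1, hSy.2.2, (hVΩ y hy).2, mul_zero, sub_zero]
  · obtain ⟨ν, hν1, hν⟩ := href x hx
    have h1 : ∀ i, Filter.Tendsto (fun y => pd i u y) (𝓝[Ω] x) (𝓝 (c * (2 * ν i) * κ)) :=
        fun i => by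
      have h2 := tendsto_sub_setIntegral (β := 2 * ν i) (κ := κ) hΩo hΩb hμ
        (contDiffOn_newtonGrad 0 i) (measurable_newtonGrad 0 i) ((hV x).2.2 i) (hgext i)
        fun δ hδ => by
          obtain ⟨r, hr, ρ, hρ, h⟩ := hν δ hδ
          refine ⟨r, hr, ρ, hρ, fun y hy hyρ => ?_⟩
          obtain ⟨y', hy', h7, ψ, h8, h9, h10⟩ := h y hy hyρ
          exact ⟨y', hy', h7, ψ, h8, h9, fun z hz => (h10 z hz).1 i⟩
      refine h2.congr' ?_
      filter_upwards [self_mem_nhdsWithin] with y hy using (hgrad i y hy).symm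
    have h3 := tendsto_finsetSum Finset.univ fun i _ => (h1 i).pow 2
    convert h3 using 2
    have h4 : ∑ i, ν i ^ 2 = 1 := by rw [← EuclideanSpace.real_norm_sq_eq, hν1, one_pow]
    calc (2 * c * κ) ^ 2 = (2 * c * κ) ^ 2 * ∑ i, ν i ^ 2 := by rw [h4, mul_one]
      _ = _ := by rw [Finset.mul_sum]; exact Finset.sum_congr rfl fun i _ => by ring

end

theorem exists_eq_ball_of_mean_value {m : ℕ} (hm : 1 ≤ m) {Ω : Set (Eu (m + 1))}
    (hΩo : IsOpen Ω) (hΩconn : IsConnected Ω) (hΩb : Bornology.IsBounded Ω)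
    (hΩbd : HasCkBoundary ⊤ Ω)
    (hmv : ∀ h : Eu (m + 1) → ℝ, ContinuousOn h (closure Ω) →
      ContDiffOn ℝ 2 h Ω → (∀ x ∈ Ω, lap (m + 1) h x = 0) →
      (volume Ω).toReal⁻¹ * (∫ x in Ω, h x)
        = (μH[(m : ℝ)] (frontier Ω)).toReal⁻¹ * ∫ x in frontier Ω, h x ∂μH[(m : ℝ)]) :
    ∃ x₀ R, 0 < R ∧ Ω = Metric.ball x₀ R := by
  have hvol : 0 < (volume Ω).toReal :=
    ENNReal.toReal_pos (hΩo.measure_pos volume hΩconn.nonempty).ne' hΩb.measure_lt_top.ne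
  have h1 := hmv (fun _ => 1) continuousOn_const contDiffOn_const fun x _ => by
    have : ∀ i : Fin (m + 1), pd i (fun _ : Eu (m + 1) => (1 : ℝ)) = fun _ => 0 := fun i =>
      funext fun _ => pd_const 1
    simp only [lap_eq_sum_pd, this, pd_const, Finset.sum_const_zero]
  simp only [setIntegral_const, smul_eq_mul, mul_one, Measure.real] at h1
  rw [inv_mul_cancel₀ hvol.ne'] at h1
  have hσ : 0 < (μH[(m : ℝ)] (frontier Ω)).toReal := by
    refine lt_of_le_of_ne ENNReal.toReal_nonneg fun h => ?_
    rw [← h, mul_zero] at h1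
    exact one_ne_zero h1
  have hσ' : μH[(m : ℝ)] (frontier Ω) < ⊤ := (ENNReal.toReal_pos_iff.1 hσ).2
  refine (isOverdetermined_of_layer_potential (μ := μH[(m : ℝ)]) (n := m + 1) (by omega) hΩo
    hΩconn hΩb hσ' (mul_pos hvol (inv_pos.2 hσ)) (halfSpaceMass_pos (m := m)) (fun y hy => ?_)
    fun x₀ hx₀ => hΩbd.exists_reflection hΩo hx₀).exists_eq_ball
  have hpos : ∀ z ∈ closure Ω, z - y ∈ {x : Eu (m + 1) | 0 < ‖x‖ ^ 2 + 0} := fun z hz =>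
    norm_sq_add_pos_of_ne (sub_ne_zero.2 fun h => hy (h ▸ hz))
  have hcd : ContDiffOn ℝ ∞ (fun z => newton 0 (z - y)) (closure Ω) :=
    (contDiffOn_newton 0).comp (contDiff_id.sub contDiff_const).contDiffOn hpos
  have h2 := hmv (fun z => newton 0 (z - y)) hcd.continuousOn
    ((hcd.mono subset_closure).of_le (by norm_cast)) fun x hx => by
      rw [lap_comp_sub_right, lap_newton_zero (hpos x (subset_closure hx))]
  simp_rw [newton_sub_comm 0 _ y] at h2
  rw [volumePotential_eq_setIntegral hΩo, mul_assoc, ← h2, mul_inv_cancel_left₀ hvol.ne']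

theorem exists_eq_ball_of_dim_one {Ω : Set (Eu 1)} (hΩo : IsOpen Ω) (hΩconn : IsConnected Ω)
    (hΩb : Bornology.IsBounded Ω) : ∃ x₀ R, 0 < R ∧ Ω = Metric.ball x₀ R := by
  let φ : Eu 1 ≃ᵢ ℝ :=
    { toEquiv := ⟨fun x => x 0, fun a => EuclideanSpace.single 0 a,
        fun x => by ext i; fin_cases i; simp, fun a => by simp⟩
      isometry_toFun := Isometry.of_dist_eq fun x y => by
        simp [EuclideanSpace.dist_eq, Real.dist_eq, Real.sqrt_sq_eq_abs] }
  have hI : IsOpen (φ '' Ω) := φ.toHomeomorph.isOpenMap _ hΩo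
  have hIc : IsConnected (φ '' Ω) := hΩconn.image _ φ.continuous.continuousOn
  have hIb : Bornology.IsBounded (φ '' Ω) := φ.isometry.lipschitz.isBounded_image hΩb
  have hsub := hIc.Ioo_csInf_csSup_subset hIb.bddBelow hIb.bddAbove
  have heq : φ '' Ω = Ioo (sInf (φ '' Ω)) (sSup (φ '' Ω)) := by
    refine Subset.antisymm (fun x hx => ?_) hsub
    have h1 := interior_mono (subset_Icc_csInf_csSup hIb.bddBelow hIb.bddAbove)
      (hI.interior_eq.symm ▸ hx)
    rwa [interior_Icc] at h1
  generalize sInf (φ '' Ω) = a at heq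
  generalize sSup (φ '' Ω) = b at heq
  have hab : a < b := nonempty_Ioo.1 (heq ▸ hIc.nonempty)
  refine ⟨φ.symm ((a + b) / 2), (b - a) / 2, by linarith, ?_⟩
  rw [← φ.symm.image_ball, ← Real.Ioo_eq_ball, ← heq, ← image_comp]
  simp

end MeanValue

/-- **The mean value property for all harmonic functions characterizes balls.** If `Ω ⊆ ℝⁿ` is
a bounded, open, connected set with smooth boundary such that for every function `h` continuous
on `cl Ω` and harmonic in `Ω` one has `(1/|Ω|) ∫_Ω h = (1/|∂Ω|) ∮_{∂Ω} h`, then `Ω` is a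
ball. -/
theorem mean_value_characterizes_balls (n : ℕ)
    (Ω : Set (EuclideanSpace ℝ (Fin n)))
    (hΩo : IsOpen Ω) (hΩconn : IsConnected Ω) (hΩb : Bornology.IsBounded Ω)
    (hΩbd : HasCkBoundary ⊤ Ω)
    (hmv : ∀ h : EuclideanSpace ℝ (Fin n) → ℝ, ContinuousOn h (closure Ω) →
      ContDiffOn ℝ 2 h Ω → (∀ x ∈ Ω, lap n h x = 0) →
      (volume Ω).toReal⁻¹ * (∫ x in Ω, h x)
        = (μH[(n : ℝ) - 1] (frontier Ω)).toReal⁻¹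
            * ∫ x in frontier Ω, h x ∂(μH[(n : ℝ) - 1])) :
    ∃ (x₀ : EuclideanSpace ℝ (Fin n)) (R : ℝ), 0 < R ∧ Ω = Metric.ball x₀ R := by
  match n with
  | 0 =>
    obtain ⟨x, hx⟩ := hΩconn.nonempty
    refine ⟨x, 1, one_pos, ?_⟩
    ext y
    simp [Subsingleton.elim y x, hx]
  | 1 => exact exists_eq_ball_of_dim_one hΩo hΩconn hΩb
  | m + 2 =>
    have hdim : ((m + 2 : ℕ) : ℝ) - 1 = ((m + 1 : ℕ) : ℝ) := by push_cast; ring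
    rw [hdim] at hmv
    exact exists_eq_ball_of_mean_value (by omega) hΩo hΩconn hΩb hΩbd hmv
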